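/- arXiv:1903.06331 — 2 statements merged into one kernel-verified Lean document; each statement's English description precedes it below -/
import Mathlib

section
/- Let χ ∈ (0, √(6√3 + 9)/2), and suppose B1, B2 satisfy (B) and (H1), and that B2(·,t) → B_{2,∞} almost everywhere in Ω as t → ∞ for some B_{2,∞} ∈ L¹(Ω) with B_{2,∞} ≢ 0. Then for each (u0, v0) satisfying (init), the global classical solution (u, v) of the crime model satisfies u(·,t) → 0 in L^∞(Ω) and v(·,t) → v_∞ in L^∞(Ω) as t → ∞, where v_∞ solves the stationary Neumann problem −(v_∞)_xx + v_∞ = B_{2,∞} in Ω with (v_∞)_x = 0 on ∂Ω. -/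
open Real MeasureTheory Filter Topology Set
open scoped ENNReal NNReal

noncomputable section

/-- Partial derivative of a space-time function in the first (space) variable. -/
def pdx (f : ℝ → ℝ → ℝ) : ℝ → ℝ → ℝ := fun x t => deriv (fun y => f y t) x

/-- Partial derivative of a space-time function in the second (time) variable. -/
def pdt (f : ℝ → ℝ → ℝ) : ℝ → ℝ → ℝ := fun x t => deriv (fun s => f x s) t

/-- The time interval `[0, Tmax)` (with `Tmax ∈ (0,∞]`). -/
def It (Tmax : ℝ≥0∞) : Set ℝ := {t : ℝ | 0 ≤ t ∧ ENNReal.ofReal t < Tmax}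

/-- The time interval `(0, Tmax)` (with `Tmax ∈ (0,∞]`). -/
def It' (Tmax : ℝ≥0∞) : Set ℝ := {t : ℝ | 0 < t ∧ ENNReal.ofReal t < Tmax}

/-- The waiting time `τ := min{1, Tmax/3}`, as a real number. -/
def tauOf (Tmax : ℝ≥0∞) : ℝ := (min 1 (Tmax / 3)).toReal

/-- Hypothesis (B): `B` is nonnegative, bounded, and locally Hölder continuous on
`Ω̄ × [0,∞)` with some exponent `ϑ ∈ (0,1)`. -/
def HypB (a b : ℝ) (B : ℝ → ℝ → ℝ) : Prop :=
  (∀ x t : ℝ, 0 ≤ B x t) ∧ (∃ M : ℝ, ∀ x t : ℝ, B x t ≤ M) ∧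
  ∃ ϑ : ℝ, ϑ ∈ Set.Ioo (0:ℝ) 1 ∧
    ∀ K : Set (ℝ × ℝ), IsCompact K → K ⊆ (Set.Icc a b) ×ˢ (Set.Ici (0:ℝ)) →
      ∃ C : ℝ, ∀ p ∈ K, ∀ q ∈ K, |B p.1 p.2 - B q.1 q.2| ≤ C * dist p q ^ ϑ

/-- Hypothesis (init): `u0 ∈ C⁰(Ω̄)` nonnegative, `v0 ∈ W^{1,∞}(Ω)` (i.e. Lipschitz)
positive on `Ω̄`. -/
def HypInit (a b : ℝ) (u0 v0 : ℝ → ℝ) : Prop :=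
  ContinuousOn u0 (Set.Icc a b) ∧ (∀ x ∈ Set.Icc a b, 0 ≤ u0 x) ∧
  (∃ L : ℝ≥0, LipschitzOnWith L v0 (Set.Icc a b)) ∧ (∀ x ∈ Set.Icc a b, 0 < v0 x)

/-- Hypothesis (H1): `∫_0^∞ ∫_Ω B1 < ∞`. -/
def HypH1 (a b : ℝ) (B1 : ℝ → ℝ → ℝ) : Prop :=
  MeasureTheory.IntegrableOn (fun p : ℝ × ℝ => B1 p.1 p.2)
    ((Set.Ioo a b) ×ˢ (Set.Ioi (0:ℝ)))

/-- Hypothesis (H1'): `∫_t^{t+1} ∫_Ω B1 → 0` as `t → ∞`. -/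
def HypH1' (a b : ℝ) (B1 : ℝ → ℝ → ℝ) : Prop :=
  Filter.Tendsto (fun t : ℝ => ∫ s in t..(t+1), ∫ x in Set.Ioo a b, B1 x s)
    Filter.atTop (nhds 0)

/-- Hypothesis (H2): `inf_{t>0} ∫_Ω B2(·,t) > 0`. -/
def HypH2 (a b : ℝ) (B2 : ℝ → ℝ → ℝ) : Prop :=
  ∃ c : ℝ, 0 < c ∧ ∀ t : ℝ, 0 < t → c ≤ ∫ x in Set.Ioo a b, B2 x t

/-- Hypothesis (H3): `B2(·,t)` stabilizes to `B2inf ∈ L²(Ω)` in the averaged `L²` sense. -/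
def HypH3 (a b : ℝ) (B2 : ℝ → ℝ → ℝ) (B2inf : ℝ → ℝ) : Prop :=
  MeasureTheory.MemLp B2inf 2 (MeasureTheory.volume.restrict (Set.Ioo a b)) ∧
  Filter.Tendsto
    (fun t : ℝ => ∫ s in t..(t+1), ∫ x in Set.Ioo a b, (B2 x s - B2inf x)^2)
    Filter.atTop (nhds 0)

/-- A classical solution of the urban crime system
`u_t = u_xx − χ (u/v · v_x)_x − uv + B1`, `v_t = v_xx + uv − v + B2` on
`Ω̄ × [0, Tmax)`, `Ω = (a,b)`, with homogeneous Neumann boundary conditions and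
initial data `(u0, v0)`; `u, v` are positive on `Ω̄ × (0, Tmax)`, belong to
`C⁰(Ω̄ × [0,Tmax)) ∩ C^{2,1}(Ω̄ × (0,Tmax))` and `v(·,t)` lies in `W^{1,r}(Ω)`,
continuously in `t`, for every `r > 1`. -/
structure CrimeSol (a b χ : ℝ) (B1 B2 : ℝ → ℝ → ℝ) (u0 v0 : ℝ → ℝ)
    (u v : ℝ → ℝ → ℝ) (Tmax : ℝ≥0∞) : Prop where
  u_cont : ContinuousOn (fun p : ℝ × ℝ => u p.1 p.2) ((Set.Icc a b) ×ˢ It Tmax)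
  v_cont : ContinuousOn (fun p : ℝ × ℝ => v p.1 p.2) ((Set.Icc a b) ×ˢ It Tmax)
  u_init : ∀ x ∈ Set.Icc a b, u x 0 = u0 x
  v_init : ∀ x ∈ Set.Icc a b, v x 0 = v0 x
  u_pos : ∀ x ∈ Set.Icc a b, ∀ t ∈ It' Tmax, 0 < u x t
  v_pos : ∀ x ∈ Set.Icc a b, ∀ t ∈ It' Tmax, 0 < v x t
  u_reg : ∀ x ∈ Set.Icc a b, ∀ t ∈ It' Tmax,
    DifferentiableAt ℝ (fun y => u y t) x ∧
    DifferentiableAt ℝ (fun y => pdx u y t) x ∧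
    DifferentiableAt ℝ (fun s => u x s) t
  v_reg : ∀ x ∈ Set.Icc a b, ∀ t ∈ It' Tmax,
    DifferentiableAt ℝ (fun y => v y t) x ∧
    DifferentiableAt ℝ (fun y => pdx v y t) x ∧
    DifferentiableAt ℝ (fun s => v x s) t
  u_cont21 : ContinuousOn
    (fun p : ℝ × ℝ => (pdx u p.1 p.2, pdx (pdx u) p.1 p.2, pdt u p.1 p.2))
    ((Set.Icc a b) ×ˢ It' Tmax)
  v_cont21 : ContinuousOn
    (fun p : ℝ × ℝ => (pdx v p.1 p.2, pdx (pdx v) p.1 p.2, pdt v p.1 p.2))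
    ((Set.Icc a b) ×ˢ It' Tmax)
  v_W1r : ∀ r : ℝ, 1 < r →
    (∀ t ∈ It Tmax,
      MeasureTheory.IntegrableOn (fun x => |pdx v x t| ^ r) (Set.Ioo a b)) ∧
    ContinuousOn (fun t => ∫ x in Set.Ioo a b, |pdx v x t| ^ r) (It Tmax)
  u_eq : ∀ x ∈ Set.Ioo a b, ∀ t ∈ It' Tmax,
    pdt u x t = pdx (pdx u) x t
      - χ * pdx (fun y s => u y s / v y s * pdx v y s) x t
      - u x t * v x t + B1 x t
  v_eq : ∀ x ∈ Set.Ioo a b, ∀ t ∈ It' Tmax,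
    pdt v x t = pdx (pdx v) x t + u x t * v x t - v x t + B2 x t
  u_bc : ∀ t ∈ It' Tmax, pdx u a t = 0 ∧ pdx u b t = 0
  v_bc : ∀ t ∈ It' Tmax, pdx v a t = 0 ∧ pdx v b t = 0

/-- A classical solution of the stationary Neumann problem
`−w'' + w = B` in `Ω = (a,b)`, `w' = 0` on `∂Ω`. -/
def IsStationarySol (a b : ℝ) (B : ℝ → ℝ) (w : ℝ → ℝ) : Prop :=
  ContinuousOn w (Set.Icc a b) ∧
  (∀ x ∈ Set.Icc a b, DifferentiableAt ℝ w x ∧ DifferentiableAt ℝ (deriv w) x) ∧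
  (∀ x ∈ Set.Ioo a b, -(deriv (deriv w) x) + w x = B x) ∧
  deriv w a = 0 ∧ deriv w b = 0

/-- The branches `q^±(p) = (1−p)/2 · (1 ∓/± √(1 − pχ²))`. -/
def qminus (χ p : ℝ) : ℝ := (1 - p) / 2 * (1 - Real.sqrt (1 - p * χ^2))

def qplus (χ p : ℝ) : ℝ := (1 - p) / 2 * (1 + Real.sqrt (1 - p * χ^2))

/-- The auxiliary functions `φ₁, φ₂, φ₃` and the constant `p₀`. -/
def phi1 (p : ℝ) : ℝ := (p + 1) / (1 - p)

def phi2 (χ p : ℝ) : ℝ := (1 - p) / (2 * p) * (1 + Real.sqrt (1 - p * χ^2))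

def phi3 (χ p : ℝ) : ℝ := (1 - p) / (2 * p) * (1 - Real.sqrt (1 - p * χ^2))

def p0 : ℝ := (2 * Real.sqrt 3 - 3) / 3


/-! ### Calculus on a compact interval -/

/-- Joint continuity on `[a,b] × (0,∞)`. -/
def JC (a b : ℝ) (F : ℝ → ℝ → ℝ) : Prop :=
  ContinuousOn (fun p : ℝ × ℝ => F p.1 p.2) (Set.Icc a b ×ˢ Set.Ioi (0:ℝ))

/-- `C^{2,1}` regularity together with Neumann boundary conditions. -/
structure Sm (a b : ℝ) (f fx fxx ft : ℝ → ℝ → ℝ) : Prop where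
  c0 : JC a b f
  cx : JC a b fx
  cxx : JC a b fxx
  ct : JC a b ft
  dx : ∀ x ∈ Set.Icc a b, ∀ t : ℝ, 0 < t → HasDerivAt (fun y => f y t) (fx x t) x
  dxx : ∀ x ∈ Set.Icc a b, ∀ t : ℝ, 0 < t → HasDerivAt (fun y => fx y t) (fxx x t) x
  dt : ∀ x ∈ Set.Icc a b, ∀ t : ℝ, 0 < t → HasDerivAt (fun s => f x s) (ft x t) t
  bca : ∀ t : ℝ, 0 < t → fx a t = 0
  bcb : ∀ t : ℝ, 0 < t → fx b t = 0

lemma JC.slice {a b : ℝ} {F : ℝ → ℝ → ℝ} (h : JC a b F) {t : ℝ} (ht : 0 < t) :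
    ContinuousOn (fun x => F x t) (Set.Icc a b) := by
  have : ContinuousOn (fun x : ℝ => ((x, t) : ℝ × ℝ)) (Set.Icc a b) := by fun_prop
  exact ContinuousOn.comp (g := fun p : ℝ × ℝ => F p.1 p.2) h this
    (fun x hx => ⟨hx, ht⟩)

lemma JC.tslice {a b : ℝ} {F : ℝ → ℝ → ℝ} (h : JC a b F) {x : ℝ} (hx : x ∈ Set.Icc a b) :
    ContinuousOn (fun t => F x t) (Set.Ioi 0) := by
  have : ContinuousOn (fun t : ℝ => ((x, t) : ℝ × ℝ)) (Set.Ioi 0) := by fun_prop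
  exact ContinuousOn.comp (g := fun p : ℝ × ℝ => F p.1 p.2) h this
    (fun t ht => ⟨hx, ht⟩)

lemma JC.bdd {a b : ℝ} {F : ℝ → ℝ → ℝ} (h : JC a b F) {s t : ℝ} (hs : 0 < s) :
    ∃ C : ℝ, 0 ≤ C ∧ ∀ x ∈ Set.Icc a b, ∀ r ∈ Set.Icc s t, |F x r| ≤ C := by
  have hc : IsCompact (Set.Icc a b ×ˢ Set.Icc s t) := isCompact_Icc.prod isCompact_Icc
  have hsub : (Set.Icc a b ×ˢ Set.Icc s t) ⊆ Set.Icc a b ×ˢ Set.Ioi (0:ℝ) := by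
    rintro ⟨x, r⟩ ⟨hx, hr⟩
    exact ⟨hx, lt_of_lt_of_le hs hr.1⟩
  obtain ⟨C, hC⟩ := hc.exists_bound_of_continuousOn (h.mono hsub)
  refine ⟨max C 0, le_max_right _ _, fun x hx r hr => ?_⟩
  exact (hC (x, r) ⟨hx, hr⟩).trans (le_max_left _ _)

lemma cii {a b : ℝ} (hab : a < b) {f : ℝ → ℝ} (h : ContinuousOn f (Set.Icc a b)) :
    IntervalIntegrable f volume a b :=
  ContinuousOn.intervalIntegrable (by rwa [Set.uIcc_of_le hab.le])

lemma int_mono {a b : ℝ} (hab : a < b) {f g : ℝ → ℝ} (hf : ContinuousOn f (Set.Icc a b))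
    (hg : ContinuousOn g (Set.Icc a b)) (h : ∀ x ∈ Set.Icc a b, f x ≤ g x) :
    ∫ x in a..b, f x ≤ ∫ x in a..b, g x :=
  intervalIntegral.integral_mono_on hab.le (cii hab hf) (cii hab hg) h

lemma int_nonneg' {a b : ℝ} (hab : a < b) {f : ℝ → ℝ}
    (h : ∀ x ∈ Set.Icc a b, 0 ≤ f x) : 0 ≤ ∫ x in a..b, f x :=
  intervalIntegral.integral_nonneg hab.le h

/-- Differentiation under the integral sign. -/
lemma deriv_int {a b : ℝ} (hab : a < b) {F F' : ℝ → ℝ → ℝ}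
    (hF : ∀ t : ℝ, 0 < t → ContinuousOn (fun x => F x t) (Set.Icc a b)) (hF' : JC a b F')
    (hd : ∀ x ∈ Set.Icc a b, ∀ t : ℝ, 0 < t → HasDerivAt (fun s => F x s) (F' x t) t)
    {t : ℝ} (ht : 0 < t) :
    HasDerivAt (fun s => ∫ x in a..b, F x s) (∫ x in a..b, F' x t) t := by
  obtain ⟨C, hC0, hC⟩ := hF'.bdd (s := t / 2) (t := 3 * t / 2) (by linarith)
  have hs : Metric.ball t (t / 2) ∈ 𝓝 t := Metric.ball_mem_nhds _ (by linarith)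
  have hball : ∀ r ∈ Metric.ball t (t / 2), r ∈ Set.Icc (t / 2) (3 * t / 2) := by
    intro r hr
    rw [Metric.mem_ball, Real.dist_eq, abs_lt] at hr
    constructor <;> linarith [hr.1, hr.2]
  have hmeas : ∀ {f : ℝ → ℝ}, ContinuousOn f (Set.Icc a b) →
      AEStronglyMeasurable f (volume.restrict (Set.uIoc a b)) := by
    intro f hf
    rw [Set.uIoc_of_le hab.le]
    exact (hf.mono Set.Ioc_subset_Icc_self).aestronglyMeasurable measurableSet_Ioc
  have hsub : ∀ x ∈ Set.uIoc a b, x ∈ Set.Icc a b := by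
    intro x hx
    rw [Set.uIoc_of_le hab.le] at hx
    exact Set.Ioc_subset_Icc_self hx
  refine (intervalIntegral.hasDerivAt_integral_of_dominated_loc_of_deriv_le
    (F := fun s x => F x s) (F' := fun s x => F' x s) (bound := fun _ => C) hs ?_ ?_ ?_ ?_ ?_ ?_).2
  · filter_upwards [hs] with r hr
    exact hmeas (hF r (by linarith [(hball r hr).1]))
  · exact cii hab (hF t ht)
  · exact hmeas (hF'.slice ht)
  · refine Filter.Eventually.of_forall (fun x hx r hr => ?_)
    exact hC x (hsub x hx) r (hball r hr)
  · exact intervalIntegrable_const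
  · refine Filter.Eventually.of_forall (fun x hx r hr => ?_)
    exact hd x (hsub x hx) r (by linarith [(hball r hr).1])

/-- Fundamental theorem with vanishing boundary values. -/
lemma ftc0 {a b : ℝ} (hab : a < b) {g g' : ℝ → ℝ} (hg' : ContinuousOn g' (Set.Icc a b))
    (hd : ∀ x ∈ Set.Icc a b, HasDerivAt g (g' x) x) (h0 : g a = 0) (h1 : g b = 0) :
    ∫ x in a..b, g' x = 0 := by
  rw [intervalIntegral.integral_eq_sub_of_hasDerivAt (f := g) _ (cii hab hg'), h0, h1, sub_zero]
  intro x hx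
  rw [Set.uIcc_of_le hab.le] at hx
  exact hd x hx

/-- An integrand bounded by a null-divergence plus a linear combination. -/
lemma int_comb {a b : ℝ} (hab : a < b) {P g g' f1 f2 f3 f4 : ℝ → ℝ} (c1 c2 c3 c4 : ℝ)
    (hP : ContinuousOn P (Set.Icc a b))
    (hg' : ContinuousOn g' (Set.Icc a b))
    (hd : ∀ x ∈ Set.Icc a b, HasDerivAt g (g' x) x) (h0 : g a = 0) (h1 : g b = 0)
    (hf1 : ContinuousOn f1 (Set.Icc a b)) (hf2 : ContinuousOn f2 (Set.Icc a b))
    (hf3 : ContinuousOn f3 (Set.Icc a b)) (hf4 : ContinuousOn f4 (Set.Icc a b))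
    (h : ∀ x ∈ Set.Icc a b, P x ≤ g' x + (c1 * f1 x + c2 * f2 x + c3 * f3 x + c4 * f4 x)) :
    ∫ x in a..b, P x ≤ c1 * (∫ x in a..b, f1 x) + c2 * (∫ x in a..b, f2 x)
      + c3 * (∫ x in a..b, f3 x) + c4 * (∫ x in a..b, f4 x) := by
  have e1 := cii hab hf1
  have e2 := cii hab hf2
  have e3 := cii hab hf3
  have e4 := cii hab hf4
  have hle := int_mono hab hP (g := fun x => g' x + (c1 * f1 x + c2 * f2 x + c3 * f3 x + c4 * f4 x))
    (by fun_prop) h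
  refine hle.trans (le_of_eq ?_)
  rw [intervalIntegral.integral_add (cii hab hg')
    ((((e1.const_mul c1).add (e2.const_mul c2)).add (e3.const_mul c3)).add (e4.const_mul c4)),
    ftc0 hab hg' hd h0 h1, zero_add,
    intervalIntegral.integral_add (((e1.const_mul c1).add (e2.const_mul c2)).add (e3.const_mul c3))
      (e4.const_mul c4),
    intervalIntegral.integral_add ((e1.const_mul c1).add (e2.const_mul c2)) (e3.const_mul c3),
    intervalIntegral.integral_add (e1.const_mul c1) (e2.const_mul c2)]
  simp only [intervalIntegral.integral_const_mul]

/-- Static combination without divergence. -/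
lemma int_lin {a b : ℝ} (hab : a < b) {P f1 f2 : ℝ → ℝ} (c1 c2 : ℝ)
    (hP : ContinuousOn P (Set.Icc a b))
    (hf1 : ContinuousOn f1 (Set.Icc a b)) (hf2 : ContinuousOn f2 (Set.Icc a b))
    (h : ∀ x ∈ Set.Icc a b, P x ≤ c1 * f1 x + c2 * f2 x) :
    ∫ x in a..b, P x ≤ c1 * (∫ x in a..b, f1 x) + c2 * (∫ x in a..b, f2 x) := by
  have := int_comb hab (P := P) (g := fun _ => 0) (g' := fun _ => 0) (f1 := f1) (f2 := f2)
    (f3 := fun _ => 0) (f4 := fun _ => 0) c1 c2 0 0 hP (by fun_prop)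
    (fun x _ => hasDerivAt_const x 0) rfl rfl hf1 hf2 (by fun_prop) (by fun_prop)
    (fun x hx => by simpa using h x hx)
  simpa using this

lemma osc_le {a b : ℝ} (hab : a < b) {g g' h : ℝ → ℝ} (hg' : ContinuousOn g' (Set.Icc a b))
    (hd : ∀ x ∈ Set.Icc a b, HasDerivAt g (g' x) x) (hh : ContinuousOn h (Set.Icc a b))
    (hb : ∀ x ∈ Set.Icc a b, |g' x| ≤ h x) {x y : ℝ} (hx : x ∈ Set.Icc a b)
    (hy : y ∈ Set.Icc a b) : |g x - g y| ≤ ∫ z in a..b, h z := by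
  wlog hxy : y ≤ x generalizing x y
  · rw [abs_sub_comm]
    exact this hy hx (le_of_not_ge hxy)
  have hsub : Set.Icc y x ⊆ Set.Icc a b := Set.Icc_subset_Icc hy.1 hx.2
  have hi : IntervalIntegrable g' volume y x :=
    ContinuousOn.intervalIntegrable (by rw [Set.uIcc_of_le hxy]; exact hg'.mono hsub)
  have hih : IntervalIntegrable h volume y x :=
    ContinuousOn.intervalIntegrable (by rw [Set.uIcc_of_le hxy]; exact hh.mono hsub)
  rw [← intervalIntegral.integral_eq_sub_of_hasDerivAt (f := g) (f' := g') (a := y) (b := x)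
    (fun z hz => hd z (hsub (by rwa [Set.uIcc_of_le hxy] at hz))) hi]
  calc |∫ z in y..x, g' z| ≤ ∫ z in y..x, |g' z| :=
        intervalIntegral.abs_integral_le_integral_abs hxy
    _ ≤ ∫ z in y..x, h z :=
        intervalIntegral.integral_mono_on hxy hi.abs hih (fun z hz => hb z (hsub hz))
    _ ≤ ∫ z in a..b, h z := by
        refine intervalIntegral.integral_mono_interval hy.1 hxy hx.2 ?_ (cii hab hh)
        filter_upwards [ae_restrict_mem measurableSet_Ioc] with z hz
        exact (abs_nonneg _).trans (hb z (Set.Ioc_subset_Icc_self hz))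

lemma sub_mean_le {a b : ℝ} (hab : a < b) {g g' h : ℝ → ℝ} (hg' : ContinuousOn g' (Set.Icc a b))
    (hd : ∀ x ∈ Set.Icc a b, HasDerivAt g (g' x) x) (hh : ContinuousOn h (Set.Icc a b))
    (hb : ∀ x ∈ Set.Icc a b, |g' x| ≤ h x) {x : ℝ} (hx : x ∈ Set.Icc a b) :
    |g x - (∫ z in a..b, g z) / (b - a)| ≤ ∫ z in a..b, h z := by
  have hl : 0 < b - a := by linarith
  have hgc : ContinuousOn g (Set.Icc a b) := fun z hz => (hd z hz).continuousAt.continuousWithinAt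
  set H := ∫ z in a..b, h z
  have h1 : ∀ y ∈ Set.Icc a b, g y ≤ g x + H := fun y hy => by
    have := abs_le.1 (osc_le hab hg' hd hh hb hy hx); linarith [this.2]
  have h2 : ∀ y ∈ Set.Icc a b, g x - H ≤ g y := fun y hy => by
    have := abs_le.1 (osc_le hab hg' hd hh hb hy hx); linarith [this.1]
  have i1 := int_mono hab hgc (g := fun _ => g x + H) (by fun_prop) h1
  have i2 := int_mono hab (f := fun _ => g x - H) (by fun_prop) hgc h2
  simp only [intervalIntegral.integral_const, smul_eq_mul] at i1 i2
  rw [abs_le]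
  have e1 : (∫ z in a..b, g z) / (b - a) ≤ g x + H := by
    rw [div_le_iff₀ hl]; linarith
  have e2 : g x - H ≤ (∫ z in a..b, g z) / (b - a) := by
    rw [le_div_iff₀ hl]; linarith
  constructor <;> linarith

/-- `u ≤ m/λ + ε ∫ u_x²/u + m/(4ε)`. -/
lemma sup_log {a b : ℝ} (hab : a < b) {u ux : ℝ → ℝ} (hux : ContinuousOn ux (Set.Icc a b))
    (hd : ∀ x ∈ Set.Icc a b, HasDerivAt u (ux x) x) (hu : ∀ x ∈ Set.Icc a b, 0 < u x)
    {ε : ℝ} (hε : 0 < ε) {x : ℝ} (hx : x ∈ Set.Icc a b) :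
    u x ≤ (∫ z in a..b, u z) / (b - a) + ε * (∫ z in a..b, ux z ^ 2 / u z)
      + (∫ z in a..b, u z) / (4 * ε) := by
  have huc : ContinuousOn u (Set.Icc a b) := fun z hz => (hd z hz).continuousAt.continuousWithinAt
  have hq : ContinuousOn (fun z => ux z ^ 2 / u z) (Set.Icc a b) :=
    (hux.pow 2).div huc (fun z hz => (hu z hz).ne')
  have := sub_mean_le hab hux hd (h := fun z => ε * (ux z ^ 2 / u z) + (1 / (4 * ε)) * u z)
    (by fun_prop) ?_ hx
  · rw [intervalIntegral.integral_add ((cii hab hq).const_mul _) ((cii hab huc).const_mul _),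
      intervalIntegral.integral_const_mul, intervalIntegral.integral_const_mul] at this
    have h2 := (abs_le.1 this).2
    have : (1 / (4 * ε)) * (∫ z in a..b, u z) = (∫ z in a..b, u z) / (4 * ε) := by ring
    linarith
  · intro z hz
    have h0 := hu z hz
    have key : ε * (ux z ^ 2 / u z) + (1 / (4 * ε)) * u z - |ux z|
        = (2 * ε * |ux z| - u z) ^ 2 / (4 * ε * u z) := by
      rw [← sq_abs (ux z)]
      field_simp
      ring
    have : 0 ≤ (2 * ε * |ux z| - u z) ^ 2 / (4 * ε * u z) := by positivity
    linarith

/-- `|f| ≤ |mean| + ε ∫ f_x² + λ/(4ε)` in the form of a distance to the mean. -/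
lemma sup_lin {a b : ℝ} (hab : a < b) {f fx : ℝ → ℝ} (hfx : ContinuousOn fx (Set.Icc a b))
    (hd : ∀ x ∈ Set.Icc a b, HasDerivAt f (fx x) x)
    {ε : ℝ} (hε : 0 < ε) {x : ℝ} (hx : x ∈ Set.Icc a b) :
    |f x - (∫ z in a..b, f z) / (b - a)| ≤ ε * (∫ z in a..b, fx z ^ 2) + (b - a) / (4 * ε) := by
  have := sub_mean_le hab hfx hd (h := fun z => ε * (fx z ^ 2) + (1 / (4 * ε)))
    (by fun_prop) ?_ hx
  · rw [intervalIntegral.integral_add ((cii hab (by fun_prop : ContinuousOn (fun z => fx z ^ 2) (Set.Icc a b))).const_mul _)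
      intervalIntegrable_const,
      intervalIntegral.integral_const_mul, intervalIntegral.integral_const, smul_eq_mul] at this
    have e : (b - a) * (1 / (4 * ε)) = (b - a) / (4 * ε) := by ring
    linarith
  · intro z hz
    have key : ε * (fx z ^ 2) + (1 / (4 * ε)) - |fx z|
        = (2 * ε * |fx z| - 1) ^ 2 / (4 * ε) := by
      rw [← sq_abs (fx z)]
      field_simp
      ring
    have : 0 ≤ (2 * ε * |fx z| - 1) ^ 2 / (4 * ε) := by positivity
    linarith

lemma sq_aux {ε : ℝ} (hε : 0 < ε) (p q : ℝ) : |2 * p * q| ≤ ε * q ^ 2 + (1 / ε) * p ^ 2 := by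
  have h1 : ε * q ^ 2 + (1 / ε) * p ^ 2 - 2 * p * q = (ε * q - p) ^ 2 / ε := by
    field_simp; ring
  have h2 : ε * q ^ 2 + (1 / ε) * p ^ 2 + 2 * p * q = (ε * q + p) ^ 2 / ε := by
    field_simp; ring
  have h3 : 0 ≤ (ε * q - p) ^ 2 / ε := by positivity
  have h4 : 0 ≤ (ε * q + p) ^ 2 / ε := by positivity
  rw [abs_le]; constructor <;> linarith

lemma sq_osc {a b : ℝ} (hab : a < b) {f fx : ℝ → ℝ} (hfx : ContinuousOn fx (Set.Icc a b))
    (hd : ∀ x ∈ Set.Icc a b, HasDerivAt f (fx x) x)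
    {ε : ℝ} (hε : 0 < ε) :
    ContinuousOn (fun z => 2 * f z * fx z) (Set.Icc a b) ∧
    (∀ x ∈ Set.Icc a b, HasDerivAt (fun z => f z ^ 2) (2 * f x * fx x) x) ∧
    ContinuousOn (fun z => ε * fx z ^ 2 + (1 / ε) * f z ^ 2) (Set.Icc a b) ∧
    (∫ z in a..b, (ε * fx z ^ 2 + (1 / ε) * f z ^ 2)) =
      ε * (∫ z in a..b, fx z ^ 2) + (1 / ε) * (∫ z in a..b, f z ^ 2) := by
  have hfc : ContinuousOn f (Set.Icc a b) := fun z hz => (hd z hz).continuousAt.continuousWithinAt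
  refine ⟨by fun_prop, fun x hx => ?_, by fun_prop, ?_⟩
  · have := (hd x hx).fun_pow 2
    simpa using this
  · rw [intervalIntegral.integral_add
      ((cii hab (by fun_prop : ContinuousOn (fun z => fx z ^ 2) (Set.Icc a b))).const_mul _)
      ((cii hab (by fun_prop : ContinuousOn (fun z => f z ^ 2) (Set.Icc a b))).const_mul _),
      intervalIntegral.integral_const_mul, intervalIntegral.integral_const_mul]

lemma sup_sq {a b : ℝ} (hab : a < b) {f fx : ℝ → ℝ} (hfx : ContinuousOn fx (Set.Icc a b))
    (hd : ∀ x ∈ Set.Icc a b, HasDerivAt f (fx x) x)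
    {ε : ℝ} (hε : 0 < ε) {x : ℝ} (hx : x ∈ Set.Icc a b) :
    f x ^ 2 ≤ (∫ z in a..b, f z ^ 2) / (b - a) + ε * (∫ z in a..b, fx z ^ 2)
      + (1 / ε) * (∫ z in a..b, f z ^ 2) := by
  obtain ⟨h1, h2, h3, h4⟩ := sq_osc hab hfx hd hε
  have := sub_mean_le hab h1 h2 h3 (fun z _ => sq_aux hε _ _) hx
  rw [h4] at this
  linarith [(abs_le.1 this).2]

lemma sup_sq0 {a b : ℝ} (hab : a < b) {f fx : ℝ → ℝ} (hfx : ContinuousOn fx (Set.Icc a b))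
    (hd : ∀ x ∈ Set.Icc a b, HasDerivAt f (fx x) x) (h0 : f a = 0)
    {ε : ℝ} (hε : 0 < ε) {x : ℝ} (hx : x ∈ Set.Icc a b) :
    f x ^ 2 ≤ ε * (∫ z in a..b, fx z ^ 2) + (1 / ε) * (∫ z in a..b, f z ^ 2) := by
  obtain ⟨h1, h2, h3, h4⟩ := sq_osc hab hfx hd hε
  have := osc_le hab h1 h2 h3 (fun z _ => sq_aux hε _ _) hx (Set.left_mem_Icc.2 hab.le)
  rw [h4] at this
  simp only [h0] at this
  have := (abs_le.1 this).2
  linarith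

/-- The derivative of the Dirichlet integral, only using `C^{2,1}` regularity. -/
lemma deriv_dirichlet {a b : ℝ} (hab : a < b) {f fx fxx ft : ℝ → ℝ → ℝ}
    (S : Sm a b f fx fxx ft) {t : ℝ} (ht : 0 < t) :
    HasDerivAt (fun s => ∫ x in a..b, fx x s ^ 2) (∫ x in a..b, -2 * (ft x t * fxx x t)) t := by
  rw [hasDerivAt_iff_tendsto_slope]
  obtain ⟨C, hC0, hC⟩ := S.ct.bdd (s := t / 2) (t := 3 * t / 2) (by linarith)
  obtain ⟨C', hC0', hC'⟩ := S.cxx.bdd (s := t / 2) (t := 3 * t / 2) (by linarith)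
  have hball : ∀ r ∈ Metric.ball t (t / 2), r ∈ Set.Icc (t / 2) (3 * t / 2) := by
    intro r hr
    rw [Metric.mem_ball, Real.dist_eq, abs_lt] at hr
    constructor <;> linarith [hr.1, hr.2]
  have htI : t ∈ Set.Icc (t / 2) (3 * t / 2) := ⟨by linarith, by linarith⟩
  have hs : ∀ᶠ r in 𝓝[≠] t, r ∈ Metric.ball t (t / 2) :=
    nhdsWithin_le_nhds (Metric.ball_mem_nhds _ (by linarith))
  have hne : ∀ᶠ r in 𝓝[≠] t, r ≠ t := eventually_mem_nhdsWithin
  have hsub : ∀ x ∈ Set.uIoc a b, x ∈ Set.Icc a b := by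
    intro x hx
    rw [Set.uIoc_of_le hab.le] at hx
    exact Set.Ioc_subset_Icc_self hx
  have key : ∀ r : ℝ, 0 < r → r ≠ t → slope (fun s => ∫ x in a..b, fx x s ^ 2) t r =
      ∫ x in a..b, -((f x r - f x t) / (r - t) * (fxx x r + fxx x t)) := by
    intro r hr hrt
    have hrt' : r - t ≠ 0 := sub_ne_zero.2 hrt
    have c1 := S.cx.slice hr
    have c2 := S.cx.slice ht
    have c3 := S.cxx.slice hr
    have c4 := S.cxx.slice ht
    have c5 := S.c0.slice hr
    have c6 := S.c0.slice ht
    have hz := ftc0 hab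
      (g := fun x => (f x r - f x t) * (fx x r + fx x t))
      (g' := fun x => (fx x r - fx x t) * (fx x r + fx x t) + (f x r - f x t) * (fxx x r + fxx x t))
      (by fun_prop)
      (fun x hx => ((S.dx x hx r hr).sub (S.dx x hx t ht)).mul
        ((S.dxx x hx r hr).add (S.dxx x hx t ht)))
      (by simp [S.bca r hr, S.bca t ht]) (by simp [S.bcb r hr, S.bcb t ht])
    rw [slope_def_field, ← intervalIntegral.integral_sub
      (cii hab (by fun_prop : ContinuousOn (fun x => fx x r ^ 2) (Set.Icc a b)))
      (cii hab (by fun_prop : ContinuousOn (fun x => fx x t ^ 2) (Set.Icc a b)))]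
    have e1 : (∫ x in a..b, (fx x r ^ 2 - fx x t ^ 2)) =
        ∫ x in a..b, -((f x r - f x t) * (fxx x r + fxx x t)) := by
      rw [← sub_eq_zero, ← intervalIntegral.integral_sub]
      · rw [← hz]
        congr 1; ext x; ring
      · exact cii hab (by fun_prop)
      · exact cii hab (by fun_prop)
    rw [e1, div_eq_inv_mul, ← intervalIntegral.integral_const_mul]
    congr 1; ext x; field_simp
  have hcongr : ∀ᶠ r in 𝓝[≠] t,
      (∫ x in a..b, -((f x r - f x t) / (r - t) * (fxx x r + fxx x t))) =
      slope (fun s => ∫ x in a..b, fx x s ^ 2) t r := by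
    filter_upwards [hs, hne] with r h1 h2
    exact (key r (by linarith [(hball r h1).1]) h2).symm
  refine Tendsto.congr' hcongr ?_
  refine intervalIntegral.tendsto_integral_filter_of_dominated_convergence
    (fun _ => C * (C' + C')) ?_ ?_ intervalIntegrable_const ?_
  · filter_upwards [hs] with r h1
    have hr : 0 < r := by linarith [(hball r h1).1]
    have c3 := S.cxx.slice hr
    have c4 := S.cxx.slice ht
    have c5 := S.c0.slice hr
    have c6 := S.c0.slice ht
    rw [Set.uIoc_of_le hab.le]
    refine ContinuousOn.aestronglyMeasurable ?_ measurableSet_Ioc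
    refine ContinuousOn.mono (s := Set.Icc a b) ?_ Set.Ioc_subset_Icc_self
    fun_prop
  · filter_upwards [hs, hne] with r h1 h2
    refine Filter.Eventually.of_forall (fun x hx => ?_)
    have hx' := hsub x hx
    have hrI := hball r h1
    have hL : |f x r - f x t| ≤ C * |r - t| := by
      have := Convex.norm_image_sub_le_of_norm_hasDerivWithin_le (f := fun s => f x s)
        (f' := fun s => ft x s) (C := C) (s := Set.Icc (t / 2) (3 * t / 2)) (x := t) (y := r)
        (fun s hs' => (S.dt x hx' s (by linarith [hs'.1])).hasDerivWithinAt)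
        (fun s hs' => hC x hx' s hs') (convex_Icc _ _) htI hrI
      simpa [Real.norm_eq_abs] using this
    have hpos : 0 < |r - t| := abs_pos.2 (sub_ne_zero.2 h2)
    rw [Real.norm_eq_abs, abs_neg, abs_mul, abs_div]
    refine mul_le_mul ?_ ?_ (abs_nonneg _) hC0
    · rw [div_le_iff₀ hpos]; exact hL
    · exact (abs_add_le _ _).trans (add_le_add (hC' x hx' r hrI) (hC' x hx' t htI))
  · refine Filter.Eventually.of_forall (fun x hx => ?_)
    have hx' := hsub x hx
    have t1 : Tendsto (fun r => (f x r - f x t) / (r - t)) (𝓝[≠] t) (𝓝 (ft x t)) := by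
      have := hasDerivAt_iff_tendsto_slope.1 (S.dt x hx' t ht)
      refine this.congr (fun r => ?_)
      rw [slope_def_field]
    have t2 : Tendsto (fun r => fxx x r) (𝓝[≠] t) (𝓝 (fxx x t)) := by
      have := (S.cxx.tslice hx').continuousAt (Ioi_mem_nhds ht)
      exact this.tendsto.mono_left nhdsWithin_le_nhds
    have := (t1.mul (t2.add_const (fxx x t))).neg
    convert this using 2
    ring

/-! ### Ordinary differential inequalities -/

lemma le_of_deriv_nonpos {f f' : ℝ → ℝ} {s t : ℝ} (hst : s ≤ t)
    (hd : ∀ r ∈ Set.Icc s t, HasDerivAt f (f' r) r) (h : ∀ r ∈ Set.Icc s t, f' r ≤ 0) :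
    f t ≤ f s := by
  have : AntitoneOn f (Set.Icc s t) := by
    refine antitoneOn_of_deriv_nonpos (convex_Icc s t)
      (fun r hr => (hd r hr).continuousAt.continuousWithinAt) ?_ ?_
    · intro r hr
      rw [interior_Icc] at hr
      exact (hd r (Set.Ioo_subset_Icc_self hr)).differentiableAt.differentiableWithinAt
    · intro r hr
      rw [interior_Icc] at hr
      rw [(hd r (Set.Ioo_subset_Icc_self hr)).deriv]
      exact h r (Set.Ioo_subset_Icc_self hr)
  exact this (Set.left_mem_Icc.2 hst) (Set.right_mem_Icc.2 hst) hst

lemma gron {y y' θ θ' : ℝ → ℝ} {s t : ℝ} (hst : s ≤ t)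
    (hy : ∀ r ∈ Set.Icc s t, HasDerivAt y (y' r) r)
    (hθ : ∀ r ∈ Set.Icc s t, HasDerivAt θ (θ' r) r)
    (h : ∀ r ∈ Set.Icc s t, y' r ≤ θ' r * y r) :
    y t ≤ y s * Real.exp (θ t - θ s) := by
  have := le_of_deriv_nonpos (f := fun r => y r * Real.exp (-θ r))
    (f' := fun r => y' r * Real.exp (-θ r) + y r * (Real.exp (-θ r) * -θ' r)) hst
    (fun r hr => (hy r hr).mul ((hθ r hr).neg.exp)) ?_
  · have e : Real.exp (θ t - θ s) = Real.exp (θ t) * Real.exp (-θ s) := by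
      rw [← Real.exp_add]; ring_nf
    have e2 : Real.exp (θ t) * Real.exp (-θ t) = 1 := by
      rw [← Real.exp_add]; simp
    calc y t = y t * Real.exp (-θ t) * Real.exp (θ t) := by
          rw [mul_assoc, mul_comm (Real.exp (-θ t)), e2, mul_one]
      _ ≤ y s * Real.exp (-θ s) * Real.exp (θ t) :=
          mul_le_mul_of_nonneg_right this (Real.exp_pos _).le
      _ = y s * Real.exp (θ t - θ s) := by rw [e]; ring
  · intro r hr
    have h1 := h r hr
    have h2 := Real.exp_pos (-θ r)
    have : y' r * Real.exp (-θ r) + y r * (Real.exp (-θ r) * -θ' r)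
      = (y' r - θ' r * y r) * Real.exp (-θ r) := by ring
    rw [this]
    exact mul_nonpos_of_nonpos_of_nonneg (by linarith) h2.le

lemma mvt1 {y y' : ℝ → ℝ} {T0 t : ℝ} (hy : ∀ r, T0 ≤ r → HasDerivAt y (y' r) r)
    (ht : T0 + 1 ≤ t) : ∃ s, T0 ≤ s ∧ t - 1 ≤ s ∧ s ≤ t ∧ y' s = y t - y (t - 1) := by
  obtain ⟨s, hs, h⟩ := exists_hasDerivAt_eq_slope y y' (a := t - 1) (b := t) (by linarith)
    (fun r hr => (hy r (by linarith [hr.1])).continuousAt.continuousWithinAt)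
    (fun r hr => hy r (by linarith [hr.1]))
  refine ⟨s, by linarith [hs.1], hs.1.le, hs.2.le, ?_⟩
  rw [h]; simp

lemma tail_small {bb β : ℝ → ℝ} {l : ℝ} (hβ : ∀ t : ℝ, 0 < t → HasDerivAt β (bb t) t)
    (hb : ∀ t : ℝ, 0 < t → 0 ≤ bb t) (hl : Tendsto β atTop (𝓝 l)) :
    (∀ s t : ℝ, 0 < s → s ≤ t → β s ≤ β t) ∧ (∀ s : ℝ, 0 < s → β s ≤ l) := by
  have hm : ∀ s t : ℝ, 0 < s → s ≤ t → β s ≤ β t := by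
    intro s t hs hst
    have := le_of_deriv_nonpos (f := fun r => - β r) (f' := fun r => - bb r) hst
      (fun r hr => (hβ r (by linarith [hr.1])).neg)
      (fun r hr => by have := hb r (by linarith [hr.1]); linarith)
    linarith
  refine ⟨hm, fun s hs => ?_⟩
  refine ge_of_tendsto hl ?_
  filter_upwards [eventually_ge_atTop s] with t ht using hm s t hs ht

lemma y_decay {y y' bb β : ℝ → ℝ} {c l T κ t : ℝ} (hc : 0 < c) (hT : 0 < T)
    (hβ : ∀ t : ℝ, 0 < t → HasDerivAt β (bb t) t)
    (hb : ∀ t : ℝ, 0 < t → 0 ≤ bb t) (hl : Tendsto β atTop (𝓝 l))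
    (hy : ∀ t, T ≤ t → HasDerivAt y (y' t) t)
    (hle : ∀ t, T ≤ t → y' t ≤ -c * y t + c * κ + bb t) (ht : T ≤ t) :
    y t ≤ κ + (y T - κ) * Real.exp (-c * (t - T)) + (l - β T) := by
  obtain ⟨hm, hml⟩ := tail_small hβ hb hl
  have := gron (y := fun r => y r - κ - (β r - β T)) (y' := fun r => y' r - bb r)
    (θ := fun r => -c * r) (θ' := fun _ => -c) ht
    (fun r hr => by
      have h1 := ((hy r hr.1).sub_const κ).sub ((hβ r (by linarith [hr.1])).sub_const (β T))
      exact h1)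
    (fun r _ => by simpa using (hasDerivAt_id r).const_mul (-c))
    (fun r hr => by
      have h1 := hle r hr.1
      have h2 := hm T r hT hr.1
      nlinarith)
  have h2 := hml t (by linarith)
  simp only [sub_self, sub_zero] at this
  have e : -c * t - -c * T = -c * (t - T) := by ring
  rw [e] at this
  linarith

lemma y_bdd {y y' bb β : ℝ → ℝ} {c l T K : ℝ} (hc : 0 < c) (hT : 0 < T)
    (hβ : ∀ t : ℝ, 0 < t → HasDerivAt β (bb t) t)
    (hb : ∀ t : ℝ, 0 < t → 0 ≤ bb t) (hl : Tendsto β atTop (𝓝 l))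
    (hy : ∀ t, T ≤ t → HasDerivAt y (y' t) t)
    (hle : ∀ t, T ≤ t → y' t ≤ -c * y t + K + bb t) :
    ∃ C : ℝ, 0 ≤ C ∧ ∀ t, T ≤ t → y t ≤ C := by
  refine ⟨|K / c| + |y T - K / c| + |l - β T|, by positivity, fun t ht => ?_⟩
  have := y_decay (κ := K / c) hc hT hβ hb hl hy (fun t ht => by
    have := hle t ht
    rwa [mul_div_cancel₀ _ hc.ne']) ht
  have h1 : Real.exp (-c * (t - T)) ≤ 1 := by
    rw [Real.exp_le_one_iff]; nlinarith
  have h2 := Real.exp_pos (-c * (t - T))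
  have h3 : (y T - K / c) * Real.exp (-c * (t - T)) ≤ |y T - K / c| := by
    calc _ ≤ |y T - K / c| * Real.exp (-c * (t - T)) :=
          mul_le_mul_of_nonneg_right (le_abs_self _) h2.le
      _ ≤ |y T - K / c| * 1 := mul_le_mul_of_nonneg_left h1 (abs_nonneg _)
      _ = _ := mul_one _
  linarith [le_abs_self (K / c), le_abs_self (l - β T)]

lemma y_tendsto {y y' h bb β : ℝ → ℝ} {c l T0 : ℝ} (hc : 0 < c) (hT0 : 0 < T0)
    (hβ : ∀ t : ℝ, 0 < t → HasDerivAt β (bb t) t)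
    (hb : ∀ t : ℝ, 0 < t → 0 ≤ bb t) (hl : Tendsto β atTop (𝓝 l))
    (hy : ∀ t, T0 ≤ t → HasDerivAt y (y' t) t) (hy0 : ∀ t, T0 ≤ t → 0 ≤ y t)
    (hle : ∀ t, T0 ≤ t → y' t ≤ -c * y t + h t + bb t) (hh : Tendsto h atTop (𝓝 0)) :
    Tendsto y atTop (𝓝 0) := by
  rw [Metric.tendsto_atTop]
  intro ε hε
  have e1 : ∀ᶠ t in atTop, h t ≤ c * (ε / 4) :=
    hh.eventually_le_const (by positivity)
  have e2 : ∀ᶠ t in atTop, l - ε / 4 < β t := hl.eventually_const_lt (by linarith)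
  obtain ⟨T1, hT1⟩ := eventually_atTop.1 (e1.and e2)
  set T := max T0 T1
  have hTT0 : T0 ≤ T := le_max_left _ _
  have hTT1 : T1 ≤ T := le_max_right _ _
  have hT : 0 < T := by linarith
  have key := fun t ht => y_decay (κ := ε / 4) (t := t) hc hT hβ hb hl
    (fun t ht => hy t (hTT0.trans ht)) (fun t ht => by
      have h1 := hle t (hTT0.trans ht)
      have h2 := (hT1 t (hTT1.trans ht)).1
      linarith) ht
  have hexp : Tendsto (fun t => (y T - ε / 4) * Real.exp (-c * (t - T))) atTop (𝓝 0) := by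
    have h1 : Tendsto (fun t : ℝ => -c * (t - T)) atTop atBot := by
      have : Tendsto (fun t : ℝ => t - T) atTop atTop := tendsto_atTop_add_const_right _ _ tendsto_id
      exact this.const_mul_atTop_of_neg (by linarith)
    simpa using (Real.tendsto_exp_atBot.comp h1).const_mul (y T - ε / 4)
  have e3 := hexp.eventually_lt_const (show (0:ℝ) < ε / 4 by linarith)
  obtain ⟨T2, hT2⟩ := eventually_atTop.1 e3
  refine ⟨max T T2, fun t ht => ?_⟩
  have htT : T ≤ t := (le_max_left _ _).trans ht
  have h1 := key t htT
  have h2 := hT2 t ((le_max_right _ _).trans ht)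
  have h3 := (hT1 T hTT1).2
  have h4 := hy0 t (hTT0.trans htT)
  rw [Real.dist_eq, sub_zero, abs_of_nonneg h4]
  linarith

/-- Coming down from infinity for a Bernoulli type inequality. -/
lemma bernoulli_bound {S S' ell ell' : ℝ → ℝ} {c K K1 T0 : ℝ} (hc : 0 < c)
    (hS : ∀ t, T0 ≤ t → HasDerivAt S (S' t) t) (hS1 : ∀ t, T0 ≤ t → 0 < S t)
    (hell : ∀ t, T0 ≤ t → HasDerivAt ell (ell' t) t) (hK1 : ∀ t, T0 ≤ t → |ell t| ≤ K1)
    (hK : 0 ≤ K)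
    (h : ∀ t, T0 ≤ t → S' t ≤ -c * S t ^ 2 + K * (ell' t + K) * S t) :
    ∀ t, T0 + 1 ≤ t → S t ≤ Real.exp (2 * K * K1 + K ^ 2) / c := by
  intro t ht
  set G : ℝ → ℝ := fun s => K * (ell s + K * s) with hG
  have hGd : ∀ s, T0 ≤ s → HasDerivAt G (K * (ell' s + K)) s := by
    intro s hs
    have := ((hell s hs).add ((hasDerivAt_id s).const_mul K)).const_mul K
    simpa using this
  set g0 := Real.exp (K * (-K1 + K * (t - 1)))
  have hg0 : ∀ s ∈ Set.Icc (t - 1) t, g0 ≤ Real.exp (G s) := by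
    intro s hs
    apply Real.exp_le_exp.2
    have h1 := (abs_le.1 (hK1 s (by linarith [hs.1]))).1
    apply mul_le_mul_of_nonneg_left _ hK
    have := mul_le_mul_of_nonneg_left hs.1 hK
    linarith
  have := le_of_deriv_nonpos (s := t - 1) (t := t)
    (f := fun s => c * g0 * s - Real.exp (G s) / S s)
    (f' := fun s => c * g0 - (Real.exp (G s) * (K * (ell' s + K)) * S s - Real.exp (G s) * S' s)
      / S s ^ 2)
    (by linarith) (fun s hs => by
      have hs' : T0 ≤ s := by linarith [hs.1]
      have h1 := ((hGd s hs').exp).div (hS s hs') (hS1 s hs').ne'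
      have h2 := ((hasDerivAt_id s).const_mul (c * g0)).sub h1
      exact HasDerivAt.congr_deriv h2 (by simp)) (fun s hs => by
      have hs' : T0 ≤ s := by linarith [hs.1]
      have hp := hS1 s hs'
      have h1 := h s hs'
      have h2 := hg0 s hs
      have h3 := Real.exp_pos (G s)
      rw [sub_nonpos, le_div_iff₀ (by positivity)]
      have h4 : Real.exp (G s) * S' s ≤
        Real.exp (G s) * (-c * S s ^ 2 + K * (ell' s + K) * S s) :=
        mul_le_mul_of_nonneg_left h1 h3.le
      have h5 : g0 * (c * S s ^ 2) ≤ Real.exp (G s) * (c * S s ^ 2) :=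
        mul_le_mul_of_nonneg_right h2 (by positivity)
      nlinarith)
  have hp := hS1 t (by linarith)
  have hp1 := hS1 (t - 1) (by linarith)
  have h6 : 0 < Real.exp (G (t - 1)) / S (t - 1) := div_pos (Real.exp_pos _) hp1
  have h7 : c * g0 ≤ Real.exp (G t) / S t := by
    have h7 : c * g0 * t - Real.exp (G t) / S t
      ≤ c * g0 * (t - 1) - Real.exp (G (t - 1)) / S (t - 1) := this
    linarith
  rw [le_div_iff₀ hp] at h7
  rw [le_div_iff₀ hc]
  have h8 : Real.exp (G t) ≤ g0 * Real.exp (2 * K * K1 + K ^ 2) := by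
    rw [← Real.exp_add]
    apply Real.exp_le_exp.2
    have h1 := (abs_le.1 (hK1 t (by linarith))).2
    have := mul_le_mul_of_nonneg_left h1 hK
    simp only [hG]
    nlinarith
  have hgp : 0 < g0 := Real.exp_pos _
  have h9 : g0 * (S t * c) ≤ g0 * Real.exp (2 * K * K1 + K ^ 2) := by
    nlinarith
  exact le_of_mul_le_mul_left h9 hgp

/-! ### The system in the variables `u` and `w = log v` -/

structure Sys (a b χ M : ℝ) (u ux uxx ut w wx wxx wt B1 B2 : ℝ → ℝ → ℝ) : Prop where
  hab : a < b
  hM : 0 ≤ M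
  su : Sm a b u ux uxx ut
  sw : Sm a b w wx wxx wt
  upos : ∀ x ∈ Set.Icc a b, ∀ t : ℝ, 0 < t → 0 < u x t
  cB1 : JC a b B1
  cB2 : JC a b B2
  B1nn : ∀ x t, 0 ≤ B1 x t
  B2nn : ∀ x t, 0 ≤ B2 x t
  B1M : ∀ x t, B1 x t ≤ M
  B2M : ∀ x t, B2 x t ≤ M
  equ : ∀ x ∈ Set.Icc a b, ∀ t : ℝ, 0 < t → ut x t = uxx x t
    - χ * (ux x t * wx x t + u x t * wxx x t) - u x t * Real.exp (w x t) + B1 x t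
  eqw : ∀ x ∈ Set.Icc a b, ∀ t : ℝ, 0 < t → wt x t = wxx x t + wx x t ^ 2 + u x t - 1
    + B2 x t * Real.exp (-w x t)

namespace Sys

variable {a b χ M : ℝ} {u ux uxx ut w wx wxx wt B1 B2 : ℝ → ℝ → ℝ}

/-- The slice continuity facts. -/
lemma slices (S : Sys a b χ M u ux uxx ut w wx wxx wt B1 B2) {t : ℝ} (ht : 0 < t) :
    ContinuousOn (fun x => u x t) (Set.Icc a b) ∧ ContinuousOn (fun x => ux x t) (Set.Icc a b) ∧
    ContinuousOn (fun x => uxx x t) (Set.Icc a b) ∧ ContinuousOn (fun x => ut x t) (Set.Icc a b) ∧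
    ContinuousOn (fun x => w x t) (Set.Icc a b) ∧ ContinuousOn (fun x => wx x t) (Set.Icc a b) ∧
    ContinuousOn (fun x => wxx x t) (Set.Icc a b) ∧ ContinuousOn (fun x => wt x t) (Set.Icc a b) ∧
    ContinuousOn (fun x => B1 x t) (Set.Icc a b) ∧ ContinuousOn (fun x => B2 x t) (Set.Icc a b) ∧
    ContinuousOn (fun x => Real.exp (w x t)) (Set.Icc a b) ∧
    ContinuousOn (fun x => Real.exp (-w x t)) (Set.Icc a b) ∧
    ContinuousOn (fun x => Real.exp (-2 * w x t)) (Set.Icc a b) := by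
  have := S.sw.c0.slice ht
  exact ⟨S.su.c0.slice ht, S.su.cx.slice ht, S.su.cxx.slice ht, S.su.ct.slice ht,
    S.sw.c0.slice ht, S.sw.cx.slice ht, S.sw.cxx.slice ht, S.sw.ct.slice ht,
    S.cB1.slice ht, S.cB2.slice ht, by fun_prop, by fun_prop, by fun_prop⟩

/-- The flux derivative. -/
lemma flux (S : Sys a b χ M u ux uxx ut w wx wxx wt B1 B2) {t : ℝ} (ht : 0 < t)
    {x : ℝ} (hx : x ∈ Set.Icc a b) :
    HasDerivAt (fun y => ux y t - χ * (u y t * wx y t))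
      (uxx x t - χ * (ux x t * wx x t + u x t * wxx x t)) x :=
  (S.su.dxx x hx t ht).sub (((S.su.dx x hx t ht).mul (S.sw.dxx x hx t ht)).const_mul χ)

lemma mass (S : Sys a b χ M u ux uxx ut w wx wxx wt B1 B2) {t : ℝ} (ht : 0 < t) :
    HasDerivAt (fun s => ∫ x in a..b, u x s) (∫ x in a..b, ut x t) t ∧
    ∫ x in a..b, ut x t ≤ -(∫ x in a..b, u x t * Real.exp (w x t)) + ∫ x in a..b, B1 x t := by
  obtain ⟨c1, c2, c3, c4, c5, c6, c7, c8, c9, c10, c11, c12, c13⟩ := S.slices ht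
  refine ⟨deriv_int S.hab (fun t ht => S.su.c0.slice ht) S.su.ct S.su.dt ht, ?_⟩
  have := int_comb S.hab (P := fun x => ut x t) (g := fun y => ux y t - χ * (u y t * wx y t))
    (g' := fun x => uxx x t - χ * (ux x t * wx x t + u x t * wxx x t))
    (f1 := fun x => u x t * Real.exp (w x t)) (f2 := fun x => B1 x t)
    (f3 := fun _ => 0) (f4 := fun _ => 0) (-1) 1 0 0 c4 (by fun_prop)
    (fun x hx => S.flux ht hx) (by simp [S.su.bca t ht, S.sw.bca t ht])
    (by simp [S.su.bcb t ht, S.sw.bcb t ht]) (by fun_prop) (by fun_prop) (by fun_prop) (by fun_prop)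
    (fun x hx => by rw [S.equ x hx t ht]; linarith)
  simpa using this

lemma vmass (S : Sys a b χ M u ux uxx ut w wx wxx wt B1 B2) {t : ℝ} (ht : 0 < t) :
    HasDerivAt (fun s => ∫ x in a..b, Real.exp (w x s))
      (∫ x in a..b, Real.exp (w x t) * wt x t) t ∧
    ∫ x in a..b, Real.exp (w x t) * wt x t ≤ (∫ x in a..b, u x t * Real.exp (w x t))
      - (∫ x in a..b, Real.exp (w x t)) + ∫ x in a..b, B2 x t := by
  obtain ⟨c1, c2, c3, c4, c5, c6, c7, c8, c9, c10, c11, c12, c13⟩ := S.slices ht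
  refine ⟨deriv_int S.hab (F := fun x s => Real.exp (w x s))
    (F' := fun x s => Real.exp (w x s) * wt x s)
    (fun t ht => (S.slices ht).2.2.2.2.2.2.2.2.2.2.1)
    ((Real.continuous_exp.comp_continuousOn S.sw.c0).mul S.sw.ct)
    (fun x hx t ht => (S.sw.dt x hx t ht).exp) ht, ?_⟩
  have := int_comb S.hab (P := fun x => Real.exp (w x t) * wt x t)
    (g := fun y => Real.exp (w y t) * wx y t)
    (g' := fun x => Real.exp (w x t) * wx x t * wx x t + Real.exp (w x t) * wxx x t)
    (f1 := fun x => u x t * Real.exp (w x t)) (f2 := fun x => Real.exp (w x t))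
    (f3 := fun x => B2 x t) (f4 := fun _ => 0) 1 (-1) 1 0 (by fun_prop) (by fun_prop)
    (fun x hx => ((S.sw.dx x hx t ht).exp).mul (S.sw.dxx x hx t ht))
    (by simp [S.sw.bca t ht])
    (by simp [S.sw.bcb t ht]) (by fun_prop) (by fun_prop) (by fun_prop) (by fun_prop)
    (fun x hx => by
      rw [S.eqw x hx t ht]
      have : Real.exp (w x t) * Real.exp (-w x t) = 1 := by rw [← Real.exp_add]; simp
      apply le_of_eq
      linear_combination B2 x t * this)
  simp only [one_mul, neg_mul, intervalIntegral.integral_zero, mul_zero, add_zero] at this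
  linarith

lemma logmass (S : Sys a b χ M u ux uxx ut w wx wxx wt B1 B2) {t : ℝ} (ht : 0 < t) :
    HasDerivAt (fun s => ∫ x in a..b, w x s) (∫ x in a..b, wt x t) t ∧
    (∫ x in a..b, wx x t ^ 2) + (∫ x in a..b, u x t) - (b - a)
      + (∫ x in a..b, B2 x t * Real.exp (-w x t)) ≤ ∫ x in a..b, wt x t := by
  obtain ⟨c1, c2, c3, c4, c5, c6, c7, c8, c9, c10, c11, c12, c13⟩ := S.slices ht
  refine ⟨deriv_int S.hab (fun t ht => S.sw.c0.slice ht) S.sw.ct S.sw.dt ht, ?_⟩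
  have := int_comb S.hab (P := fun x => -wt x t)
    (g := fun y => -wx y t)
    (g' := fun x => -wxx x t)
    (f1 := fun x => wx x t ^ 2) (f2 := fun x => u x t)
    (f3 := fun x => B2 x t * Real.exp (-w x t)) (f4 := fun _ => 1) (-1) (-1) (-1) 1
    (by fun_prop) (by fun_prop)
    (fun x hx => (S.sw.dxx x hx t ht).neg)
    (by simp [S.sw.bca t ht])
    (by simp [S.sw.bcb t ht]) (by fun_prop) (by fun_prop) (by fun_prop) (by fun_prop)
    (fun x hx => by
      rw [S.eqw x hx t ht]
      linarith)
  simp only [one_mul, neg_mul, intervalIntegral.integral_neg, intervalIntegral.integral_const,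
    smul_eq_mul, mul_one] at this
  linarith

lemma recip (S : Sys a b χ M u ux uxx ut w wx wxx wt B1 B2) {t : ℝ} (ht : 0 < t) :
    HasDerivAt (fun s => ∫ x in a..b, Real.exp (-2 * w x s))
      (∫ x in a..b, Real.exp (-2 * w x t) * (-2 * wt x t)) t ∧
    ∫ x in a..b, Real.exp (-2 * w x t) * (-2 * wt x t)
      ≤ 2 * ∫ x in a..b, Real.exp (-2 * w x t) := by
  obtain ⟨c1, c2, c3, c4, c5, c6, c7, c8, c9, c10, c11, c12, c13⟩ := S.slices ht
  refine ⟨deriv_int S.hab (F := fun x s => Real.exp (-2 * w x s))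
    (F' := fun x s => Real.exp (-2 * w x s) * (-2 * wt x s))
    (fun t ht => (S.slices ht).2.2.2.2.2.2.2.2.2.2.2.2)
    ((Real.continuous_exp.comp_continuousOn (continuousOn_const.mul S.sw.c0)).mul
      (continuousOn_const.mul S.sw.ct))
    (fun x hx t ht => ((S.sw.dt x hx t ht).const_mul (-2)).exp) ht, ?_⟩
  have := int_comb S.hab (P := fun x => Real.exp (-2 * w x t) * (-2 * wt x t))
    (g := fun y => Real.exp (-2 * w y t) * (-2 * wx y t))
    (g' := fun x => Real.exp (-2 * w x t) * (-2 * wx x t) * (-2 * wx x t)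
      + Real.exp (-2 * w x t) * (-2 * wxx x t))
    (f1 := fun x => Real.exp (-2 * w x t)) (f2 := fun _ => 0)
    (f3 := fun x => 0) (f4 := fun _ => 0) 2 0 0 0 (by fun_prop) (by fun_prop)
    (fun x hx => (((S.sw.dx x hx t ht).const_mul (-2)).exp).mul
      ((S.sw.dxx x hx t ht).const_mul (-2)))
    (by simp [S.sw.bca t ht])
    (by simp [S.sw.bcb t ht]) (by fun_prop) (by fun_prop) (by fun_prop) (by fun_prop)
    (fun x hx => by
      rw [S.eqw x hx t ht]
      have h1 := Real.exp_pos (-2 * w x t)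
      have h2 := Real.exp_pos (-w x t)
      have h3 := S.B2nn x t
      have h4 := S.upos x hx t ht
      have e1 : 0 ≤ Real.exp (-2 * w x t) * (B2 x t * Real.exp (-w x t)) := by positivity
      have e2 : 0 ≤ Real.exp (-2 * w x t) * u x t := by positivity
      have e3 : 0 ≤ Real.exp (-2 * w x t) * wx x t ^ 2 := by positivity
      nlinarith)
  simpa using this

lemma dirw (S : Sys a b χ M u ux uxx ut w wx wxx wt B1 B2) {t : ℝ} (ht : 0 < t) :
    ∫ x in a..b, -2 * (wt x t * wxx x t) ≤ -(∫ x in a..b, wxx x t ^ 2)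
      + 3 * (∫ x in a..b, u x t ^ 2) + 3 * (b - a)
      + 3 * M ^ 2 * ∫ x in a..b, Real.exp (-2 * w x t) := by
  obtain ⟨c1, c2, c3, c4, c5, c6, c7, c8, c9, c10, c11, c12, c13⟩ := S.slices ht
  have := int_comb S.hab (P := fun x => -2 * (wt x t * wxx x t))
    (g := fun y => (-2 / 3) * (wx y t) ^ 3)
    (g' := fun x => (-2 / 3) * (3 * wx x t ^ 2 * wxx x t))
    (f1 := fun x => wxx x t ^ 2) (f2 := fun x => u x t ^ 2)
    (f3 := fun x => 1) (f4 := fun x => Real.exp (-2 * w x t)) (-1) 3 3 (3 * M ^ 2)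
    (by fun_prop) (by fun_prop)
    (fun x hx => by
      have := ((S.sw.dxx x hx t ht).fun_pow 3).const_mul (-2 / 3 : ℝ)
      simpa using this)
    (by simp [S.sw.bca t ht])
    (by simp [S.sw.bcb t ht]) (by fun_prop) (by fun_prop) (by fun_prop) (by fun_prop)
    (fun x hx => by
      rw [S.eqw x hx t ht]
      have h2 := Real.exp_pos (-w x t)
      have e : Real.exp (-2 * w x t) = Real.exp (-w x t) ^ 2 := by
        rw [← Real.exp_nat_mul]; congr 1; push_cast; ring
      rw [e]
      set q := B2 x t * Real.exp (-w x t) with hq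
      have hq2 : q ^ 2 ≤ M ^ 2 * Real.exp (-w x t) ^ 2 := by
        rw [hq, mul_pow]
        exact mul_le_mul_of_nonneg_right (pow_le_pow_left₀ (S.B2nn x t) (S.B2M x t) 2)
          (by positivity)
      nlinarith [sq_nonneg (wxx x t + (u x t - 1 + q)), sq_nonneg (u x t + 1),
        sq_nonneg (u x t - q), sq_nonneg (1 + q)])
  simp only [one_mul, neg_mul, intervalIntegral.integral_const,
    smul_eq_mul, mul_one] at this ⊢
  linarith

lemma entropy (S : Sys a b χ M u ux uxx ut w wx wxx wt B1 B2) {t : ℝ} (ht : 0 < t) {p : ℝ}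
    (hp : ∀ x ∈ Set.Icc a b, u x t ≤ p) :
    HasDerivAt (fun s => ∫ x in a..b, u x s * Real.log (u x s))
      (∫ x in a..b, (Real.log (u x t) + 1) * ut x t) t ∧
    ∫ x in a..b, (Real.log (u x t) + 1) * ut x t ≤ -(3 / 4) * (∫ x in a..b, ux x t ^ 2 / u x t)
      + χ ^ 2 * p * (∫ x in a..b, wx x t ^ 2) + (∫ x in a..b, Real.exp (w x t))
      + M * ∫ x in a..b, u x t := by
  obtain ⟨c1, c2, c3, c4, c5, c6, c7, c8, c9, c10, c11, c12, c13⟩ := S.slices ht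
  have cl : ∀ t : ℝ, 0 < t → ContinuousOn (fun x => Real.log (u x t)) (Set.Icc a b) :=
    fun t ht => (S.su.c0.slice ht).log (fun x hx => (S.upos x hx t ht).ne')
  have c14 := cl t ht
  have c15 : ContinuousOn (fun x => ux x t / u x t) (Set.Icc a b) :=
    c2.div c1 (fun x hx => (S.upos x hx t ht).ne')
  have c16 : ContinuousOn (fun x => ux x t ^ 2 / u x t) (Set.Icc a b) :=
    (c2.pow 2).div c1 (fun x hx => (S.upos x hx t ht).ne')
  refine ⟨deriv_int S.hab (F := fun x s => u x s * Real.log (u x s))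
    (F' := fun x s => (Real.log (u x s) + 1) * ut x s)
    (fun t ht => (S.su.c0.slice ht).mul (cl t ht))
    (by
      have k1 := ContinuousOn.log S.su.c0 (fun p hp => (S.upos p.1 hp.1 p.2 hp.2).ne')
      have k2 := S.su.ct
      unfold JC at *
      fun_prop)
    (fun x hx t ht => by
      have h0 := (S.upos x hx t ht).ne'
      have := (S.su.dt x hx t ht).mul ((S.su.dt x hx t ht).log h0)
      refine HasDerivAt.congr_deriv this ?_
      field_simp) ht, ?_⟩
  have := int_comb S.hab (P := fun x => (Real.log (u x t) + 1) * ut x t)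
    (g := fun y => (Real.log (u y t) + 1) * (ux y t - χ * (u y t * wx y t)))
    (g' := fun x => (ux x t / u x t) * (ux x t - χ * (u x t * wx x t))
      + (Real.log (u x t) + 1) * (uxx x t - χ * (ux x t * wx x t + u x t * wxx x t)))
    (f1 := fun x => ux x t ^ 2 / u x t) (f2 := fun x => wx x t ^ 2)
    (f3 := fun x => Real.exp (w x t)) (f4 := fun x => u x t) (-(3 / 4)) (χ ^ 2 * p) 1 M
    (by fun_prop) (by fun_prop)
    (fun x hx => (((S.su.dx x hx t ht).log (S.upos x hx t ht).ne').add_const 1).mul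
      (S.flux ht hx))
    (by simp [S.su.bca t ht, S.sw.bca t ht])
    (by simp [S.su.bcb t ht, S.sw.bcb t ht]) (by fun_prop) (by fun_prop) (by fun_prop) (by fun_prop)
    (fun x hx => by
      rw [S.equ x hx t ht]
      have h0 := S.upos x hx t ht
      have h1 := hp x hx
      have he := Real.exp_pos (w x t)
      have hB := S.B1nn x t
      have hBM := S.B1M x t
      have l1 : Real.log (u x t) + 1 ≤ u x t := by
        have := Real.log_le_sub_one_of_pos h0; linarith
      have l2 : -((Real.log (u x t) + 1) * u x t) ≤ 1 := by
        have := Real.one_sub_inv_le_log_of_pos h0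
        have h3 : (1 - (u x t)⁻¹) * u x t ≤ Real.log (u x t) * u x t :=
          mul_le_mul_of_nonneg_right this h0.le
        have h4 : (1 - (u x t)⁻¹) * u x t = u x t - 1 := by field_simp
        nlinarith
      have l3 : -((Real.log (u x t) + 1) * u x t) * Real.exp (w x t) ≤ 1 * Real.exp (w x t) :=
        mul_le_mul_of_nonneg_right l2 he.le
      have l4 : (Real.log (u x t) + 1) * B1 x t ≤ M * u x t := by nlinarith
      have l5 : (ux x t / u x t) * (ux x t - χ * (u x t * wx x t))
          = ux x t ^ 2 / u x t - χ * ux x t * wx x t := by field_simp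
      have l6 : χ * ux x t * wx x t ≤ (1 / 4) * (ux x t ^ 2 / u x t) + χ ^ 2 * (u x t * wx x t ^ 2) := by
        have : (1 / 4) * (ux x t ^ 2 / u x t) + χ ^ 2 * (u x t * wx x t ^ 2) - χ * ux x t * wx x t
          = (ux x t / 2 - χ * u x t * wx x t) ^ 2 / u x t := by field_simp; ring
        have h2 : 0 ≤ (ux x t / 2 - χ * u x t * wx x t) ^ 2 / u x t := by positivity
        linarith
      have l7 : χ ^ 2 * (u x t * wx x t ^ 2) ≤ χ ^ 2 * (p * wx x t ^ 2) := by gcongr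
      rw [l5]
      nlinarith)
  linarith

lemma energy (S : Sys a b χ M u ux uxx ut w wx wxx wt B1 B2) {t : ℝ} (ht : 0 < t) {p : ℝ}
    (hp : ∀ x ∈ Set.Icc a b, u x t ^ 2 ≤ p) :
    HasDerivAt (fun s => ∫ x in a..b, u x s ^ 2)
      (∫ x in a..b, 2 * u x t * ut x t) t ∧
    ∫ x in a..b, 2 * u x t * ut x t ≤ -(∫ x in a..b, ux x t ^ 2)
      + χ ^ 2 * p * (∫ x in a..b, wx x t ^ 2) + 2 * M * ∫ x in a..b, u x t := by
  obtain ⟨c1, c2, c3, c4, c5, c6, c7, c8, c9, c10, c11, c12, c13⟩ := S.slices ht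
  refine ⟨deriv_int S.hab (F := fun x s => u x s ^ 2)
    (F' := fun x s => 2 * u x s * ut x s)
    (fun t ht => (S.su.c0.slice ht).pow 2)
    (by
      have k1 := S.su.c0
      have k2 := S.su.ct
      unfold JC at *
      fun_prop)
    (fun x hx t ht => by
      have := (S.su.dt x hx t ht).fun_pow 2
      simpa using this) ht, ?_⟩
  have := int_comb S.hab (P := fun x => 2 * u x t * ut x t)
    (g := fun y => (2 * u y t) * (ux y t - χ * (u y t * wx y t)))
    (g' := fun x => (2 * ux x t) * (ux x t - χ * (u x t * wx x t))
      + (2 * u x t) * (uxx x t - χ * (ux x t * wx x t + u x t * wxx x t)))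
    (f1 := fun x => ux x t ^ 2) (f2 := fun x => wx x t ^ 2)
    (f3 := fun x => u x t) (f4 := fun x => 0) (-1) (χ ^ 2 * p) (2 * M) 0
    (by fun_prop) (by fun_prop)
    (fun x hx => ((S.su.dx x hx t ht).const_mul 2).mul (S.flux ht hx))
    (by simp [S.su.bca t ht, S.sw.bca t ht])
    (by simp [S.su.bcb t ht, S.sw.bcb t ht]) (by fun_prop) (by fun_prop) (by fun_prop) (by fun_prop)
    (fun x hx => by
      rw [S.equ x hx t ht]
      have h0 := S.upos x hx t ht
      have h1 := hp x hx
      have he := Real.exp_pos (w x t)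
      have hB := S.B1nn x t
      have hBM := S.B1M x t
      have l4 : u x t * B1 x t ≤ M * u x t := by nlinarith
      have l3 : 0 ≤ u x t ^ 2 * Real.exp (w x t) := by positivity
      have l6 : 2 * χ * u x t * ux x t * wx x t ≤ ux x t ^ 2 + χ ^ 2 * (u x t ^ 2 * wx x t ^ 2) := by
        nlinarith [sq_nonneg (ux x t - χ * u x t * wx x t)]
      have l7 : χ ^ 2 * (u x t ^ 2 * wx x t ^ 2) ≤ χ ^ 2 * (p * wx x t ^ 2) := by gcongr
      nlinarith)
  simp only [one_mul, neg_mul, zero_mul, add_zero] at this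
  linarith

lemma diru (S : Sys a b χ M u ux uxx ut w wx wxx wt B1 B2) {t : ℝ} (ht : 0 < t) {p q C : ℝ}
    (hp : ∀ x ∈ Set.Icc a b, ux x t ^ 2 ≤ p) (hq : ∀ x ∈ Set.Icc a b, u x t ^ 2 ≤ q)
    (hC : ∀ x ∈ Set.Icc a b, Real.exp (w x t) ≤ C) :
    ∫ x in a..b, -2 * (ut x t * uxx x t) ≤ -(∫ x in a..b, uxx x t ^ 2)
      + 4 * χ ^ 2 * p * (∫ x in a..b, wx x t ^ 2) + 4 * χ ^ 2 * q * (∫ x in a..b, wxx x t ^ 2)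
      + (4 * q * C ^ 2 + 4 * M ^ 2) * (b - a) := by
  obtain ⟨c1, c2, c3, c4, c5, c6, c7, c8, c9, c10, c11, c12, c13⟩ := S.slices ht
  have := int_comb S.hab (P := fun x => -2 * (ut x t * uxx x t))
    (g := fun _ => 0) (g' := fun _ => 0)
    (f1 := fun x => uxx x t ^ 2) (f2 := fun x => wx x t ^ 2)
    (f3 := fun x => wxx x t ^ 2) (f4 := fun x => 1) (-1) (4 * χ ^ 2 * p) (4 * χ ^ 2 * q)
    (4 * q * C ^ 2 + 4 * M ^ 2)
    (by fun_prop) (by fun_prop)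
    (fun x hx => hasDerivAt_const x 0) rfl rfl
    (by fun_prop) (by fun_prop) (by fun_prop) (by fun_prop)
    (fun x hx => by
      rw [S.equ x hx t ht]
      have h0 := S.upos x hx t ht
      have h1 := hp x hx
      have h2 := hq x hx
      have he := Real.exp_pos (w x t)
      have hB := S.B1nn x t
      have hBM := S.B1M x t
      have heC := hC x hx
      set r1 := χ * (ux x t * wx x t) with hr1
      set r2 := χ * (u x t * wxx x t) with hr2
      set r3 := u x t * Real.exp (w x t) with hr3
      have k1 : r1 ^ 2 ≤ χ ^ 2 * p * wx x t ^ 2 := by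
        have : r1 ^ 2 = χ ^ 2 * ux x t ^ 2 * wx x t ^ 2 := by rw [hr1]; ring
        rw [this]; gcongr
      have k2 : r2 ^ 2 ≤ χ ^ 2 * q * wxx x t ^ 2 := by
        have : r2 ^ 2 = χ ^ 2 * u x t ^ 2 * wxx x t ^ 2 := by rw [hr2]; ring
        rw [this]; gcongr
      have k3 : r3 ^ 2 ≤ q * C ^ 2 := by
        have : r3 ^ 2 = u x t ^ 2 * Real.exp (w x t) ^ 2 := by rw [hr3]; ring
        rw [this]; gcongr
        exact (sq_nonneg _).trans h2
      have k4 : B1 x t ^ 2 ≤ M ^ 2 := pow_le_pow_left₀ hB hBM 2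
      have e : -2 * ((uxx x t - χ * (ux x t * wx x t + u x t * wxx x t) - r3 + B1 x t) * uxx x t)
        = -2 * uxx x t ^ 2 + 2 * uxx x t * (r1 + r2 + r3 - B1 x t) := by
        rw [hr1, hr2]; ring
      rw [e]
      nlinarith [sq_nonneg (uxx x t - (r1 + r2 + r3 - B1 x t)), sq_nonneg (r1 - r2),
        sq_nonneg (r1 - r3), sq_nonneg (r1 + B1 x t), sq_nonneg (r2 - r3),
        sq_nonneg (r2 + B1 x t), sq_nonneg (r3 + B1 x t)])
  simp only [one_mul, neg_mul, intervalIntegral.integral_const,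
    smul_eq_mul, mul_one] at this ⊢
  linarith

end Sys

/-! ### Uniform bounds -/

namespace Sys

variable {a b χ M : ℝ} {u ux uxx ut w wx wxx wt B1 B2 : ℝ → ℝ → ℝ} {β : ℝ → ℝ} {l : ℝ}

lemma m_pos (S : Sys a b χ M u ux uxx ut w wx wxx wt B1 B2) {t : ℝ} (ht : 0 < t) :
    0 < ∫ x in a..b, u x t :=
  intervalIntegral.intervalIntegral_pos_of_pos_on (cii S.hab (S.slices ht).1)
    (fun x hx => S.upos x (Set.Ioo_subset_Icc_self hx) t ht) S.hab

lemma b1_nonneg (S : Sys a b χ M u ux uxx ut w wx wxx wt B1 B2) (t : ℝ) :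
    0 ≤ ∫ x in a..b, B1 x t := int_nonneg' S.hab (fun x _ => S.B1nn x t)

lemma b2_le (S : Sys a b χ M u ux uxx ut w wx wxx wt B1 B2) {t : ℝ} (ht : 0 < t) :
    ∫ x in a..b, B2 x t ≤ M * (b - a) := by
  have := int_mono S.hab (f := fun x => B2 x t) (g := fun _ => M) (S.cB2.slice ht)
    continuousOn_const (fun x _ => S.B2M x t)
  simp only [intervalIntegral.integral_const, smul_eq_mul] at this
  linarith

lemma ue_nonneg (S : Sys a b χ M u ux uxx ut w wx wxx wt B1 B2) {t : ℝ} (ht : 0 < t) :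
    0 ≤ ∫ x in a..b, u x t * Real.exp (w x t) :=
  int_nonneg' S.hab (fun x hx => mul_nonneg (S.upos x hx t ht).le (Real.exp_pos _).le)

lemma mass_bdd (S : Sys a b χ M u ux uxx ut w wx wxx wt B1 B2)
    (hβ : ∀ t : ℝ, 0 < t → HasDerivAt β (∫ x in a..b, B1 x t) t)
    (hl : Tendsto β atTop (𝓝 l)) :
    ∃ C : ℝ, 0 ≤ C ∧ ∀ t : ℝ, 1 ≤ t → (∫ x in a..b, u x t) ≤ C ∧
      (∫ x in a..b, Real.exp (w x t)) ≤ C := by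
  obtain ⟨hm, hml⟩ := tail_small hβ (fun t _ => S.b1_nonneg t) hl
  have h1 : ∀ t : ℝ, 1 ≤ t → (∫ x in a..b, u x t) ≤ (∫ x in a..b, u x 1) + l - β 1 := by
    intro t ht
    have := le_of_deriv_nonpos (f := fun s => (∫ x in a..b, u x s) - β s)
      (f' := fun s => (∫ x in a..b, ut x s) - ∫ x in a..b, B1 x s) ht
      (fun r hr => (S.mass (by linarith [hr.1])).1.sub (hβ r (by linarith [hr.1])))
      (fun r hr => by
        have h1 := (S.mass (t := r) (by linarith [hr.1])).2
        have h2 := S.ue_nonneg (t := r) (by linarith [hr.1])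
        linarith)
    have h2 := hml t (by linarith)
    linarith
  set m1 := (∫ x in a..b, u x 1) + l - β 1
  have h2 := y_bdd (y := fun s => (∫ x in a..b, u x s) + ∫ x in a..b, Real.exp (w x s))
    (y' := fun s => (∫ x in a..b, ut x s) + ∫ x in a..b, Real.exp (w x s) * wt x s)
    (c := 1) (T := 1) (K := m1 + M * (b - a)) one_pos one_pos hβ (fun t _ => S.b1_nonneg t) hl
    (fun t ht => (S.mass (by linarith)).1.add (S.vmass (by linarith)).1)
    (fun t ht => by
      have h1 := h1 t ht
      have h2 := (S.mass (t := t) (by linarith)).2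
      have h3 := (S.vmass (t := t) (by linarith)).2
      have h4 := S.b2_le (t := t) (by linarith)
      linarith)
  obtain ⟨C, hC, h⟩ := h2
  refine ⟨C, hC, fun t ht => ?_⟩
  have h3 := h t ht
  have h4 := S.m_pos (t := t) (by linarith)
  have h5 : 0 ≤ ∫ x in a..b, Real.exp (w x t) := int_nonneg' S.hab (fun x _ => (Real.exp_pos _).le)
  constructor <;> linarith

lemma eta_nonneg (S : Sys a b χ M u ux uxx ut w wx wxx wt B1 B2) (t : ℝ) :
    0 ≤ ∫ x in a..b, wx x t ^ 2 := int_nonneg' S.hab (fun x _ => sq_nonneg _)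

lemma be_nonneg (S : Sys a b χ M u ux uxx ut w wx wxx wt B1 B2) (t : ℝ) :
    0 ≤ ∫ x in a..b, B2 x t * Real.exp (-w x t) :=
  int_nonneg' S.hab (fun x _ => mul_nonneg (S.B2nn x t) (Real.exp_pos _).le)

lemma eta_le (S : Sys a b χ M u ux uxx ut w wx wxx wt B1 B2) {t : ℝ} (ht : 0 < t) :
    (∫ x in a..b, wx x t ^ 2) ≤ (∫ x in a..b, wt x t) + (b - a) := by
  have h1 := (S.logmass ht).2
  have h2 := S.be_nonneg t
  have h3 := S.m_pos ht
  linarith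

lemma w_dev (S : Sys a b χ M u ux uxx ut w wx wxx wt B1 B2) {t : ℝ} (ht : 0 < t)
    {x : ℝ} (hx : x ∈ Set.Icc a b) :
    |w x t - (∫ z in a..b, w z t) / (b - a)|
      ≤ (∫ x in a..b, wx x t ^ 2) / 2 + (b - a) / 2 := by
  have := sup_lin S.hab (S.sw.cx.slice ht) (fun x hx => S.sw.dx x hx t ht)
    (ε := 1 / 2) (by norm_num) hx
  have e : (b - a) / (4 * (1 / 2)) = (b - a) / 2 := by norm_num
  rw [e] at this
  linarith

lemma log_bdd (S : Sys a b χ M u ux uxx ut w wx wxx wt B1 B2)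
    (hβ : ∀ t : ℝ, 0 < t → HasDerivAt β (∫ x in a..b, B1 x t) t)
    (hl : Tendsto β atTop (𝓝 l)) {T β0 : ℝ} (hT : 1 ≤ T) (hβ0 : 0 < β0)
    (hB : ∀ t, T ≤ t → β0 ≤ ∫ x in a..b, B2 x t) :
    ∃ C : ℝ, 0 ≤ C ∧ ∀ t : ℝ, T ≤ t → |∫ x in a..b, w x t| ≤ C := by
  obtain ⟨C, hC, hCb⟩ := S.mass_bdd hβ hl
  have hlam : 0 < b - a := by linarith [S.hab]
  set lam := b - a with hlamdef
  set N := lam * (lam + lam / β0) with hN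
  set Bc := max (-(∫ x in a..b, w x T)) N with hBc
  have low : ∀ t, T ≤ t → -(∫ x in a..b, w x t) ≤ Bc := by
    intro t ht
    refine image_le_of_deriv_right_lt_deriv_boundary (f := fun s => -(∫ x in a..b, w x s))
      (f' := fun s => -(∫ x in a..b, wt x s)) (a := T) (b := t) (B := fun _ => Bc)
      (B' := fun _ => 0) ?_ ?_ (le_max_left _ _) (fun x => hasDerivAt_const x Bc) ?_
      (Set.right_mem_Icc.2 ht)
    · intro s hs
      exact (S.logmass (by linarith [hs.1])).1.neg.continuousAt.continuousWithinAt
    · intro s hs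
      exact (S.logmass (by linarith [hs.1])).1.neg.hasDerivWithinAt
    · intro s hs hs2
      have hs0 : 0 < s := by linarith [hs.1]
      have h1 := (S.logmass hs0).2
      have h2 := S.be_nonneg s
      have h3 := S.m_pos hs0
      have hle : N ≤ -(∫ x in a..b, w x s) := by
        rw [hs2]; exact le_max_right _ _
      rcases le_or_gt lam (∫ x in a..b, wx x s ^ 2) with h | h
      · linarith
      · have hw : ∀ x ∈ Set.Icc a b, w x s ≤ -(lam / β0) := by
          intro x hx
          have := (abs_le.1 (S.w_dev hs0 hx)).2
          have h4 : (∫ z in a..b, w z s) / lam ≤ -(lam + lam / β0) := by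
            rw [div_le_iff₀ hlam]; linarith
          linarith
        have h5 := int_lin S.hab (P := fun x => (lam / β0) * B2 x s)
          (f1 := fun x => B2 x s * Real.exp (-w x s)) (f2 := fun _ => 0) 1 0
          (continuousOn_const.mul (S.cB2.slice hs0))
          ((S.cB2.slice hs0).mul (S.slices hs0).2.2.2.2.2.2.2.2.2.2.2.1) continuousOn_const
          (fun x hx => by
            have h6 := hw x hx
            have h7 := Real.add_one_le_exp (-w x s)
            have h8 := S.B2nn x s
            have : (lam / β0) * B2 x s ≤ Real.exp (-w x s) * B2 x s :=
              mul_le_mul_of_nonneg_right (by linarith) h8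
            linarith)
        rw [intervalIntegral.integral_const_mul] at h5
        have h6 : lam / β0 * β0 ≤ lam / β0 * ∫ x in a..b, B2 x s :=
          mul_le_mul_of_nonneg_left (hB s hs.1) (by positivity)
        have h7 : lam / β0 * β0 = lam := by field_simp
        have h8 := S.eta_nonneg s
        linarith
  refine ⟨max C Bc, hC.trans (le_max_left _ _), fun t ht => abs_le.2 ⟨?_, ?_⟩⟩
  · have := low t ht
    have := le_max_right C Bc
    linarith
  · have h1 := (hCb t (by linarith)).2
    obtain ⟨c1, c2, c3, c4, c5, c6, c7, c8, c9, c10, c11, c12, c13⟩ :=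
      S.slices (t := t) (by linarith)
    have h2 := int_mono S.hab c5 c11 (fun x _ => by
      have := Real.add_one_le_exp (w x t); linarith)
    have := le_max_left C Bc
    linarith

lemma basic (S : Sys a b χ M u ux uxx ut w wx wxx wt B1 B2)
    (hβ : ∀ t : ℝ, 0 < t → HasDerivAt β (∫ x in a..b, B1 x t) t)
    (hl : Tendsto β atTop (𝓝 l)) {T β0 : ℝ} (hT : 1 ≤ T) (hβ0 : 0 < β0)
    (hB : ∀ t, T ≤ t → β0 ≤ ∫ x in a..b, B2 x t) :
    ∃ K : ℝ, 1 ≤ K ∧ ∀ t : ℝ, T + 1 ≤ t → (∫ x in a..b, u x t) ≤ K ∧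
      (∫ x in a..b, Real.exp (w x t)) ≤ K ∧ |∫ x in a..b, w x t| ≤ K ∧
      (∫ x in a..b, Real.exp (-2 * w x t)) ≤ K := by
  obtain ⟨C, hC, hCb⟩ := S.mass_bdd hβ hl
  obtain ⟨C1, hC1, hC1b⟩ := S.log_bdd hβ hl hT hβ0 hB
  have hlam : 0 < b - a := by linarith [S.hab]
  set lam := b - a with hlamdef
  set k := C1 / lam + (2 * C1 + lam) / 2 + lam / 2 with hk
  set K2 := lam * Real.exp (2 * k) * Real.exp 2 with hK2
  have hK2p : 0 ≤ K2 := by positivity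
  refine ⟨1 + C + C1 + K2, by linarith, fun t ht => ⟨?_, ?_, ?_, ?_⟩⟩
  · linarith [(hCb t (by linarith)).1]
  · linarith [(hCb t (by linarith)).2]
  · linarith [hC1b t (by linarith)]
  · obtain ⟨s, hs, hs1, hs2, h⟩ := mvt1 (T0 := T) (t := t)
      (y := fun s => ∫ x in a..b, w x s) (y' := fun s => ∫ x in a..b, wt x s)
      (fun r hr => (S.logmass (by linarith)).1) ht
    have hs0 : 0 < s := by linarith
    have h1 := (abs_le.1 (hC1b t (by linarith))).2
    have h2 := (abs_le.1 (hC1b (t - 1) (by linarith))).1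
    have h3 := S.eta_le hs0
    have h4 : ∀ x ∈ Set.Icc a b, Real.exp (-2 * w x s) ≤ Real.exp (2 * k) := by
      intro x hx
      apply Real.exp_le_exp.2
      have h5 := (abs_le.1 (S.w_dev hs0 hx)).1
      have h6 := (abs_le.1 (hC1b s hs)).1
      have h7 : -(C1 / lam) ≤ (∫ z in a..b, w z s) / lam := by
        rw [← neg_div]; gcongr
      linarith
    have h5 := int_mono S.hab (f := fun x => Real.exp (-2 * w x s))
      (S.slices hs0).2.2.2.2.2.2.2.2.2.2.2.2 continuousOn_const h4
    simp only [intervalIntegral.integral_const, smul_eq_mul] at h5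
    have h6 := gron (y := fun s => ∫ x in a..b, Real.exp (-2 * w x s))
      (y' := fun s => ∫ x in a..b, Real.exp (-2 * w x s) * (-2 * wt x s))
      (θ := fun r => 2 * r) (θ' := fun _ => 2) hs2
      (fun r hr => (S.recip (by linarith [hr.1])).1)
      (fun r _ => by simpa using (hasDerivAt_id r).const_mul (2:ℝ))
      (fun r hr => (S.recip (by linarith [hr.1])).2)
    have h7 : Real.exp (2 * t - 2 * s) ≤ Real.exp 2 := Real.exp_le_exp.2 (by linarith)
    have h8 : (∫ x in a..b, Real.exp (-2 * w x s)) * Real.exp (2 * t - 2 * s) ≤ K2 := by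
      rw [hK2]
      apply mul_le_mul h5 h7 (Real.exp_pos _).le (by positivity)
    linarith

end Sys

/-! ### The entropy argument -/

namespace Sys

variable {a b χ M : ℝ} {u ux uxx ut w wx wxx wt B1 B2 : ℝ → ℝ → ℝ} {β : ℝ → ℝ} {l : ℝ}

lemma A1_nonneg (S : Sys a b χ M u ux uxx ut w wx wxx wt B1 B2) {t : ℝ} (ht : 0 < t) :
    0 ≤ ∫ x in a..b, ux x t ^ 2 / u x t :=
  int_nonneg' S.hab (fun x hx => div_nonneg (sq_nonneg _) (S.upos x hx t ht).le)

lemma u_le (S : Sys a b χ M u ux uxx ut w wx wxx wt B1 B2) {t K ε : ℝ} (ht : 0 < t)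
    (hm : ∫ x in a..b, u x t ≤ K) (hε : 0 < ε) {x : ℝ} (hx : x ∈ Set.Icc a b) :
    u x t ≤ K / (b - a) + ε * (∫ z in a..b, ux z t ^ 2 / u z t) + K / (4 * ε) := by
  have h := sup_log S.hab (S.su.cx.slice ht) (fun x hx => S.su.dx x hx t ht)
    (fun x hx => S.upos x hx t ht) hε hx
  have hlam : 0 < b - a := by linarith [S.hab]
  have h1 : (∫ z in a..b, u z t) / (b - a) ≤ K / (b - a) := by gcongr
  have h2 : (∫ z in a..b, u z t) / (4 * ε) ≤ K / (4 * ε) := by gcongr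
  linarith

lemma u2_le (S : Sys a b χ M u ux uxx ut w wx wxx wt B1 B2) {t K p : ℝ} (ht : 0 < t)
    (hm : ∫ x in a..b, u x t ≤ K) (hp : ∀ x ∈ Set.Icc a b, u x t ≤ p) :
    ∫ x in a..b, u x t ^ 2 ≤ K * p := by
  have c1 := S.su.c0.slice ht
  have h1 := int_lin S.hab (P := fun x => u x t ^ 2) (f1 := fun x => u x t) (f2 := fun _ => 0)
    p 0 (by fun_prop) c1 continuousOn_const (fun x hx => by
      have h1 := hp x hx
      have h2 := S.upos x hx t ht
      nlinarith)
  have hp0 : 0 ≤ p := (S.upos a (Set.left_mem_Icc.2 S.hab.le) t ht).le.trans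
    (hp a (Set.left_mem_Icc.2 S.hab.le))
  nlinarith

lemma ent_bounds (S : Sys a b χ M u ux uxx ut w wx wxx wt B1 B2) {t : ℝ} (ht : 0 < t) :
    -(b - a) ≤ (∫ x in a..b, u x t * Real.log (u x t)) ∧
    (∫ x in a..b, u x t * Real.log (u x t)) ≤ ∫ x in a..b, u x t ^ 2 := by
  have c1 := S.su.c0.slice ht
  have c2 : ContinuousOn (fun x => Real.log (u x t)) (Set.Icc a b) :=
    c1.log (fun x hx => (S.upos x hx t ht).ne')
  constructor
  · have := int_mono S.hab (f := fun _ => (-1 : ℝ)) (g := fun x => u x t * Real.log (u x t))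
      (by fun_prop) (by fun_prop) (fun x hx => by
        have h0 := S.upos x hx t ht
        have h1 := Real.one_sub_inv_le_log_of_pos h0
        have h2 : u x t * (1 - (u x t)⁻¹) ≤ u x t * Real.log (u x t) :=
          mul_le_mul_of_nonneg_left h1 h0.le
        have h3 : u x t * (1 - (u x t)⁻¹) = u x t - 1 := by field_simp
        linarith)
    simp only [intervalIntegral.integral_const, smul_eq_mul] at this
    linarith
  · refine int_mono S.hab (by fun_prop) (by fun_prop) (fun x hx => ?_)
    have h0 := S.upos x hx t ht
    have h1 := Real.log_le_sub_one_of_pos h0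
    nlinarith

set_option maxHeartbeats 1000000 in
lemma entropy_ineq (S : Sys a b χ M u ux uxx ut w wx wxx wt B1 B2) (hχ : 0 < χ) {K : ℝ}
    (hK : 1 ≤ K) :
    ∃ G c : ℝ, 0 ≤ G ∧ 0 < c ∧ ∀ t : ℝ, 0 < t → (∫ x in a..b, u x t) ≤ K →
      (∫ x in a..b, Real.exp (w x t)) ≤ K → (∫ x in a..b, Real.exp (-2 * w x t)) ≤ K →
      ∀ Z : ℝ, Z = (∫ x in a..b, u x t * Real.log (u x t)) + (b - a) + 1
        + ∫ x in a..b, wx x t ^ 2 →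
      (∫ x in a..b, (Real.log (u x t) + 1) * ut x t) + (∫ x in a..b, -2 * (wt x t * wxx x t))
        ≤ -c * Z ^ 2 + G * ((∫ x in a..b, wt x t) + G) * Z := by
  have hlam : 0 < b - a := by linarith [S.hab]
  have hK0 : 0 < K := by linarith
  have hM := S.hM
  set lam := b - a with hlamdef
  set G1 := χ ^ 2 * K / lam + χ ^ 4 * K + K + M * K + 3 * (K * (K / lam + 3 * K ^ 2)) + 3 * lam
    + 3 * M ^ 2 * K with hG1
  have hG1p : 0 ≤ G1 := by positivity
  set G2 := K ^ 2 / lam + lam + 1 with hG2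
  have hG2p : 0 ≤ G2 := by positivity
  refine ⟨G1 + G2 + 1 + lam, 3 / (16 * K ^ 3), by positivity, by positivity, ?_⟩
  intro t ht hm hV hR Z hZ
  have hA := S.A1_nonneg ht
  have hη := S.eta_nonneg t
  have hηl := S.eta_le ht
  have hE := fun p hp => (S.entropy (p := p) ht hp).2
  have hD := S.dirw ht
  have hDn : 0 ≤ ∫ x in a..b, wxx x t ^ 2 := int_nonneg' S.hab (fun x _ => sq_nonneg _)
  obtain ⟨hL1, hL2⟩ := S.ent_bounds ht
  have hup := fun ε (hε : 0 < ε) x hx => S.u_le (x := x) ht hm hε hx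
  have hU := fun p hp => S.u2_le (p := p) ht hm hp
  rw [← hlamdef] at *
  generalize (∫ x in a..b, ux x t ^ 2 / u x t) = A at *
  generalize (∫ x in a..b, wx x t ^ 2) = η at *
  generalize (∫ x in a..b, wt x t) = ell at *
  generalize (∫ x in a..b, u x t * Real.log (u x t)) = L at *
  generalize (∫ x in a..b, (Real.log (u x t) + 1) * ut x t) = L' at *
  generalize (∫ x in a..b, -2 * (wt x t * wxx x t)) = η' at *
  generalize (∫ x in a..b, u x t) = m at *
  generalize (∫ x in a..b, u x t ^ 2) = U at *
  generalize (∫ x in a..b, Real.exp (w x t)) = V at *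
  generalize (∫ x in a..b, Real.exp (-2 * w x t)) = R at *
  generalize (∫ x in a..b, wxx x t ^ 2) = D at *
  have hχ2 : 0 < χ ^ 2 := by positivity
  have hZ1 : 1 + η ≤ Z := by linarith
  have hZp : 0 < Z := by linarith
  -- first: the dissipation inequality
  have i1 := hE _ (hup (1 / (4 * χ ^ 2 * (1 + η))) (by positivity))
  have e1 : χ ^ 2 * (K / lam + 1 / (4 * χ ^ 2 * (1 + η)) * A
      + K / (4 * (1 / (4 * χ ^ 2 * (1 + η))))) * η
      = χ ^ 2 * K / lam * η + (η / (1 + η)) * (A / 4) + χ ^ 4 * K * ((1 + η) * η) := by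
    field_simp
  rw [e1] at i1
  have e2 : η / (1 + η) ≤ 1 := by rw [div_le_one (by positivity)]; linarith
  have e3 : (η / (1 + η)) * (A / 4) ≤ 1 * (A / 4) :=
    mul_le_mul_of_nonneg_right e2 (by positivity)
  have i2 := hU _ (hup (1 / (12 * K)) (by positivity))
  have e4 : K * (K / lam + 1 / (12 * K) * A + K / (4 * (1 / (12 * K))))
      = K * (K / lam + 3 * K ^ 2) + A / 12 := by
    field_simp
    ring
  rw [e4] at i2
  have i3 : L' + η' ≤ -(1 / 4) * A + G1 * (1 + η) * Z := by
    have k0 : (1 + η) * 1 ≤ (1 + η) * Z := mul_le_mul_of_nonneg_left (by linarith) (by linarith)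
    have k1 : χ ^ 2 * K / lam * η ≤ χ ^ 2 * K / lam * ((1 + η) * Z) :=
      mul_le_mul_of_nonneg_left (by linarith) (by positivity)
    have k2 : χ ^ 4 * K * ((1 + η) * η) ≤ χ ^ 4 * K * ((1 + η) * Z) := by
      gcongr; linarith
    have k3 : M * m ≤ M * K := mul_le_mul_of_nonneg_left hm hM
    have k4 : 3 * M ^ 2 * R ≤ 3 * M ^ 2 * K := mul_le_mul_of_nonneg_left hR (by positivity)
    have k5 : 0 ≤ K + M * K + 3 * (K * (K / lam + 3 * K ^ 2)) + 3 * lam + 3 * M ^ 2 * K := by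
      positivity
    have k6 : (K + M * K + 3 * (K * (K / lam + 3 * K ^ 2)) + 3 * lam + 3 * M ^ 2 * K) * 1 ≤
      (K + M * K + 3 * (K * (K / lam + 3 * K ^ 2)) + 3 * lam + 3 * M ^ 2 * K) * ((1 + η) * Z) :=
      mul_le_mul_of_nonneg_left (by linarith) k5
    have k7 : G1 * (1 + η) * Z = χ ^ 2 * K / lam * ((1 + η) * Z) + χ ^ 4 * K * ((1 + η) * Z) +
      (K + M * K + 3 * (K * (K / lam + 3 * K ^ 2)) + 3 * lam + 3 * M ^ 2 * K) * ((1 + η) * Z) := by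
      rw [hG1]; ring
    rw [k7]
    linarith
  -- second: the lower bound for the dissipation
  have i4 := hU _ (hup (K ^ 2 / Z) (by positivity))
  have e5 : K * (K / lam + K ^ 2 / Z * A + K / (4 * (K ^ 2 / Z)))
      = K ^ 2 / lam + K ^ 3 * A / Z + Z / 4 := by
    field_simp
  rw [e5] at i4
  have i5 : (3 / 4) * Z ^ 2 ≤ (G2 + η) * Z + K ^ 3 * A := by
    have h1 : (3 / 4) * Z ≤ G2 + η + K ^ 3 * A / Z := by
      rw [hG2]; linarith
    have h2 : (3 / 4) * Z * Z ≤ (G2 + η + K ^ 3 * A / Z) * Z :=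
      mul_le_mul_of_nonneg_right h1 hZp.le
    have h3 : (G2 + η + K ^ 3 * A / Z) * Z = (G2 + η) * Z + K ^ 3 * A := by field_simp
    linarith
  have i6 : -(1 / 4) * A ≤ -(3 / (16 * K ^ 3)) * Z ^ 2 + (G2 + η) * Z := by
    have h1 : (1:ℝ) ≤ K ^ 3 := one_le_pow₀ hK
    have h2 : 0 ≤ (G2 + η) * Z := by positivity
    have h3 : (G2 + η) * Z / K ^ 3 ≤ (G2 + η) * Z := div_le_self h2 h1
    have h4 : (3 / 4 * Z ^ 2) / K ^ 3 ≤ ((G2 + η) * Z + K ^ 3 * A) / K ^ 3 := by gcongr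
    have h5 : ((G2 + η) * Z + K ^ 3 * A) / K ^ 3 = (G2 + η) * Z / K ^ 3 + A := by field_simp
    have h6 : (3 / 4 * Z ^ 2) / K ^ 3 = 4 * (3 / (16 * K ^ 3) * Z ^ 2) := by
      field_simp
      norm_num
    rw [h5, h6] at h4
    linarith
  have i7 : G1 * (1 + η) + (G2 + η) ≤ (G1 + G2 + 1 + lam) * (ell + (G1 + G2 + 1 + lam)) := by
    have h1 : (G1 + 1) * η ≤ (G1 + 1) * (ell + lam) := mul_le_mul_of_nonneg_left hηl (by linarith)
    have h2 : 0 ≤ ell + lam := by linarith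
    have h3 : (G1 + 1) * (ell + lam) ≤ (G1 + G2 + 1 + lam) * (ell + lam) :=
      mul_le_mul_of_nonneg_right (by linarith) h2
    have h4 : 1 * (G1 + G2 + 1) ≤ (G1 + G2 + 1 + lam) * (G1 + G2 + 1) :=
      mul_le_mul_of_nonneg_right (by linarith) (by linarith)
    have h5 : (G1 + G2 + 1 + lam) * (ell + (G1 + G2 + 1 + lam))
      = (G1 + G2 + 1 + lam) * (ell + lam) + (G1 + G2 + 1 + lam) * (G1 + G2 + 1) := by ring
    rw [h5]
    linarith
  have i8 := mul_le_mul_of_nonneg_right i7 hZp.le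
  linarith

lemma eta_bdd (S : Sys a b χ M u ux uxx ut w wx wxx wt B1 B2) (hχ : 0 < χ) {T K : ℝ}
    (hT : 1 ≤ T) (hK : 1 ≤ K)
    (hb : ∀ t : ℝ, T ≤ t → (∫ x in a..b, u x t) ≤ K ∧
      (∫ x in a..b, Real.exp (w x t)) ≤ K ∧ |∫ x in a..b, w x t| ≤ K ∧
      (∫ x in a..b, Real.exp (-2 * w x t)) ≤ K) :
    ∃ H : ℝ, 1 ≤ H ∧ ∀ t : ℝ, T + 1 ≤ t → (∫ x in a..b, wx x t ^ 2) ≤ H ∧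
      ∀ x ∈ Set.Icc a b, |w x t| ≤ H := by
  obtain ⟨G, c, hG, hc, h⟩ := S.entropy_ineq hχ hK
  have hlam : 0 < b - a := by linarith [S.hab]
  have key := bernoulli_bound
    (S := fun t => (∫ x in a..b, u x t * Real.log (u x t)) + (b - a) + 1
        + ∫ x in a..b, wx x t ^ 2)
    (S' := fun t => (∫ x in a..b, (Real.log (u x t) + 1) * ut x t)
      + (∫ x in a..b, -2 * (wt x t * wxx x t)))
    (ell := fun t => ∫ x in a..b, w x t) (ell' := fun t => ∫ x in a..b, wt x t)
    (K := G) (K1 := K) (T0 := T) hc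
    (fun t ht => by
      have ht0 : 0 < t := by linarith
      obtain ⟨p, _, hp⟩ := S.su.c0.bdd (s := t) (t := t) ht0
      have h1 := (S.entropy (p := p) ht0 (fun x hx =>
        (le_abs_self _).trans (hp x hx t (Set.right_mem_Icc.2 le_rfl)))).1
      exact ((h1.add_const (b - a)).add_const 1).add (deriv_dirichlet S.hab S.sw ht0))
    (fun t ht => by
      have ht0 : 0 < t := by linarith
      have h1 := (S.ent_bounds ht0).1
      have h2 := S.eta_nonneg t
      linarith)
    (fun t ht => (S.logmass (by linarith)).1) (fun t ht => (hb t ht).2.2.1) hG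
    (fun t ht => h t (by linarith) (hb t ht).1 (hb t ht).2.1 (hb t ht).2.2.2 _ rfl)
  set H0 := Real.exp (2 * G * K + G ^ 2) / c with hH0
  have hH0p : 0 < H0 := by positivity
  have hKl : 0 < K / (b - a) := by positivity
  refine ⟨1 + H0 + K / (b - a) + (b - a), by linarith, fun t ht => ?_⟩
  have ht0 : 0 < t := by linarith
  have h1 : (∫ x in a..b, wx x t ^ 2) ≤ H0 := by
    have h1 := key t ht
    have h2 := (S.ent_bounds ht0).1
    linarith
  refine ⟨by linarith, fun x hx => ?_⟩
  have h2 := S.w_dev ht0 hx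
  have h3 : |(∫ z in a..b, w z t) / (b - a)| ≤ K / (b - a) := by
    rw [abs_div, abs_of_pos hlam]
    have := (hb t (by linarith)).2.2.1
    gcongr
  have h4 := abs_sub_abs_le_abs_sub (w x t) ((∫ z in a..b, w z t) / (b - a))
  linarith

end Sys

/-! ### Decay of the first component -/

lemma unif_of_L2 {a b : ℝ} (hab : a < b) {f fx : ℝ → ℝ → ℝ} {T C : ℝ} (hC : 0 ≤ C)
    (hfx : ∀ t, T ≤ t → ContinuousOn (fun x => fx x t) (Set.Icc a b))
    (hd : ∀ t, T ≤ t → ∀ x ∈ Set.Icc a b, HasDerivAt (fun y => f y t) (fx x t) x)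
    (hA : ∀ t, T ≤ t → ∫ x in a..b, fx x t ^ 2 ≤ C)
    (hU : Tendsto (fun t => ∫ x in a..b, f x t ^ 2) atTop (𝓝 0)) {e : ℝ} (he : 0 < e) :
    ∀ᶠ t in atTop, ∀ x ∈ Set.Icc a b, |f x t| < e := by
  have hlam : 0 < b - a := by linarith
  set δ := e ^ 2 / (2 * (C + 1)) with hδ
  have hδp : 0 < δ := by positivity
  have h1 : Tendsto (fun t => (∫ x in a..b, f x t ^ 2) / (b - a)
      + (1 / δ) * (∫ x in a..b, f x t ^ 2)) atTop (𝓝 0) := by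
    simpa using (hU.div_const (b - a)).add (hU.const_mul (1 / δ))
  have h2 := h1.eventually_lt_const (show (0:ℝ) < e ^ 2 / 2 by positivity)
  filter_upwards [h2, eventually_ge_atTop T] with t ht htT x hx
  have h3 := sup_sq hab (hfx t htT) (hd t htT) hδp hx
  have h4 : δ * (∫ x in a..b, fx x t ^ 2) ≤ e ^ 2 / 2 := by
    calc _ ≤ δ * (C + 1) := mul_le_mul_of_nonneg_left (by linarith [hA t htT]) hδp.le
      _ = e ^ 2 / 2 := by rw [hδ]; field_simp
  have h5 : f x t ^ 2 < e ^ 2 := by linarith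
  exact abs_lt_of_sq_lt_sq h5 he.le

namespace Sys

variable {a b χ M : ℝ} {u ux uxx ut w wx wxx wt B1 B2 : ℝ → ℝ → ℝ} {β : ℝ → ℝ} {l : ℝ}

lemma m_tendsto (S : Sys a b χ M u ux uxx ut w wx wxx wt B1 B2)
    (hβ : ∀ t : ℝ, 0 < t → HasDerivAt β (∫ x in a..b, B1 x t) t)
    (hl : Tendsto β atTop (𝓝 l)) {T H : ℝ} (hT : 1 ≤ T)
    (hw : ∀ t : ℝ, T ≤ t → ∀ x ∈ Set.Icc a b, |w x t| ≤ H) :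
    Tendsto (fun t => ∫ x in a..b, u x t) atTop (𝓝 0) := by
  refine y_tendsto (y' := fun t => ∫ x in a..b, ut x t) (h := fun _ => 0) (c := Real.exp (-H))
    (T0 := T) (Real.exp_pos _) (by linarith) hβ (fun t _ => S.b1_nonneg t) hl
    (fun t ht => (S.mass (by linarith)).1) (fun t ht => (S.m_pos (by linarith)).le) ?_
    tendsto_const_nhds
  intro t ht
  have ht0 : 0 < t := by linarith
  obtain ⟨c1, c2, c3, c4, c5, c6, c7, c8, c9, c10, c11, c12, c13⟩ := S.slices ht0
  have h1 := (S.mass ht0).2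
  have h2 := int_mono S.hab (f := fun x => Real.exp (-H) * u x t)
    (g := fun x => u x t * Real.exp (w x t)) (by fun_prop) (by fun_prop) (fun x hx => by
      have h3 : Real.exp (-H) ≤ Real.exp (w x t) := Real.exp_le_exp.2 (abs_le.1 (hw t ht x hx)).1
      have h4 := S.upos x hx t ht0
      rw [mul_comm]
      gcongr)
  rw [intervalIntegral.integral_const_mul] at h2
  linarith

lemma U_ineq (S : Sys a b χ M u ux uxx ut w wx wxx wt B1 B2) (hχ : 0 < χ) {H : ℝ} (hH : 1 ≤ H) :
    ∃ G : ℝ, 0 ≤ G ∧ ∀ t : ℝ, 0 < t → (∫ x in a..b, wx x t ^ 2) ≤ H →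
      ∫ x in a..b, 2 * u x t * ut x t ≤ -(1 / 2) * (∫ x in a..b, ux x t ^ 2)
        - (∫ x in a..b, u x t ^ 2) + (G * (∫ x in a..b, u x t) ^ 2 + 2 * M * ∫ x in a..b, u x t) := by
  have hlam : 0 < b - a := by linarith [S.hab]
  have hH0 : 0 < H := by linarith
  set lam := b - a with hlamdef
  set G := χ ^ 2 * H / lam + 4 * χ ^ 4 * H ^ 2 with hG
  have hGp : 0 ≤ G := by positivity
  refine ⟨(G + 1) / lam + (G + 1) ^ 2 * lam, by positivity, fun t ht hη => ?_⟩
  have hηn := S.eta_nonneg t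
  have hE := fun p hp => (S.energy (p := p) ht hp).2
  have hm := S.m_pos ht
  have hp := fun ε (hε : 0 < ε) x hx => sup_sq (x := x) (ε := ε) S.hab (S.su.cx.slice ht)
    (fun x hx => S.su.dx x hx t ht) hε hx
  have hq : ∀ ε, 0 < ε → ∀ x ∈ Set.Icc a b, u x t ≤ (∫ x in a..b, u x t) / (b - a) +
      (ε * (∫ x in a..b, ux x t ^ 2) + (b - a) / (4 * ε)) := by
    intro ε hε x hx
    have := sup_lin S.hab (S.su.cx.slice ht) (fun x hx => S.su.dx x hx t ht) hε hx
    linarith [(abs_le.1 this).2]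
  have hU := fun p hp => S.u2_le (p := p) ht le_rfl hp
  have hUn : 0 ≤ ∫ x in a..b, u x t ^ 2 := int_nonneg' S.hab (fun x _ => sq_nonneg _)
  have hAn : 0 ≤ ∫ x in a..b, ux x t ^ 2 := int_nonneg' S.hab (fun x _ => sq_nonneg _)
  rw [← hlamdef] at *
  generalize (∫ x in a..b, ux x t ^ 2) = A at *
  generalize (∫ x in a..b, wx x t ^ 2) = η at *
  generalize (∫ x in a..b, 2 * u x t * ut x t) = U' at *
  generalize (∫ x in a..b, u x t ^ 2) = U at *
  generalize (∫ x in a..b, u x t) = m at *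
  have i1 := hE _ (hp (1 / (4 * χ ^ 2 * H)) (by positivity))
  have e1 : χ ^ 2 * (U / lam + 1 / (4 * χ ^ 2 * H) * A + 1 / (1 / (4 * χ ^ 2 * H)) * U) * H
      = A / 4 + G * U := by
    rw [hG]; field_simp; ring
  have e2 : χ ^ 2 * (U / lam + 1 / (4 * χ ^ 2 * H) * A + 1 / (1 / (4 * χ ^ 2 * H)) * U) * η ≤
      χ ^ 2 * (U / lam + 1 / (4 * χ ^ 2 * H) * A + 1 / (1 / (4 * χ ^ 2 * H)) * U) * H := by
    gcongr
  have i2 := hU _ (hq (1 / (4 * (G + 1) * m)) (by positivity))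
  have i3 := mul_le_mul_of_nonneg_left i2 (show 0 ≤ G + 1 by linarith)
  have e3 : (G + 1) * (m * (m / lam + (1 / (4 * (G + 1) * m) * A
      + lam / (4 * (1 / (4 * (G + 1) * m)))))) =
      ((G + 1) / lam + (G + 1) ^ 2 * lam) * m ^ 2 + A / 4 := by
    field_simp
    ring
  rw [e3] at i3
  linarith

lemma U_tendsto (S : Sys a b χ M u ux uxx ut w wx wxx wt B1 B2) (hχ : 0 < χ)
    (hβ : ∀ t : ℝ, 0 < t → HasDerivAt β (∫ x in a..b, B1 x t) t)
    (hl : Tendsto β atTop (𝓝 l)) {T H : ℝ} (hT : 1 ≤ T) (hH : 1 ≤ H)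
    (hw : ∀ t : ℝ, T ≤ t → ∀ x ∈ Set.Icc a b, |w x t| ≤ H)
    (hη : ∀ t : ℝ, T ≤ t → (∫ x in a..b, wx x t ^ 2) ≤ H) :
    Tendsto (fun t => ∫ x in a..b, u x t ^ 2) atTop (𝓝 0) ∧
    ∃ T1, T ≤ T1 ∧ ∀ t, T1 ≤ t → ∫ x in a..b, 2 * u x t * ut x t ≤
      -(1 / 2) * (∫ x in a..b, ux x t ^ 2) + 1 := by
  have hm := S.m_tendsto hβ hl hT hw
  obtain ⟨G, hG, h⟩ := S.U_ineq hχ hH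
  have hh : Tendsto (fun t => G * (∫ x in a..b, u x t) ^ 2 + 2 * M * ∫ x in a..b, u x t)
      atTop (𝓝 0) := by
    simpa using ((hm.pow 2).const_mul G).add (hm.const_mul (2 * M))
  have hUn : ∀ t, 0 ≤ ∫ x in a..b, u x t ^ 2 :=
    fun t => int_nonneg' S.hab (fun x _ => sq_nonneg _)
  have hAn : ∀ t, 0 ≤ ∫ x in a..b, ux x t ^ 2 :=
    fun t => int_nonneg' S.hab (fun x _ => sq_nonneg _)
  constructor
  · refine y_tendsto (y' := fun t => ∫ x in a..b, 2 * u x t * ut x t) (c := 1)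
      (T0 := T) one_pos (by linarith) hβ (fun t _ => S.b1_nonneg t) hl ?_ (fun t _ => hUn t) ?_ hh
    · intro t ht
      have ht0 : 0 < t := by linarith
      obtain ⟨p, _, hp⟩ := (show JC a b (fun x s => u x s ^ 2) from S.su.c0.pow 2).bdd
        (s := t) (t := t) ht0
      exact (S.energy (p := p) ht0 (fun x hx =>
        (le_abs_self _).trans (hp x hx t (Set.right_mem_Icc.2 le_rfl)))).1
    · intro t ht
      have h1 := h t (by linarith) (hη t ht)
      have h2 := hAn t
      have h3 := S.b1_nonneg t
      linarith
  · obtain ⟨T2, hT2⟩ := eventually_atTop.1 (hh.eventually_le_const one_pos)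
    refine ⟨max T T2, le_max_left _ _, fun t ht => ?_⟩
    have hTt : T ≤ t := (le_max_left _ _).trans ht
    have h1 := h t (by linarith) (hη t hTt)
    have h2 := hT2 t ((le_max_right _ _).trans ht)
    have h3 := hUn t
    linarith

lemma A_ineq (S : Sys a b χ M u ux uxx ut w wx wxx wt B1 B2) (hχ : 0 < χ) {H K : ℝ} (hH : 1 ≤ H)
    (hK : 0 ≤ K) :
    ∃ G G' : ℝ, 0 ≤ G ∧ 0 ≤ G' ∧ ∀ t : ℝ, 0 < t → (∫ x in a..b, wx x t ^ 2) ≤ H →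
      (∀ x ∈ Set.Icc a b, |w x t| ≤ H) → (∫ x in a..b, u x t ^ 2) ≤ 1 →
      (∫ x in a..b, Real.exp (-2 * w x t)) ≤ K →
      ∫ x in a..b, -2 * (ut x t * uxx x t) ≤
        (G - G' * ∫ x in a..b, -2 * (wt x t * wxx x t)) * ((∫ x in a..b, ux x t ^ 2) + 1) := by
  have hlam : 0 < b - a := by linarith [S.hab]
  have hH0 : 0 < H := by linarith
  set lam := b - a with hlamdef
  set G3 := 2 + 1 / lam with hG3
  have hG3p : 0 ≤ G3 := by positivity
  set K4 := 3 + 3 * lam + 3 * M ^ 2 * K with hK4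
  have hK4p : 0 ≤ K4 := by positivity
  set G4 := 16 * χ ^ 4 * H ^ 2 + 4 * G3 * Real.exp H ^ 2 * lam + 4 * M ^ 2 * lam with hG4
  have hG4p : 0 ≤ G4 := by positivity
  refine ⟨G4 + 4 * χ ^ 2 * G3 * K4, 4 * χ ^ 2 * G3, by positivity, by positivity,
    fun t ht hη hw hU hR => ?_⟩
  have hηn := S.eta_nonneg t
  have hD := S.dirw ht
  have hdu := fun p q hp hq => S.diru (p := p) (q := q) (C := Real.exp H) ht hp hq
    (fun x hx => Real.exp_le_exp.2 (abs_le.1 (hw x hx)).2)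
  have hp := fun ε (hε : 0 < ε) x hx => sup_sq0 (x := x) (ε := ε) S.hab (S.su.cxx.slice ht)
    (fun x hx => S.su.dxx x hx t ht) (S.su.bca t ht) hε hx
  have hq := fun x hx => sup_sq (x := x) (ε := 1) S.hab (S.su.cx.slice ht)
    (fun x hx => S.su.dx x hx t ht) one_pos hx
  have hUn : 0 ≤ ∫ x in a..b, u x t ^ 2 := int_nonneg' S.hab (fun x _ => sq_nonneg _)
  have hAn : 0 ≤ ∫ x in a..b, ux x t ^ 2 := int_nonneg' S.hab (fun x _ => sq_nonneg _)
  have hQn : 0 ≤ ∫ x in a..b, uxx x t ^ 2 := int_nonneg' S.hab (fun x _ => sq_nonneg _)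
  have hDn : 0 ≤ ∫ x in a..b, wxx x t ^ 2 := int_nonneg' S.hab (fun x _ => sq_nonneg _)
  rw [← hlamdef] at *
  generalize (∫ x in a..b, ux x t ^ 2) = A at *
  generalize (∫ x in a..b, uxx x t ^ 2) = Q at *
  generalize (∫ x in a..b, wx x t ^ 2) = η at *
  generalize (∫ x in a..b, -2 * (wt x t * wxx x t)) = η' at *
  generalize (∫ x in a..b, -2 * (ut x t * uxx x t)) = A' at *
  generalize (∫ x in a..b, u x t ^ 2) = U at *
  generalize (∫ x in a..b, wxx x t ^ 2) = D at *
  generalize (∫ x in a..b, Real.exp (-2 * w x t)) = R at *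
  have hq2 : ∀ x ∈ Set.Icc a b, u x t ^ 2 ≤ G3 * (A + 1) := by
    intro x hx
    have h1 := hq x hx
    have h2 : U / lam ≤ 1 / lam := by gcongr
    have h3 : 0 ≤ 1 / lam := by positivity
    have h4 : 0 ≤ 1 / lam * A := by positivity
    rw [hG3]
    linarith
  have i1 := hdu _ _ (hp (1 / (4 * χ ^ 2 * H)) (by positivity)) hq2
  have e1 : 4 * χ ^ 2 * (1 / (4 * χ ^ 2 * H) * Q + 1 / (1 / (4 * χ ^ 2 * H)) * A) * H
      = Q + 16 * χ ^ 4 * H ^ 2 * A := by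
    field_simp
    ring
  have e2 : 4 * χ ^ 2 * (1 / (4 * χ ^ 2 * H) * Q + 1 / (1 / (4 * χ ^ 2 * H)) * A) * η
      ≤ 4 * χ ^ 2 * (1 / (4 * χ ^ 2 * H) * Q + 1 / (1 / (4 * χ ^ 2 * H)) * A) * H := by
    gcongr
  have hR2 : 3 * M ^ 2 * R ≤ 3 * M ^ 2 * K := mul_le_mul_of_nonneg_left hR (by positivity)
  have i2 : D ≤ K4 - η' := by rw [hK4]; linarith
  have i3 : 4 * χ ^ 2 * (G3 * (A + 1)) * D ≤ 4 * χ ^ 2 * (G3 * (A + 1)) * (K4 - η') := by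
    gcongr
  have i4 : 16 * χ ^ 4 * H ^ 2 * A ≤ 16 * χ ^ 4 * H ^ 2 * (A + 1) := by
    gcongr; linarith
  have i5 : 4 * M ^ 2 * lam * 1 ≤ 4 * M ^ 2 * lam * (A + 1) := by
    gcongr; linarith
  have e3 : (G4 + 4 * χ ^ 2 * G3 * K4 - 4 * χ ^ 2 * G3 * η') * (A + 1) =
    16 * χ ^ 4 * H ^ 2 * (A + 1) + 4 * G3 * Real.exp H ^ 2 * lam * (A + 1)
    + 4 * M ^ 2 * lam * (A + 1) + 4 * χ ^ 2 * (G3 * (A + 1)) * (K4 - η') := by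
    rw [hG4]; ring
  rw [e3]
  linarith

lemma A_bdd (S : Sys a b χ M u ux uxx ut w wx wxx wt B1 B2) (hχ : 0 < χ) {T H K : ℝ}
    (hT : 1 ≤ T) (hH : 1 ≤ H) (hK : 0 ≤ K)
    (hw : ∀ t : ℝ, T ≤ t → ∀ x ∈ Set.Icc a b, |w x t| ≤ H)
    (hη : ∀ t : ℝ, T ≤ t → (∫ x in a..b, wx x t ^ 2) ≤ H)
    (hU : ∀ t : ℝ, T ≤ t → (∫ x in a..b, u x t ^ 2) ≤ 1)
    (hR : ∀ t : ℝ, T ≤ t → (∫ x in a..b, Real.exp (-2 * w x t)) ≤ K)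
    (hU' : ∀ t, T ≤ t → ∫ x in a..b, 2 * u x t * ut x t ≤
      -(1 / 2) * (∫ x in a..b, ux x t ^ 2) + 1) :
    ∃ C : ℝ, 0 ≤ C ∧ ∀ t, T + 1 ≤ t → ∫ x in a..b, ux x t ^ 2 ≤ C := by
  obtain ⟨G, G', hG, hG', h⟩ := S.A_ineq hχ hH hK
  refine ⟨5 * Real.exp (G + G' * H), by positivity, fun t ht => ?_⟩
  have hUn : ∀ t, 0 ≤ ∫ x in a..b, u x t ^ 2 :=
    fun t => int_nonneg' S.hab (fun x _ => sq_nonneg _)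
  obtain ⟨s, hs, hs1, hs2, hs3⟩ := mvt1 (T0 := T) (t := t)
    (y := fun s => ∫ x in a..b, u x s ^ 2) (y' := fun s => ∫ x in a..b, 2 * u x s * ut x s)
    (fun r hr => by
      have ht0 : 0 < r := by linarith
      obtain ⟨p, _, hp⟩ := (show JC a b (fun x s => u x s ^ 2) from S.su.c0.pow 2).bdd
        (s := r) (t := r) ht0
      exact (S.energy (p := p) ht0 (fun x hx =>
        (le_abs_self _).trans (hp x hx r (Set.right_mem_Icc.2 le_rfl)))).1) ht
  have h1 := hU' s hs
  have h2 := hU (t - 1) (by linarith)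
  have h3 := hUn t
  have h4 : (∫ x in a..b, ux x s ^ 2) + 1 ≤ 5 := by linarith
  have h5 := gron (y := fun s => (∫ x in a..b, ux x s ^ 2) + 1)
    (y' := fun s => ∫ x in a..b, -2 * (ut x s * uxx x s))
    (θ := fun s => G * s - G' * ∫ x in a..b, wx x s ^ 2)
    (θ' := fun s => G - G' * ∫ x in a..b, -2 * (wt x s * wxx x s)) hs2
    (fun r hr => (deriv_dirichlet S.hab S.su (by linarith [hr.1])).add_const 1)
    (fun r hr => by
      have k1 := (hasDerivAt_id r).const_mul G
      have k2 := (deriv_dirichlet S.hab S.sw (t := r) (by linarith [hr.1])).const_mul G'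
      exact HasDerivAt.congr_deriv (k1.sub k2) (by simp))
    (fun r hr => by
      have hr1 : T ≤ r := by linarith [hr.1]
      exact h r (by linarith) (hη r hr1) (hw r hr1) (hU r hr1) (hR r hr1))
  have h6 : Real.exp (G * t - G' * (∫ x in a..b, wx x t ^ 2)
      - (G * s - G' * ∫ x in a..b, wx x s ^ 2)) ≤ Real.exp (G + G' * H) := by
    apply Real.exp_le_exp.2
    have k1 := mul_le_mul_of_nonneg_left (hη s hs) hG'
    have k2 := mul_nonneg hG' (S.eta_nonneg t)
    have k3 := mul_le_mul_of_nonneg_left (show t - s ≤ 1 by linarith) hG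
    linarith
  have h7 := mul_le_mul h4 h6 (Real.exp_pos _).le (by norm_num)
  linarith

/-- Collected consequences. -/
lemma final_u (S : Sys a b χ M u ux uxx ut w wx wxx wt B1 B2) (hχ : 0 < χ)
    (hβ : ∀ t : ℝ, 0 < t → HasDerivAt β (∫ x in a..b, B1 x t) t)
    (hl : Tendsto β atTop (𝓝 l)) {T β0 : ℝ} (hT : 1 ≤ T) (hβ0 : 0 < β0)
    (hB : ∀ t, T ≤ t → β0 ≤ ∫ x in a..b, B2 x t) :
    (∀ e : ℝ, 0 < e → ∀ᶠ t in atTop, ∀ x ∈ Set.Icc a b, |u x t| < e) ∧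
    Tendsto (fun t => ∫ x in a..b, u x t ^ 2) atTop (𝓝 0) ∧
    ∃ T1 H, 1 ≤ T1 ∧ 1 ≤ H ∧ ∀ t, T1 ≤ t → (∫ x in a..b, wx x t ^ 2) ≤ H ∧
      ∀ x ∈ Set.Icc a b, |w x t| ≤ H := by
  obtain ⟨K, hK, hb⟩ := S.basic hβ hl hT hβ0 hB
  obtain ⟨H, hH, hh⟩ := S.eta_bdd hχ (T := T + 1) (by linarith) hK hb
  obtain ⟨hU, T1, hT1, hU'⟩ := S.U_tendsto hχ hβ hl (T := T + 1 + 1) (by linarith) hH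
    (fun t ht => (hh t ht).2) (fun t ht => (hh t ht).1)
  obtain ⟨T2, hT2⟩ := eventually_atTop.1 (hU.eventually_le_const one_pos)
  set T3 := max T1 T2
  have h31 : T1 ≤ T3 := le_max_left _ _
  have h32 : T2 ≤ T3 := le_max_right _ _
  obtain ⟨C, hC, hA⟩ := S.A_bdd hχ (T := T3) (H := H) (K := K) (by linarith) hH (by linarith)
    (fun t ht => (hh t (by linarith)).2) (fun t ht => (hh t (by linarith)).1)
    (fun t ht => hT2 t (by linarith)) (fun t ht => (hb t (by linarith)).2.2.2)
    (fun t ht => hU' t (by linarith))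
  refine ⟨fun e he => unif_of_L2 S.hab (T := T3 + 1) hC
    (fun t ht => S.su.cx.slice (by linarith))
    (fun t ht x hx => S.su.dx x hx t (by linarith)) hA hU he, hU, T + 1 + 1, H, by linarith, hH,
    fun t ht => hh t ht⟩

end Sys

/-! ### Convergence of the second component -/

lemma ii_eq {a b : ℝ} (hab : a < b) (f : ℝ → ℝ) :
    ∫ x in a..b, f x = ∫ x in Set.Ioo a b, f x := by
  rw [intervalIntegral.integral_of_le hab.le, integral_Ioc_eq_integral_Ioo]

lemma B2_facts {a b M : ℝ} (hab : a < b) {B2 : ℝ → ℝ → ℝ} {Bi : ℝ → ℝ} (hM : 0 ≤ M)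
    (cB2 : JC a b B2) (B2nn : ∀ x t, 0 ≤ B2 x t) (B2M : ∀ x t, B2 x t ≤ M)
    (hBi : IntegrableOn Bi (Set.Ioo a b))
    (hconv : ∀ᵐ x ∂(volume.restrict (Set.Ioo a b)),
      Tendsto (fun t : ℝ => B2 x t) atTop (𝓝 (Bi x))) :
    (∀ t : ℝ, 0 < t → IntervalIntegrable (fun x => (B2 x t - Bi x) ^ 2) volume a b) ∧
    Tendsto (fun t => ∫ x in a..b, (B2 x t - Bi x) ^ 2) atTop (𝓝 0) ∧
    Tendsto (fun t => ∫ x in a..b, B2 x t) atTop (𝓝 (∫ x in a..b, Bi x)) ∧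
    (¬ (∀ᵐ x ∂(volume.restrict (Set.Ioo a b)), Bi x = 0) → 0 < ∫ x in a..b, Bi x) := by
  have hBi0 : ∀ᵐ x ∂(volume.restrict (Set.Ioo a b)), 0 ≤ Bi x ∧ Bi x ≤ M := by
    filter_upwards [hconv] with x hx
    exact ⟨ge_of_tendsto' hx (fun t => B2nn x t), le_of_tendsto' hx (fun t => B2M x t)⟩
  have hmeas : ∀ t : ℝ, 0 < t →
      AEStronglyMeasurable (fun x => B2 x t) (volume.restrict (Set.Ioo a b)) := fun t ht =>
    ((cB2.slice ht).mono Set.Ioo_subset_Icc_self).aestronglyMeasurable measurableSet_Ioo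
  have hmeas2 : ∀ t : ℝ, 0 < t → AEStronglyMeasurable (fun x => (B2 x t - Bi x) ^ 2)
      (volume.restrict (Set.Ioo a b)) := fun t ht =>
    ((hmeas t ht).sub hBi.aestronglyMeasurable).pow 2
  have hbd : ∀ t : ℝ, ∀ᵐ x ∂(volume.restrict (Set.Ioo a b)), ‖(B2 x t - Bi x) ^ 2‖ ≤ M ^ 2 := by
    intro t
    filter_upwards [hBi0] with x hx
    rw [Real.norm_eq_abs, abs_of_nonneg (sq_nonneg _)]
    have h1 := B2nn x t
    have h2 := B2M x t
    apply sq_le_sq'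
    · linarith [hx.1, hx.2]
    · linarith [hx.1, hx.2]
  have hfin : IsFiniteMeasure (volume.restrict (Set.Ioo a b)) := ⟨by simp⟩
  have e0 : ∀ᶠ t : ℝ in atTop, 0 < t := eventually_gt_atTop 0
  refine ⟨fun t ht => ?_, ?_, ?_, fun hne => ?_⟩
  · rw [intervalIntegrable_iff_integrableOn_Ioo_of_le hab.le]
    exact Integrable.of_bound (hmeas2 t ht) (M ^ 2) (hbd t)
  · simp only [ii_eq hab]
    have := tendsto_integral_filter_of_dominated_convergence
      (μ := volume.restrict (Set.Ioo a b)) (l := atTop)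
      (F := fun (t : ℝ) x => (B2 x t - Bi x) ^ 2) (f := fun _ => 0) (fun _ => M ^ 2)
      (e0.mono hmeas2) (Eventually.of_forall hbd) (integrable_const _)
      (by
        filter_upwards [hconv] with x hx
        have := (hx.sub_const (Bi x)).pow 2
        simpa using this)
    simpa using this
  · simp only [ii_eq hab]
    refine tendsto_integral_filter_of_dominated_convergence (fun _ => M)
      (e0.mono hmeas) (Eventually.of_forall fun t => ?_) (integrable_const _) hconv
    filter_upwards with x
    rw [Real.norm_eq_abs, abs_of_nonneg (B2nn x t)]
    exact B2M x t
  · rw [ii_eq hab]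
    have h0 : 0 ≤ᵐ[volume.restrict (Set.Ioo a b)] Bi := hBi0.mono (fun x hx => hx.1)
    refine lt_of_le_of_ne (integral_nonneg_of_ae h0) (fun h => hne ?_)
    exact (integral_eq_zero_iff_of_nonneg_ae h0 hBi).1 h.symm

namespace Sys

variable {a b χ M : ℝ} {u ux uxx ut w wx wxx wt B1 B2 : ℝ → ℝ → ℝ} {β : ℝ → ℝ} {l : ℝ}
  {q qx qxx Bi : ℝ → ℝ}

lemma Z_ineq (S : Sys a b χ M u ux uxx ut w wx wxx wt B1 B2)
    (dq : ∀ x ∈ Set.Icc a b, HasDerivAt q (qx x) x)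
    (dqx : ∀ x ∈ Set.Icc a b, HasDerivAt qx (qxx x) x) (qa : qx a = 0) (qb : qx b = 0)
    (hq : ∀ x ∈ Set.Ioo a b, qxx x = q x - Bi x) (hBi : IntegrableOn Bi (Set.Ioo a b))
    {t H : ℝ} (ht : 0 < t) (hw : ∀ x ∈ Set.Icc a b, |w x t| ≤ H)
    (hint : IntervalIntegrable (fun x => (B2 x t - Bi x) ^ 2) volume a b) :
    HasDerivAt (fun s => ∫ x in a..b, (Real.exp (w x s) - q x) ^ 2)
      (∫ x in a..b, 2 * (Real.exp (w x t) - q x) * (Real.exp (w x t) * wt x t)) t ∧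
    ∫ x in a..b, 2 * (Real.exp (w x t) - q x) * (Real.exp (w x t) * wt x t) ≤
      -(∫ x in a..b, (Real.exp (w x t) - q x) ^ 2)
      + 2 * Real.exp H ^ 2 * (∫ x in a..b, u x t ^ 2) + 2 * ∫ x in a..b, (B2 x t - Bi x) ^ 2 := by
  obtain ⟨c1, c2, c3, c4, c5, c6, c7, c8, c9, c10, c11, c12, c13⟩ := S.slices ht
  have cq : ContinuousOn q (Set.Icc a b) := fun x hx => (dq x hx).continuousAt.continuousWithinAt
  have cqx : ContinuousOn qx (Set.Icc a b) :=
    fun x hx => (dqx x hx).continuousAt.continuousWithinAt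
  refine ⟨deriv_int S.hab (F := fun x s => (Real.exp (w x s) - q x) ^ 2)
    (F' := fun x s => 2 * (Real.exp (w x s) - q x) * (Real.exp (w x s) * wt x s))
    (fun s hs => by
      have := (S.slices hs).2.2.2.2.2.2.2.2.2.2.1
      fun_prop)
    (by
      have k1 := S.sw.c0
      have k2 := S.sw.ct
      have k3 : ContinuousOn (fun p : ℝ × ℝ => q p.1) (Set.Icc a b ×ˢ Set.Ioi 0) :=
        cq.comp continuousOn_fst (fun p hp => hp.1)
      unfold JC at *
      have k4 : ContinuousOn (fun p : ℝ × ℝ => Real.exp (w p.1 p.2)) (Set.Icc a b ×ˢ Set.Ioi 0) :=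
        k1.rexp
      exact (continuousOn_const.mul (k4.sub k3)).mul (k4.mul k2))
    (fun x hx s hs => by
      have := (((S.sw.dt x hx s hs).exp).sub_const (q x)).fun_pow 2
      simpa using this) ht, ?_⟩
  have iqxx : IntervalIntegrable qxx volume a b := by
    rw [intervalIntegrable_iff_integrableOn_Ioo_of_le S.hab.le]
    refine IntegrableOn.congr_fun (f := fun x => q x - Bi x) ?_ (fun x hx => (hq x hx).symm)
      measurableSet_Ioo
    exact ((cq.integrableOn_Icc).mono_set Set.Ioo_subset_Icc_self).sub hBi
  have hucc : Set.uIcc a b = Set.Icc a b := Set.uIcc_of_le S.hab.le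
  set g' : ℝ → ℝ := fun x => (Real.exp (w x t) * wx x t - qx x)
      * (2 * (Real.exp (w x t) * wx x t - qx x))
      + (Real.exp (w x t) - q x) * (2 * (Real.exp (w x t) * wx x t * wx x t
        + Real.exp (w x t) * wxx x t - qxx x)) with hg'
  have ig' : IntervalIntegrable g' volume a b := by
    have k1 : IntervalIntegrable (fun x => (Real.exp (w x t) * wx x t - qx x)
      * (2 * (Real.exp (w x t) * wx x t - qx x))
      + (Real.exp (w x t) - q x) * (2 * (Real.exp (w x t) * wx x t * wx x t
        + Real.exp (w x t) * wxx x t))) volume a b := cii S.hab (by fun_prop)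
    have k2 : IntervalIntegrable (fun x => (2 * (Real.exp (w x t) - q x)) * qxx x) volume a b :=
      iqxx.continuousOn_mul (by rw [hucc]; fun_prop)
    refine (k1.sub k2).congr (fun x _ => ?_)
    simp only [hg']
    ring
  have hg0 : ∫ x in a..b, g' x = 0 := by
    rw [intervalIntegral.integral_eq_sub_of_hasDerivAt
      (f := fun x => (Real.exp (w x t) - q x) * (2 * (Real.exp (w x t) * wx x t - qx x))) ?_ ig']
    · simp [qa, qb, S.sw.bca t ht, S.sw.bcb t ht]
    · intro x hx
      rw [hucc] at hx
      have k1 := (S.sw.dx x hx t ht).exp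
      exact (k1.sub (dq x hx)).mul (((k1.mul (S.sw.dxx x hx t ht)).sub (dqx x hx)).const_mul 2)
  have iz : IntervalIntegrable (fun x => (Real.exp (w x t) - q x) ^ 2) volume a b :=
    cii S.hab (by fun_prop)
  have iu : IntervalIntegrable (fun x => u x t ^ 2) volume a b := cii S.hab (by fun_prop)
  have izn : IntervalIntegrable (fun x => -(Real.exp (w x t) - q x) ^ 2) volume a b := iz.neg
  have iu2 : IntervalIntegrable (fun x => 2 * Real.exp H ^ 2 * u x t ^ 2) volume a b :=
    iu.const_mul _
  have ib2 : IntervalIntegrable (fun x => 2 * (B2 x t - Bi x) ^ 2) volume a b := hint.const_mul _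
  have is1 : IntervalIntegrable (fun x => 2 * Real.exp H ^ 2 * u x t ^ 2
      + 2 * (B2 x t - Bi x) ^ 2) volume a b := iu2.add ib2
  have is2 : IntervalIntegrable (fun x => -(Real.exp (w x t) - q x) ^ 2
      + (2 * Real.exp H ^ 2 * u x t ^ 2 + 2 * (B2 x t - Bi x) ^ 2)) volume a b := izn.add is1
  have key := intervalIntegral.integral_mono_on_of_le_Ioo S.hab.le
    (f := fun x => 2 * (Real.exp (w x t) - q x) * (Real.exp (w x t) * wt x t))
    (g := fun x => g' x + (-(Real.exp (w x t) - q x) ^ 2 + (2 * Real.exp H ^ 2 * u x t ^ 2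
      + 2 * (B2 x t - Bi x) ^ 2))) (μ := volume)
    (cii S.hab (by fun_prop))
    (ig'.add is2)
    (fun x hx => by
      have hx' := Set.Ioo_subset_Icc_self hx
      have h0 := hq x hx
      have h1 := S.eqw x hx' t ht
      have h2 : Real.exp (w x t) * Real.exp (-w x t) = 1 := by rw [← Real.exp_add]; simp
      have h3 : Real.exp (w x t) * wt x t = Real.exp (w x t) * wx x t * wx x t
        + Real.exp (w x t) * wxx x t + u x t * Real.exp (w x t) - Real.exp (w x t) + B2 x t := by
        rw [h1]
        linear_combination B2 x t * h2
      have h4 : Real.exp (w x t) ≤ Real.exp H := Real.exp_le_exp.2 (abs_le.1 (hw x hx')).2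
      have h5 : (u x t * Real.exp (w x t)) ^ 2 ≤ Real.exp H ^ 2 * u x t ^ 2 := by
        rw [mul_pow, mul_comm]
        gcongr
      simp only [hg']
      rw [h3, h0]
      generalize Real.exp (w x t) * wx x t * wx x t + Real.exp (w x t) * wxx x t = vxx
      generalize Real.exp (w x t) * wx x t = vx
      generalize u x t * Real.exp (w x t) = uv at *
      generalize Real.exp (w x t) = vv
      nlinarith [sq_nonneg (vv - q x - 2 * uv), sq_nonneg (vv - q x - 2 * (B2 x t - Bi x)),
        sq_nonneg (vx - qx x)])
  rw [intervalIntegral.integral_add ig' is2, intervalIntegral.integral_add izn is1,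
    intervalIntegral.integral_add iu2 ib2, hg0,
    intervalIntegral.integral_neg, intervalIntegral.integral_const_mul,
    intervalIntegral.integral_const_mul] at key
  linarith

lemma final_v (S : Sys a b χ M u ux uxx ut w wx wxx wt B1 B2)
    (hβ : ∀ t : ℝ, 0 < t → HasDerivAt β (∫ x in a..b, B1 x t) t)
    (hl : Tendsto β atTop (𝓝 l))
    (dq : ∀ x ∈ Set.Icc a b, HasDerivAt q (qx x) x)
    (dqx : ∀ x ∈ Set.Icc a b, HasDerivAt qx (qxx x) x) (qa : qx a = 0) (qb : qx b = 0)
    (hq : ∀ x ∈ Set.Ioo a b, qxx x = q x - Bi x) (hBi : IntegrableOn Bi (Set.Ioo a b))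
    {T1 H : ℝ} (hT1 : 1 ≤ T1) (hH : 1 ≤ H)
    (hh : ∀ t, T1 ≤ t → (∫ x in a..b, wx x t ^ 2) ≤ H ∧ ∀ x ∈ Set.Icc a b, |w x t| ≤ H)
    (hU : Tendsto (fun t => ∫ x in a..b, u x t ^ 2) atTop (𝓝 0))
    (hint : ∀ t : ℝ, 0 < t → IntervalIntegrable (fun x => (B2 x t - Bi x) ^ 2) volume a b)
    (hB : Tendsto (fun t => ∫ x in a..b, (B2 x t - Bi x) ^ 2) atTop (𝓝 0)) {e : ℝ} (he : 0 < e) :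
    ∀ᶠ t in atTop, ∀ x ∈ Set.Icc a b, |Real.exp (w x t) - q x| < e := by
  have cqx : ContinuousOn qx (Set.Icc a b) :=
    fun x hx => (dqx x hx).continuousAt.continuousWithinAt
  have hZ : Tendsto (fun t => ∫ x in a..b, (Real.exp (w x t) - q x) ^ 2) atTop (𝓝 0) := by
    refine y_tendsto
      (y' := fun t => ∫ x in a..b, 2 * (Real.exp (w x t) - q x) * (Real.exp (w x t) * wt x t))
      (h := fun t => 2 * Real.exp H ^ 2 * (∫ x in a..b, u x t ^ 2)
        + 2 * ∫ x in a..b, (B2 x t - Bi x) ^ 2) (c := 1) (T0 := T1)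
      one_pos (by linarith) hβ (fun t _ => S.b1_nonneg t) hl
      (fun t ht => (S.Z_ineq dq dqx qa qb hq hBi (by linarith) (hh t ht).2
        (hint t (by linarith))).1)
      (fun t ht => int_nonneg' S.hab (fun x _ => sq_nonneg _)) (fun t ht => ?_) ?_
    · have h1 := (S.Z_ineq dq dqx qa qb hq hBi (by linarith) (hh t ht).2 (hint t (by linarith))).2
      have h2 := S.b1_nonneg t
      linarith
    · simpa using (hU.const_mul (2 * Real.exp H ^ 2)).add (hB.const_mul 2)
  have hqn : 0 ≤ ∫ x in a..b, qx x ^ 2 := int_nonneg' S.hab (fun x _ => sq_nonneg _)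
  refine unif_of_L2 S.hab (f := fun x t => Real.exp (w x t) - q x)
    (fx := fun x t => Real.exp (w x t) * wx x t - qx x) (T := T1)
    (C := 2 * Real.exp H ^ 2 * H + 2 * ∫ x in a..b, qx x ^ 2) (by positivity) ?_ ?_ ?_ hZ he
  · intro t ht
    obtain ⟨c1, c2, c3, c4, c5, c6, c7, c8, c9, c10, c11, c12, c13⟩ :=
      S.slices (t := t) (by linarith)
    fun_prop
  · intro t ht x hx
    exact ((S.sw.dx x hx t (by linarith)).exp).sub (dq x hx)
  · intro t ht
    obtain ⟨c1, c2, c3, c4, c5, c6, c7, c8, c9, c10, c11, c12, c13⟩ :=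
      S.slices (t := t) (by linarith)
    have := int_lin S.hab (P := fun x => (Real.exp (w x t) * wx x t - qx x) ^ 2)
      (f1 := fun x => wx x t ^ 2) (f2 := fun x => qx x ^ 2) (2 * Real.exp H ^ 2) 2
      (by fun_prop) (by fun_prop) (by fun_prop) (fun x hx => by
        have h4 : Real.exp (w x t) ≤ Real.exp H := Real.exp_le_exp.2 (abs_le.1 ((hh t ht).2 x hx)).2
        have h5 : (Real.exp (w x t) * wx x t) ^ 2 ≤ Real.exp H ^ 2 * wx x t ^ 2 := by
          rw [mul_pow]
          gcongr
        nlinarith [sq_nonneg (Real.exp (w x t) * wx x t + qx x)])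
    have h6 : 2 * Real.exp H ^ 2 * (∫ x in a..b, wx x t ^ 2) ≤ 2 * Real.exp H ^ 2 * H := by
      gcongr
      exact (hh t ht).1
    linarith

end Sys
/-! ### From the crime model to the logarithmic system -/

lemma mem_It'_top {t : ℝ} : t ∈ It' ⊤ ↔ 0 < t := by simp [It']

lemma HypB.jc {a b : ℝ} {B : ℝ → ℝ → ℝ} (h : HypB a b B) : JC a b B := by
  obtain ⟨_, _, ϑ, hϑ, hK⟩ := h
  rintro ⟨x, t⟩ ⟨hx, ht⟩
  have ht' : (0:ℝ) < t := ht
  obtain ⟨C, hC⟩ := hK (Set.Icc a b ×ˢ Set.Icc 0 (t + 1)) (isCompact_Icc.prod isCompact_Icc)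
    (Set.prod_mono le_rfl (fun s hs => hs.1))
  have hev : ∀ᶠ p : ℝ × ℝ in 𝓝[Set.Icc a b ×ˢ Set.Ioi 0] (x, t),
      p ∈ Set.Icc a b ×ˢ Set.Icc 0 (t + 1) := by
    have h1 : ∀ᶠ p : ℝ × ℝ in 𝓝 (x, t), p.2 < t + 1 :=
      (continuous_snd.tendsto (x, t)).eventually (gt_mem_nhds (by simp))
    filter_upwards [self_mem_nhdsWithin, h1.filter_mono nhdsWithin_le_nhds] with p hp hp1
    exact ⟨hp.1, le_of_lt hp.2, hp1.le⟩
  have hlim : Tendsto (fun p : ℝ × ℝ => C * dist p (x, t) ^ ϑ) (𝓝 (x, t)) (𝓝 0) := by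
    have h1 : Tendsto (fun p : ℝ × ℝ => dist p (x, t)) (𝓝 (x, t)) (𝓝 0) := by
      have : Continuous (fun p : ℝ × ℝ => dist p (x, t)) := by fun_prop
      simpa using this.tendsto (x, t)
    have h2 := (h1.rpow_const (p := ϑ) (Or.inr hϑ.1.le)).const_mul C
    simpa [Real.zero_rpow hϑ.1.ne'] using h2
  have : Tendsto (fun p : ℝ × ℝ => B p.1 p.2) (𝓝[Set.Icc a b ×ˢ Set.Ioi 0] (x, t))
      (𝓝 (B x t)) := by
    rw [tendsto_iff_dist_tendsto_zero]
    refine squeeze_zero' (Eventually.of_forall fun p => dist_nonneg) ?_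
      (hlim.mono_left nhdsWithin_le_nhds)
    filter_upwards [hev] with p hp
    rw [Real.dist_eq]
    exact hC p hp (x, t) ⟨hx, ht'.le, by linarith⟩
  exact this

lemma eq_on_Icc {a b : ℝ} (hab : a < b) {f g : ℝ → ℝ} (hf : ContinuousOn f (Set.Icc a b))
    (hg : ContinuousOn g (Set.Icc a b)) (h : ∀ x ∈ Set.Ioo a b, f x = g x) :
    ∀ x ∈ Set.Icc a b, f x = g x := by
  have h1 : Set.EqOn f g (Set.Ioo a b) := h
  exact h1.of_subset_closure hf hg Set.Ioo_subset_Icc_self (by rw [closure_Ioo hab.ne])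

lemma CrimeSol.toSys {a b χ M : ℝ} {B1 B2 : ℝ → ℝ → ℝ} {u0 v0 : ℝ → ℝ} {u v : ℝ → ℝ → ℝ}
    (hab : a < b) (hM : 0 ≤ M) (S : CrimeSol a b χ B1 B2 u0 v0 u v ⊤)
    (hB1 : HypB a b B1) (hB2 : HypB a b B2) (h1 : ∀ x t, B1 x t ≤ M) (h2 : ∀ x t, B2 x t ≤ M) :
    Sys a b χ M u (pdx u) (pdx (pdx u)) (pdt u) (fun x t => Real.log (v x t))
      (fun x t => pdx v x t / v x t)
      (fun x t => (pdx (pdx v) x t * v x t - pdx v x t * pdx v x t) / v x t ^ 2)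
      (fun x t => pdt v x t / v x t) B1 B2 := by
  have hI : It' ⊤ = Set.Ioi (0:ℝ) := by ext t; simp [It']
  have hsub : Set.Icc a b ×ˢ Set.Ioi (0:ℝ) ⊆ Set.Icc a b ×ˢ It ⊤ :=
    Set.prod_mono le_rfl (fun t ht => ⟨le_of_lt ht, by simp⟩)
  have cu : JC a b u := S.u_cont.mono hsub
  have cv : JC a b v := S.v_cont.mono hsub
  have hu := S.u_cont21
  have hv := S.v_cont21
  rw [hI] at hu hv
  have cux : JC a b (pdx u) := hu.fst
  have cuxx : JC a b (pdx (pdx u)) := hu.snd.fst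
  have cut : JC a b (pdt u) := hu.snd.snd
  have cvx : JC a b (pdx v) := hv.fst
  have cvxx : JC a b (pdx (pdx v)) := hv.snd.fst
  have cvt : JC a b (pdt v) := hv.snd.snd
  have vpos : ∀ x ∈ Set.Icc a b, ∀ t : ℝ, 0 < t → 0 < v x t :=
    fun x hx t ht => S.v_pos x hx t (mem_It'_top.2 ht)
  have vne : ∀ p ∈ Set.Icc a b ×ˢ Set.Ioi (0:ℝ), v p.1 p.2 ≠ 0 :=
    fun p hp => (vpos p.1 hp.1 p.2 hp.2).ne'
  have dux : ∀ x ∈ Set.Icc a b, ∀ t : ℝ, 0 < t → HasDerivAt (fun y => u y t) (pdx u x t) x :=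
    fun x hx t ht => (S.u_reg x hx t (mem_It'_top.2 ht)).1.hasDerivAt
  have duxx : ∀ x ∈ Set.Icc a b, ∀ t : ℝ, 0 < t →
      HasDerivAt (fun y => pdx u y t) (pdx (pdx u) x t) x :=
    fun x hx t ht => (S.u_reg x hx t (mem_It'_top.2 ht)).2.1.hasDerivAt
  have dut : ∀ x ∈ Set.Icc a b, ∀ t : ℝ, 0 < t → HasDerivAt (fun s => u x s) (pdt u x t) t :=
    fun x hx t ht => (S.u_reg x hx t (mem_It'_top.2 ht)).2.2.hasDerivAt
  have dvx : ∀ x ∈ Set.Icc a b, ∀ t : ℝ, 0 < t → HasDerivAt (fun y => v y t) (pdx v x t) x :=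
    fun x hx t ht => (S.v_reg x hx t (mem_It'_top.2 ht)).1.hasDerivAt
  have dvxx : ∀ x ∈ Set.Icc a b, ∀ t : ℝ, 0 < t →
      HasDerivAt (fun y => pdx v y t) (pdx (pdx v) x t) x :=
    fun x hx t ht => (S.v_reg x hx t (mem_It'_top.2 ht)).2.1.hasDerivAt
  have dvt : ∀ x ∈ Set.Icc a b, ∀ t : ℝ, 0 < t → HasDerivAt (fun s => v x s) (pdt v x t) t :=
    fun x hx t ht => (S.v_reg x hx t (mem_It'_top.2 ht)).2.2.hasDerivAt
  have su : Sm a b u (pdx u) (pdx (pdx u)) (pdt u) :=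
    ⟨cu, cux, cuxx, cut, dux, duxx, dut, fun t ht => (S.u_bc t (mem_It'_top.2 ht)).1,
      fun t ht => (S.u_bc t (mem_It'_top.2 ht)).2⟩
  have sw : Sm a b (fun x t => Real.log (v x t)) (fun x t => pdx v x t / v x t)
      (fun x t => (pdx (pdx v) x t * v x t - pdx v x t * pdx v x t) / v x t ^ 2)
      (fun x t => pdt v x t / v x t) := by
    refine ⟨?_, ?_, ?_, ?_, ?_, ?_, ?_, ?_, ?_⟩
    · exact ContinuousOn.log cv vne
    · exact ContinuousOn.div cvx cv vne
    · exact ContinuousOn.div ((cvxx.mul cv).sub (cvx.mul cvx)) (cv.pow 2)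
        (fun p hp => pow_ne_zero 2 (vne p hp))
    · exact ContinuousOn.div cvt cv vne
    · exact fun x hx t ht => (dvx x hx t ht).log (vpos x hx t ht).ne'
    · exact fun x hx t ht => (dvxx x hx t ht).div (dvx x hx t ht) (vpos x hx t ht).ne'
    · exact fun x hx t ht => (dvt x hx t ht).log (vpos x hx t ht).ne'
    · intro t ht
      simp [(S.v_bc t (mem_It'_top.2 ht)).1]
    · intro t ht
      simp [(S.v_bc t (mem_It'_top.2 ht)).2]
  refine ⟨hab, hM, su, sw, fun x hx t ht => S.u_pos x hx t (mem_It'_top.2 ht), hB1.jc, hB2.jc,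
    hB1.1, hB2.1, h1, h2, ?_, ?_⟩
  · intro x hx t ht
    have c1 := cu.slice ht
    have c2 := cux.slice ht
    have c3 := cuxx.slice ht
    have c4 := cut.slice ht
    have c5 := sw.c0.slice ht
    have c6 := sw.cx.slice ht
    have c7 := sw.cxx.slice ht
    have c8 := hB1.jc.slice ht
    refine eq_on_Icc hab (f := fun x => pdt u x t) (g := fun x => pdx (pdx u) x t
      - χ * (pdx u x t * (pdx v x t / v x t) + u x t * ((pdx (pdx v) x t * v x t
        - pdx v x t * pdx v x t) / v x t ^ 2)) - u x t * Real.exp (Real.log (v x t)) + B1 x t)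
      c4 (((c3.sub (continuousOn_const.mul ((c2.mul c6).add (c1.mul c7)))).sub
        (c1.mul c5.rexp)).add c8) ?_ x hx
    intro y hy
    have hy' := Set.Ioo_subset_Icc_self hy
    have hvy := vpos y hy' t ht
    have h := S.u_eq y hy t (mem_It'_top.2 ht)
    have hd : pdx (fun y s => u y s / v y s * pdx v y s) y t =
        pdx u y t * (pdx v y t / v y t) + u y t * ((pdx (pdx v) y t * v y t
        - pdx v y t * pdx v y t) / v y t ^ 2) := by
      have k := (((dux y hy' t ht).fun_div (dvx y hy' t ht) hvy.ne').fun_mul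
        (dvxx y hy' t ht)).deriv
      unfold pdx at k ⊢
      rw [k]
      field_simp
      ring
    rw [h, hd, Real.exp_log hvy]
  · intro x hx t ht
    have c1 := cu.slice ht
    have c4 := sw.ct.slice ht
    have c5 := sw.c0.slice ht
    have c6 := sw.cx.slice ht
    have c7 := sw.cxx.slice ht
    have c8 := hB2.jc.slice ht
    refine eq_on_Icc hab (f := fun x => pdt v x t / v x t) (g := fun x =>
      (pdx (pdx v) x t * v x t - pdx v x t * pdx v x t) / v x t ^ 2 + (pdx v x t / v x t) ^ 2
      + u x t - 1 + B2 x t * Real.exp (-Real.log (v x t)))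
      c4 ((((c7.add (c6.pow 2)).add c1).sub continuousOn_const).add (c8.mul c5.neg.rexp)) ?_ x hx
    intro y hy
    have hvy := vpos y (Set.Ioo_subset_Icc_self hy) t ht
    have h := S.v_eq y hy t (mem_It'_top.2 ht)
    rw [h, Real.exp_neg, Real.exp_log hvy]
    field_simp
    ring

lemma HypH1.beta {a b M : ℝ} {B1 : ℝ → ℝ → ℝ} (hab : a < b) (hB1 : HypB a b B1)
    (hM : ∀ x t, B1 x t ≤ M) (h : HypH1 a b B1) :
    ∃ (β : ℝ → ℝ) (l : ℝ), (∀ t : ℝ, 0 < t → HasDerivAt β (∫ x in a..b, B1 x t) t) ∧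
      Tendsto β atTop (𝓝 l) := by
  set bb : ℝ → ℝ := fun t => ∫ x in a..b, B1 x t with hbb
  have hfin : IsFiniteMeasure (volume.restrict (Set.Ioo a b)) := ⟨by simp⟩
  have hc : ContinuousOn bb (Set.Ioi 0) := by
    intro t ht
    have hmain : Tendsto (fun s => ∫ x in Set.Ioo a b, B1 x s) (𝓝[Set.Ioi 0] t)
        (𝓝 (∫ x in Set.Ioo a b, B1 x t)) := by
      refine tendsto_integral_filter_of_dominated_convergence (fun _ => M) ?_
        (Eventually.of_forall fun s => ?_) (integrable_const _) ?_
      · filter_upwards [self_mem_nhdsWithin] with s hs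
        exact ((hB1.jc.slice hs).mono Set.Ioo_subset_Icc_self).aestronglyMeasurable
          measurableSet_Ioo
      · filter_upwards with x
        rw [Real.norm_eq_abs, abs_of_nonneg (hB1.1 x s)]
        exact hM x s
      · filter_upwards [ae_restrict_mem measurableSet_Ioo] with x hx
        exact hB1.jc.tslice (Set.Ioo_subset_Icc_self hx) t ht
    simp only [← ii_eq hab] at hmain
    exact hmain
  have hint : IntegrableOn bb (Set.Ioi 0) := by
    have h1 : Integrable (fun p : ℝ × ℝ => B1 p.1 p.2)
        ((volume.restrict (Set.Ioo a b)).prod (volume.restrict (Set.Ioi (0:ℝ)))) := by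
      rw [Measure.prod_restrict, ← Measure.volume_eq_prod]
      exact h
    have h2 := h1.integral_prod_right
    simp only [← ii_eq hab] at h2
    exact h2
  refine ⟨fun t => ∫ s in (1:ℝ)..t, bb s, ∫ s in Set.Ioi (1:ℝ), bb s, fun t ht => ?_, ?_⟩
  · have hsub : Set.uIcc 1 t ⊆ Set.Ioi (0:ℝ) := by
      intro s hs
      exact lt_of_lt_of_le (lt_min one_pos ht) hs.1
    exact intervalIntegral.integral_hasDerivAt_right (hc.mono hsub).intervalIntegrable
      (hc.stronglyMeasurableAtFilter isOpen_Ioi t ht) (hc.continuousAt (Ioi_mem_nhds ht))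
  · exact intervalIntegral_tendsto_integral_Ioi 1
      (hint.mono_set (Set.Ioi_subset_Ioi zero_le_one)) tendsto_id

/-- Corollary 1.4 (long-time behavior under (H1) and pointwise a.e. stabilization
of `B2`). -/
theorem corollary_long_time_behavior
    (a b χ : ℝ) (hab : a < b) (hχ : 0 < χ)
    (hχ' : χ < Real.sqrt (6 * Real.sqrt 3 + 9) / 2)
    (B1 B2 : ℝ → ℝ → ℝ) (hB1 : HypB a b B1) (hB2 : HypB a b B2)
    (hH1 : HypH1 a b B1)
    (B2inf : ℝ → ℝ)
    (hB2int : MeasureTheory.IntegrableOn B2inf (Set.Ioo a b))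
    (hB2ne : ¬ (∀ᵐ x ∂(MeasureTheory.volume.restrict (Set.Ioo a b)), B2inf x = 0))
    (hconv : ∀ᵐ x ∂(MeasureTheory.volume.restrict (Set.Ioo a b)),
      Filter.Tendsto (fun t : ℝ => B2 x t) Filter.atTop (nhds (B2inf x)))
    (u0 v0 : ℝ → ℝ) (hinit : HypInit a b u0 v0)
    (u v : ℝ → ℝ → ℝ) (hsol : CrimeSol a b χ B1 B2 u0 v0 u v ⊤)
    (vinf : ℝ → ℝ) (hvinf : IsStationarySol a b B2inf vinf) :
    TendstoUniformlyOn (fun (t : ℝ) (x : ℝ) => u x t) (fun _ => 0)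
      Filter.atTop (Set.Ioo a b) ∧
    TendstoUniformlyOn (fun (t : ℝ) (x : ℝ) => v x t) vinf
      Filter.atTop (Set.Ioo a b) := by
  obtain ⟨M1, hM1⟩ := hB1.2.1
  obtain ⟨M2, hM2⟩ := hB2.2.1
  set M := max (max M1 M2) 0 with hMdef
  have hM : 0 ≤ M := le_max_right _ _
  have h1 : ∀ x t, B1 x t ≤ M := fun x t =>
    (hM1 x t).trans ((le_max_left _ _).trans (le_max_left _ _))
  have h2 : ∀ x t, B2 x t ≤ M := fun x t =>
    (hM2 x t).trans ((le_max_right _ _).trans (le_max_left _ _))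
  have S := hsol.toSys hab hM hB1 hB2 h1 h2
  obtain ⟨β, l, hβ, hl⟩ := hH1.beta hab hB1 h1
  obtain ⟨f1, f2, f3, f4⟩ := B2_facts hab hM hB2.jc hB2.1 h2 hB2int hconv
  have hpos := f4 hB2ne
  obtain ⟨T, hT⟩ := eventually_atTop.1 (f3.eventually
    (lt_mem_nhds (half_lt_self hpos)))
  obtain ⟨hu, hu2, T1, H, hT1, hH, hh⟩ := S.final_u hχ hβ hl (T := max 1 T)
    (β0 := (∫ x in a..b, B2inf x) / 2) (le_max_left _ _) (half_pos hpos)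
    (fun t ht => (hT t ((le_max_right _ _).trans ht)).le)
  obtain ⟨_, hd, heq, qa, qb⟩ := hvinf
  constructor
  · rw [Metric.tendstoUniformlyOn_iff]
    intro e he
    filter_upwards [hu e he] with t ht x hx
    rw [Real.dist_eq, zero_sub, abs_neg]
    exact ht x (Set.Ioo_subset_Icc_self hx)
  · rw [Metric.tendstoUniformlyOn_iff]
    intro e he
    have hv := S.final_v hβ hl (q := vinf) (qx := deriv vinf) (qxx := deriv (deriv vinf))
      (Bi := B2inf) (fun x hx => (hd x hx).1.hasDerivAt) (fun x hx => (hd x hx).2.hasDerivAt)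
      qa qb (fun x hx => by linarith [heq x hx]) hB2int hT1 hH hh hu2 f1 f2 he
    filter_upwards [hv, eventually_gt_atTop 0] with t ht ht0 x hx
    have hx' := Set.Ioo_subset_Icc_self hx
    have := ht x hx'
    rw [Real.exp_log (hsol.v_pos x hx' t (mem_It'_top.2 ht0))] at this
    rw [dist_comm, Real.dist_eq]
    exact this
end
end

section
/- Let χ > 0, assume (B) and (init), and let (u, v) be the maximal classical solution of the crime model on Ω̄ × [0, T_max). For every T > 0 there exists C(T) > 0 such that, with T̂_max := min{T, T_max}, v(x,t) ≥ C(T) for all x ∈ Ω and all t ∈ (0, T̂_max); moreover, if hypothesis (H2) holds, then inf_{T>0} C(T) > 0. -/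
open Real MeasureTheory Filter Topology Set
open scoped ENNReal NNReal

noncomputable section

/-- Unnormalised one-dimensional heat kernel. -/
def heatK (z τ : ℝ) : ℝ := (√τ)⁻¹ * Real.exp (-(z ^ 2) / (4 * τ))

/-- The common value of the time derivative and the second space derivative of `heatK`. -/
def heatK2 (z τ : ℝ) : ℝ := heatK z τ * (z ^ 2 / (4 * τ ^ 2) - 1 / (2 * τ))

/-- The space derivative of `heatK`. -/
def heatK1 (z τ : ℝ) : ℝ := -(z / (2 * τ)) * heatK z τ

lemma heatK_nonneg (z τ : ℝ) : 0 ≤ heatK z τ := by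
  unfold heatK; positivity

lemma heatK_pos (z : ℝ) {τ : ℝ} (h : 0 < τ) : 0 < heatK z τ := by
  unfold heatK; positivity

lemma heatK_hasDerivAt_z (z : ℝ) {τ : ℝ} (h : 0 < τ) :
    HasDerivAt (fun z => heatK z τ) (heatK1 z τ) z := by
  have h1 : HasDerivAt (fun z : ℝ => -(z ^ 2) / (4 * τ)) (-(2 * z) / (4 * τ)) z := by
    have := ((hasDerivAt_pow 2 z).neg).div_const (4 * τ)
    simpa using this
  have h2 := (h1.exp).const_mul ((√τ)⁻¹)
  refine h2.congr_deriv ?_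
  unfold heatK1 heatK
  field_simp
  ring

lemma heatK1_hasDerivAt_z (z : ℝ) {τ : ℝ} (h : 0 < τ) :
    HasDerivAt (fun z => heatK1 z τ) (heatK2 z τ) z := by
  have h1 : HasDerivAt (fun z : ℝ => -(z / (2 * τ))) (-(1 / (2 * τ))) z :=
    ((hasDerivAt_id z).div_const (2 * τ)).neg
  have h2 := h1.mul (heatK_hasDerivAt_z z h)
  refine h2.congr_deriv ?_
  unfold heatK2 heatK1
  field_simp
  ring

lemma heatK_hasDerivAt_τ (z : ℝ) {τ : ℝ} (h : 0 < τ) :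
    HasDerivAt (fun τ => heatK z τ) (heatK2 z τ) τ := by
  have h0 : HasDerivAt (fun τ : ℝ => 4 * τ) 4 τ := by
    simpa using (hasDerivAt_id τ).const_mul 4
  have h1 : HasDerivAt (fun τ : ℝ => -(z ^ 2) / (4 * τ)) (z ^ 2 / (4 * τ ^ 2)) τ := by
    refine ((hasDerivAt_const τ (-(z ^ 2))).div h0 (by positivity)).congr_deriv ?_
    field_simp
    ring
  have h3 : HasDerivAt (fun τ : ℝ => (√τ)⁻¹) (-((√τ)⁻¹ * (1 / (2 * τ)))) τ := by
    refine ((Real.hasDerivAt_sqrt h.ne').inv (Real.sqrt_pos.2 h).ne').congr_deriv ?_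
    have hs : √τ ≠ 0 := (Real.sqrt_pos.2 h).ne'
    have hq : √τ ^ 2 = τ := Real.sq_sqrt h.le
    rw [hq]
    field_simp
  refine (h3.mul h1.exp).congr_deriv ?_
  unfold heatK2 heatK
  ring

lemma heatK_contOn {X : Type*} [TopologicalSpace X] {S : Set X} {f g : X → ℝ}
    (hf : ContinuousOn f S) (hg : ContinuousOn g S) (hp : ∀ x ∈ S, 0 < g x) :
    ContinuousOn (fun x => heatK (f x) (g x)) S := by
  unfold heatK
  refine ContinuousOn.mul (ContinuousOn.inv₀ hg.sqrt ?_) ?_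
  · intro x hx; exact (Real.sqrt_pos.2 (hp x hx)).ne'
  · refine Real.continuous_exp.comp_continuousOn ?_
    refine ((hf.pow 2).neg).div (continuousOn_const.mul hg) ?_
    intro x hx; have := hp x hx; positivity

lemma heatK2_contOn {X : Type*} [TopologicalSpace X] {S : Set X} {f g : X → ℝ}
    (hf : ContinuousOn f S) (hg : ContinuousOn g S) (hp : ∀ x ∈ S, 0 < g x) :
    ContinuousOn (fun x => heatK2 (f x) (g x)) S := by
  unfold heatK2
  refine (heatK_contOn hf hg hp).mul (ContinuousOn.sub ?_ ?_)
  · refine (hf.pow 2).div (continuousOn_const.mul (hg.pow 2)) ?_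
    intro x hx; have := hp x hx; positivity
  · refine continuousOn_const.div (continuousOn_const.mul hg) ?_
    intro x hx; have := hp x hx; positivity

/-- Leibniz rule on a compact interval for `C¹` integrands. -/
lemma leibniz_aux {a b α β : ℝ} (hab : a < b) (f f' : ℝ → ℝ → ℝ)
    (hf : ContinuousOn (fun p : ℝ × ℝ => f p.1 p.2) (Icc a b ×ˢ Ioo α β))
    (hf' : ContinuousOn (fun p : ℝ × ℝ => f' p.1 p.2) (Icc a b ×ˢ Ioo α β))
    (hd : ∀ y ∈ Icc a b, ∀ s ∈ Ioo α β, HasDerivAt (fun s => f y s) (f' y s) s)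
    {s : ℝ} (hs : s ∈ Ioo α β) :
    HasDerivAt (fun s => ∫ y in a..b, f y s) (∫ y in a..b, f' y s) s := by
  obtain ⟨hs1, hs2⟩ := hs
  have hslice : ∀ g : ℝ → ℝ → ℝ,
      ContinuousOn (fun p : ℝ × ℝ => g p.1 p.2) (Icc a b ×ˢ Ioo α β) →
      ∀ r ∈ Ioo α β, ContinuousOn (fun y => g y r) (Icc a b) := by
    intro g hg r hr
    exact hg.comp (f := fun y => (y, r)) (by fun_prop) (fun y hy => ⟨hy, hr⟩)
  set l := (α + s) / 2
  set r := (s + β) / 2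
  have hl : α < l ∧ l < s := by constructor <;> simp only [l] <;> linarith
  have hr : s < r ∧ r < β := by constructor <;> simp only [r] <;> linarith
  have hsub : Icc l r ⊆ Ioo α β := fun x hx => ⟨hl.1.trans_le hx.1, hx.2.trans_lt hr.2⟩
  obtain ⟨M, hM⟩ := ((isCompact_Icc (a := a) (b := b)).prod
    (isCompact_Icc (a := l) (b := r))).exists_bound_of_continuousOn
    (hf'.mono (prod_mono subset_rfl hsub))
  have hII : ∀ g : ℝ → ℝ, ContinuousOn g (Icc a b) → IntervalIntegrable g volume a b := by
    intro g hg
    apply ContinuousOn.intervalIntegrable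
    rwa [uIcc_of_le hab.le]
  have hmem : ∀ y ∈ uIoc a b, y ∈ Icc a b := by
    intro y hy
    rw [uIoc_of_le hab.le] at hy
    exact Ioc_subset_Icc_self hy
  have hs0 : s ∈ Ioo α β := ⟨hs1, hs2⟩
  refine (intervalIntegral.hasDerivAt_integral_of_dominated_loc_of_deriv_le
    (F := fun s y => f y s) (F' := fun s y => f' y s) (bound := fun _ => M)
    (s := Icc l r) (Icc_mem_nhds hl.2 hr.1) ?_ ?_ ?_ ?_ ?_ ?_).2
  · filter_upwards [Ioo_mem_nhds hs1 hs2] with r hr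
    have := (hII _ (hslice f hf r hr)).def'
    exact this.aestronglyMeasurable
  · exact hII _ (hslice f hf s hs0)
  · exact ((hII _ (hslice f' hf' s hs0)).def').aestronglyMeasurable
  · refine Eventually.of_forall fun y hy x hx => ?_
    exact hM (y, x) ⟨hmem y hy, hx⟩
  · exact intervalIntegrable_const
  · exact Eventually.of_forall fun y hy x hx => hd y (hmem y hy) x (hsub hx)

lemma gauss_int (x0 : ℝ) {c : ℝ} (hc : 0 < c) :
    Integrable (fun y : ℝ => Real.exp (-c * (y - x0) ^ 2)) ∧
      ∫ y : ℝ, Real.exp (-c * (y - x0) ^ 2) = √(π / c) := by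
  constructor
  · exact (integrable_exp_neg_mul_sq hc).comp_sub_right x0
  · rw [integral_sub_right_eq_self (fun y : ℝ => Real.exp (-c * y ^ 2)) x0]
    exact integral_gaussian c

lemma gauss_int_ab {a b : ℝ} (hab : a < b) (x0 : ℝ) {c : ℝ} (hc : 0 < c) :
    ∫ y in a..b, Real.exp (-c * (y - x0) ^ 2) ≤ √(π / c) := by
  obtain ⟨h1, h2⟩ := gauss_int x0 hc
  rw [intervalIntegral.integral_of_le hab.le, ← h2]
  exact setIntegral_le_integral h1 (Eventually.of_forall fun y => (Real.exp_pos _).le)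

lemma heatK_int {a b : ℝ} (hab : a < b) (x0 : ℝ) {τ : ℝ} (hτ : 0 < τ) :
    ∫ y in a..b, heatK (y - x0) τ ≤ √(4 * π) := by
  have h := gauss_int_ab hab x0 (c := 1 / (4 * τ)) (by positivity)
  have e : ∀ y : ℝ, heatK (y - x0) τ
      = (√τ)⁻¹ * Real.exp (-(1 / (4 * τ)) * (y - x0) ^ 2) := by
    intro y; unfold heatK; congr 2; ring
  simp_rw [e]
  rw [intervalIntegral.integral_const_mul]
  have e2 : √(π / (1 / (4 * τ))) = √τ * √(4 * π) := by
    rw [← Real.sqrt_mul hτ.le]; congr 1; field_simp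
  rw [e2] at h
  have hs := Real.sqrt_pos.2 hτ
  calc _ ≤ (√τ)⁻¹ * (√τ * √(4 * π)) := by gcongr
    _ = _ := by field_simp

lemma heatK_sq_le (z : ℝ) {τ : ℝ} (hτ : 0 < τ) :
    z ^ 2 * heatK z τ ≤ 8 * τ * ((√τ)⁻¹ * Real.exp (-(1 / (8 * τ)) * z ^ 2)) := by
  unfold heatK
  set X := z ^ 2 / (8 * τ) with hX
  have h1 : X ≤ Real.exp X := by linarith [Real.add_one_le_exp X]
  have h2 : z ^ 2 = 8 * τ * X := by rw [hX]; field_simp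
  have h3 : -(z ^ 2) / (4 * τ) = -X + -X := by rw [hX]; field_simp; ring
  have h4 : -(1 / (8 * τ)) * z ^ 2 = -X := by rw [hX]; field_simp
  rw [h3, h4, h2, Real.exp_add]
  have h5 : X * Real.exp (-X) ≤ 1 := by
    rw [Real.exp_neg]
    rw [← div_eq_mul_inv, div_le_one (Real.exp_pos _)]; exact h1
  have hs : 0 ≤ (√τ)⁻¹ := by positivity
  have he := (Real.exp_pos (-X)).le
  calc 8 * τ * X * ((√τ)⁻¹ * (Real.exp (-X) * Real.exp (-X)))
      = 8 * τ * ((√τ)⁻¹ * Real.exp (-X)) * (X * Real.exp (-X)) := by ring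
    _ ≤ 8 * τ * ((√τ)⁻¹ * Real.exp (-X)) * 1 := by gcongr
    _ = _ := by ring

lemma heatK_cont (x0 : ℝ) {τ : ℝ} (hτ : 0 < τ) : Continuous fun y => heatK (y - x0) τ := by
  unfold heatK; fun_prop

lemma heatK_sq_int {a b : ℝ} (hab : a < b) (x0 : ℝ) {τ : ℝ} (hτ : 0 < τ) :
    ∫ y in a..b, (y - x0) ^ 2 * heatK (y - x0) τ ≤ 8 * τ * √(8 * π) := by
  have h := gauss_int_ab hab x0 (c := 1 / (8 * τ)) (by positivity)
  have e2 : √(π / (1 / (8 * τ))) = √τ * √(8 * π) := by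
    rw [← Real.sqrt_mul hτ.le]; congr 1; field_simp
  rw [e2] at h
  have hs := Real.sqrt_pos.2 hτ
  have hc := heatK_cont x0 hτ
  calc _ ≤ ∫ y in a..b, 8 * τ * ((√τ)⁻¹ * Real.exp (-(1 / (8 * τ)) * (y - x0) ^ 2)) := by
        apply intervalIntegral.integral_mono_on hab.le
        · apply Continuous.intervalIntegrable; fun_prop
        · apply Continuous.intervalIntegrable; fun_prop
        · intro y _; exact heatK_sq_le _ hτ
    _ = 8 * τ * ((√τ)⁻¹ * ∫ y in a..b, Real.exp (-(1 / (8 * τ)) * (y - x0) ^ 2)) := by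
        rw [intervalIntegral.integral_const_mul, intervalIntegral.integral_const_mul]
    _ ≤ 8 * τ * ((√τ)⁻¹ * (√τ * √(8 * π))) := by gcongr
    _ = _ := by field_simp

/-- The dual functional. -/
def dualF (a b : ℝ) (v : ℝ → ℝ → ℝ) (x0 t s : ℝ) : ℝ :=
  ∫ y in a..b, Real.exp s * (heatK (y - x0) (t - s) * v y s)

lemma It'_down {Tmax : ℝ≥0∞} {t s : ℝ} (ht : t ∈ It' Tmax) (h0 : 0 < s) (hs : s ≤ t) :
    s ∈ It' Tmax := ⟨h0, (ENNReal.ofReal_le_ofReal hs).trans_lt ht.2⟩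

lemma It'_sub (Tmax : ℝ≥0∞) : It' Tmax ⊆ It Tmax := fun _ h => ⟨h.1.le, h.2⟩

lemma dualF_deriv {a b χ : ℝ} (hab : a < b) {B1 B2 : ℝ → ℝ → ℝ} {u0 v0 : ℝ → ℝ}
    {Tmax : ℝ≥0∞} {u v : ℝ → ℝ → ℝ} (hsol : CrimeSol a b χ B1 B2 u0 v0 u v Tmax)
    (hB0 : ∀ x t : ℝ, 0 ≤ B2 x t)
    {x0 t : ℝ} (hx0 : x0 ∈ Ioo a b) (ht : t ∈ It' Tmax) {s : ℝ} (hs : s ∈ Ioo 0 t)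
    {κ : ℝ} (hκ : ∀ y ∈ Icc a b, κ ≤ heatK (y - x0) (t - s)) :
    DifferentiableAt ℝ (dualF a b v x0 t) s ∧
      Real.exp s * (κ * ∫ x in Ioo a b, B2 x s) ≤ deriv (dualF a b v x0 t) s := by
  have hsub : Ioo 0 t ⊆ It' Tmax := fun r hr => It'_down ht hr.1 hr.2.le
  have hsub2 : Icc a b ×ˢ Ioo 0 t ⊆ Icc a b ×ˢ It' Tmax := prod_mono subset_rfl hsub
  have hsub3 : Icc a b ×ˢ Ioo 0 t ⊆ Icc a b ×ˢ It Tmax :=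
    prod_mono subset_rfl (hsub.trans (It'_sub _))
  have hv := hsol.v_cont.mono hsub3
  have hu := hsol.u_cont.mono hsub3
  have hvx : ContinuousOn (fun p : ℝ × ℝ => pdx v p.1 p.2) (Icc a b ×ˢ Ioo 0 t) :=
    (hsol.v_cont21.mono hsub2).fst
  have hvxx : ContinuousOn (fun p : ℝ × ℝ => pdx (pdx v) p.1 p.2) (Icc a b ×ˢ Ioo 0 t) :=
    (hsol.v_cont21.mono hsub2).snd.fst
  have hvt : ContinuousOn (fun p : ℝ × ℝ => pdt v p.1 p.2) (Icc a b ×ˢ Ioo 0 t) :=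
    (hsol.v_cont21.mono hsub2).snd.snd
  have hslice : ∀ g : ℝ → ℝ → ℝ,
      ContinuousOn (fun p : ℝ × ℝ => g p.1 p.2) (Icc a b ×ˢ Ioo 0 t) →
      ContinuousOn (fun y => g y s) (Icc a b) := by
    intro g hg
    exact hg.comp (f := fun y => (y, s)) (by fun_prop) (fun y hy => ⟨hy, hs⟩)
  have hp : ∀ p ∈ Icc a b ×ˢ Ioo 0 t, 0 < t - p.2 := fun p hp => sub_pos.2 hp.2.2
  have hK : ContinuousOn (fun p : ℝ × ℝ => heatK (p.1 - x0) (t - p.2)) (Icc a b ×ˢ Ioo 0 t) :=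
    heatK_contOn (by fun_prop) (by fun_prop) hp
  have hK2 : ContinuousOn (fun p : ℝ × ℝ => heatK2 (p.1 - x0) (t - p.2))
      (Icc a b ×ˢ Ioo 0 t) :=
    heatK2_contOn (by fun_prop) (by fun_prop) hp
  have hexp : ContinuousOn (fun p : ℝ × ℝ => Real.exp p.2) (Icc a b ×ˢ Ioo 0 t) := by fun_prop
  have hτ : 0 < t - s := sub_pos.2 hs.2
  have hsT := hsub hs
  have hD : HasDerivAt (dualF a b v x0 t)
      (∫ y in a..b, Real.exp s * (heatK (y - x0) (t - s) * v y s)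
        + Real.exp s * (-heatK2 (y - x0) (t - s) * v y s
          + heatK (y - x0) (t - s) * pdt v y s)) s := by
    refine leibniz_aux hab (α := 0) (β := t)
      (fun y s => Real.exp s * (heatK (y - x0) (t - s) * v y s))
      (fun y s => Real.exp s * (heatK (y - x0) (t - s) * v y s)
        + Real.exp s * (-heatK2 (y - x0) (t - s) * v y s
          + heatK (y - x0) (t - s) * pdt v y s)) ?_ ?_ ?_ hs
    · exact hexp.mul (hK.mul hv)
    · exact (hexp.mul (hK.mul hv)).add (hexp.mul ((hK2.neg.mul hv).add (hK.mul hvt)))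
    · intro y hy r hr
      have h1 : HasDerivAt (fun s => heatK (y - x0) (t - s)) (-heatK2 (y - x0) (t - r)) r := by
        have h2 := heatK_hasDerivAt_τ (y - x0) (sub_pos.2 hr.2)
        have h3 : HasDerivAt (fun s : ℝ => t - s) (-1) r := by
          simpa using (hasDerivAt_id r).const_sub t
        refine (h2.comp r h3).congr_deriv ?_
        ring
      have h4 : HasDerivAt (fun s => v y s) (pdt v y r) r :=
        (hsol.v_reg y hy r (hsub hr)).2.2.hasDerivAt
      exact (Real.hasDerivAt_exp r).mul (h1.mul h4)
  refine ⟨hD.differentiableAt, ?_⟩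
  rw [hD.deriv]
  have hII : ∀ g : ℝ → ℝ, ContinuousOn g (Icc a b) → IntervalIntegrable g volume a b := by
    intro g hg
    apply ContinuousOn.intervalIntegrable
    rwa [uIcc_of_le hab.le]
  have cK := hslice (fun y s => heatK (y - x0) (t - s)) hK
  have cK2 := hslice (fun y s => heatK2 (y - x0) (t - s)) hK2
  have cv := hslice v hv
  have cu := hslice u hu
  have cvxx := hslice (pdx (pdx v)) hvxx
  have cvt := hslice (pdt v) hvt
  -- integration by parts
  have hibp : 0 ≤ ∫ y in a..b, (pdx (pdx v) y s * heatK (y - x0) (t - s)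
      - v y s * heatK2 (y - x0) (t - s)) := by
    have hd : ∀ y ∈ uIcc a b, HasDerivAt
        (fun y => pdx v y s * heatK (y - x0) (t - s) - v y s * heatK1 (y - x0) (t - s))
        (pdx (pdx v) y s * heatK (y - x0) (t - s) - v y s * heatK2 (y - x0) (t - s)) y := by
      intro y hy
      rw [uIcc_of_le hab.le] at hy
      have r := hsol.v_reg y hy s hsT
      have d1 : HasDerivAt (fun y => v y s) (pdx v y s) y := r.1.hasDerivAt
      have d2 : HasDerivAt (fun y => pdx v y s) (pdx (pdx v) y s) y := r.2.1.hasDerivAt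
      have k1 : HasDerivAt (fun y => heatK (y - x0) (t - s)) (heatK1 (y - x0) (t - s)) y :=
        (heatK_hasDerivAt_z (y - x0) hτ).comp_sub_const y x0
      have k2 : HasDerivAt (fun y => heatK1 (y - x0) (t - s)) (heatK2 (y - x0) (t - s)) y :=
        (heatK1_hasDerivAt_z (y - x0) hτ).comp_sub_const y x0
      refine ((d2.mul k1).sub (d1.mul k2)).congr_deriv ?_
      ring
    rw [intervalIntegral.integral_eq_sub_of_hasDerivAt hd
      (hII _ ((cvxx.mul cK).sub (cv.mul cK2)))]
    obtain ⟨ba, bb⟩ := hsol.v_bc s hsT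
    rw [ba, bb]
    have pa := (hsol.v_pos a ⟨le_rfl, hab.le⟩ s hsT).le
    have pb := (hsol.v_pos b ⟨hab.le, le_rfl⟩ s hsT).le
    have ka : 0 ≤ heatK1 (a - x0) (t - s) := by
      unfold heatK1
      have h1 := heatK_nonneg (a - x0) (t - s)
      have h2 : 0 ≤ -((a - x0) / (2 * (t - s))) := by
        rw [← neg_div]; apply div_nonneg <;> linarith [hx0.1]
      exact mul_nonneg h2 h1
    have kb : heatK1 (b - x0) (t - s) ≤ 0 := by
      unfold heatK1
      have h1 := heatK_nonneg (b - x0) (t - s)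
      have h2 : 0 ≤ ((b - x0) / (2 * (t - s))) := by
        apply div_nonneg <;> linarith [hx0.2]
      have := mul_nonneg h2 h1
      linarith
    have q1 := mul_nonneg pa ka
    have q2 := mul_nonneg pb (neg_nonneg.2 kb)
    linarith
  -- the source
  have hR : ∀ y ∈ Ioo a b, B2 y s = pdt v y s - pdx (pdx v) y s - u y s * v y s + v y s := by
    intro y hy
    have := hsol.v_eq y hy s hsT
    linarith
  have cR : ContinuousOn (fun y => pdt v y s - pdx (pdx v) y s - u y s * v y s + v y s)
      (Icc a b) := ((cvt.sub cvxx).sub (cu.mul cv)).add cv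
  have hBint : ∫ x in Ioo a b, B2 x s
      = ∫ y in a..b, (pdt v y s - pdx (pdx v) y s - u y s * v y s + v y s) := by
    rw [intervalIntegral.integral_of_le hab.le, integral_Ioc_eq_integral_Ioo]
    exact setIntegral_congr_fun measurableSet_Ioo hR
  have hsplit : ∫ y in a..b, (Real.exp s * (heatK (y - x0) (t - s) * v y s)
        + Real.exp s * (-heatK2 (y - x0) (t - s) * v y s
          + heatK (y - x0) (t - s) * pdt v y s))
      = Real.exp s * ((∫ y in a..b, (heatK (y - x0) (t - s)
          * (pdt v y s - pdx (pdx v) y s + v y s)))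
        + ∫ y in a..b, (pdx (pdx v) y s * heatK (y - x0) (t - s)
      - v y s * heatK2 (y - x0) (t - s))) := by
    rw [← intervalIntegral.integral_add, ← intervalIntegral.integral_const_mul]
    · congr 1; ext y; ring
    · exact hII _ (cK.mul ((cvt.sub cvxx).add cv))
    · exact hII _ ((cvxx.mul cK).sub (cv.mul cK2))
  rw [hsplit, hBint, ← intervalIntegral.integral_const_mul]
  have hmain : ∫ y in a..b, κ * (pdt v y s - pdx (pdx v) y s - u y s * v y s + v y s)
      ≤ ∫ y in a..b, (heatK (y - x0) (t - s)
          * (pdt v y s - pdx (pdx v) y s + v y s)) := by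
    apply intervalIntegral.integral_mono_on_of_le_Ioo hab.le
    · exact hII _ (continuousOn_const.mul cR)
    · exact hII _ (cK.mul ((cvt.sub cvxx).add cv))
    · intro y hy
      have hy' := Ioo_subset_Icc_self hy
      have b0 := hB0 y s
      have k := hκ y hy'
      have k0 := heatK_nonneg (y - x0) (t - s)
      have uv := mul_nonneg (hsol.u_pos y hy' s hsT).le (hsol.v_pos y hy' s hsT).le
      have e := hR y hy
      rw [← e]
      have e2 : pdt v y s - pdx (pdx v) y s + v y s = B2 y s + u y s * v y s := by linarith
      rw [e2]
      nlinarith [mul_nonneg (sub_nonneg.2 k) b0, mul_nonneg k0 uv]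
  have := Real.exp_pos s
  gcongr
  linarith

/-- Lower bounds on the dual functional transfer to the point value. -/
lemma dualF_limit {a b χ : ℝ} (hab : a < b) {B1 B2 : ℝ → ℝ → ℝ} {u0 v0 : ℝ → ℝ}
    {Tmax : ℝ≥0∞} {u v : ℝ → ℝ → ℝ} (hsol : CrimeSol a b χ B1 B2 u0 v0 u v Tmax)
    {x0 t : ℝ} (hx0 : x0 ∈ Ioo a b) (ht : t ∈ It' Tmax) {s1 A : ℝ} (hs1 : s1 < t)
    (hA : 0 ≤ A) (h : ∀ s ∈ Ico s1 t, A ≤ dualF a b v x0 t s) :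
    A ≤ Real.exp t * (√(4 * π) * v x0 t) := by
  have ht0 : 0 < t := ht.1
  have hsub : Icc (t / 2) t ⊆ It' Tmax := fun r hr => It'_down ht (by linarith [hr.1]) hr.2
  obtain ⟨M, hM⟩ := ((isCompact_Icc (a := a) (b := b)).prod
    (isCompact_Icc (a := t / 2) (b := t))).exists_bound_of_continuousOn
    (hsol.v_cont.mono (prod_mono subset_rfl (hsub.trans (It'_sub _))))
  have hM0 : 0 ≤ M := (norm_nonneg _).trans
    (hM (x0, t) ⟨Ioo_subset_Icc_self hx0, by constructor <;> linarith⟩)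
  have key : ∀ ε > 0, A ≤ Real.exp t * (√(4 * π) * (v x0 t + ε)) := by
    intro ε hε
    have hc := hsol.v_cont (x0, t) ⟨Ioo_subset_Icc_self hx0, It'_sub _ ht⟩
    rw [Metric.continuousWithinAt_iff] at hc
    obtain ⟨r, hr, hc⟩ := hc ε hε
    have hbd : ∀ s, max s1 (max (t / 2) (t - r)) < s → s < t →
        A ≤ Real.exp t * ((v x0 t + ε) * √(4 * π) + M / r ^ 2 * (8 * (t - s) * √(8 * π))) := by
      intro s hs hst
      have m1 : s1 < s := (le_max_left _ _).trans_lt hs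
      have m2 : t / 2 < s := ((le_max_left _ _).trans (le_max_right _ _)).trans_lt hs
      have m3 : t - r < s := ((le_max_right _ _).trans (le_max_right _ _)).trans_lt hs
      have hsI : s ∈ Icc (t / 2) t := ⟨m2.le, hst.le⟩
      have hτ : 0 < t - s := sub_pos.2 hst
      have hvx : 0 < v x0 t := hsol.v_pos x0 (Ioo_subset_Icc_self hx0) t ht
      have hpt : ∀ y ∈ Icc a b, v y s ≤ (v x0 t + ε) + M / r ^ 2 * (y - x0) ^ 2 := by
        intro y hy
        by_cases hyr : |y - x0| < r
        · have := @hc (y, s) ⟨hy, It'_sub _ (hsub hsI)⟩ (by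
            rw [Prod.dist_eq]
            apply max_lt
            · simpa [Real.dist_eq] using hyr
            · simp only [Real.dist_eq]
              rw [abs_lt]; constructor <;> linarith)
          rw [Real.dist_eq, abs_lt] at this
          have h3 : 0 ≤ M / r ^ 2 * (y - x0) ^ 2 := by positivity
          have := this.2
          simp only at this
          linarith
        · push Not at hyr
          have h1 := (le_abs_self _).trans (hM (y, s) ⟨hy, hsI⟩)
          have h2 : r ^ 2 ≤ (y - x0) ^ 2 := by
            rw [← sq_abs (y - x0)]; gcongr
          have h3 : M ≤ M / r ^ 2 * (y - x0) ^ 2 := by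
            calc M = M / r ^ 2 * r ^ 2 := by field_simp
              _ ≤ _ := by gcongr
          simp only at h1
          linarith
      have hck := heatK_cont x0 hτ
      have cv : ContinuousOn (fun y => v y s) (Icc a b) :=
        hsol.v_cont.comp (f := fun y => (y, s)) (by fun_prop)
          (fun y hy => ⟨hy, It'_sub _ (hsub hsI)⟩)
      have hint : ∫ y in a..b, heatK (y - x0) (t - s) * v y s
          ≤ (v x0 t + ε) * √(4 * π) + M / r ^ 2 * (8 * (t - s) * √(8 * π)) := by
        calc _ ≤ ∫ y in a..b, ((v x0 t + ε) * heatK (y - x0) (t - s)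
              + M / r ^ 2 * ((y - x0) ^ 2 * heatK (y - x0) (t - s))) := by
              apply intervalIntegral.integral_mono_on hab.le
              · apply ContinuousOn.intervalIntegrable
                rw [uIcc_of_le hab.le]
                exact hck.continuousOn.mul cv
              · apply Continuous.intervalIntegrable; fun_prop
              · intro y hy
                nlinarith [mul_le_mul_of_nonneg_left (hpt y hy) (heatK_nonneg (y - x0) (t - s))]
          _ = (v x0 t + ε) * (∫ y in a..b, heatK (y - x0) (t - s))
              + M / r ^ 2 * ∫ y in a..b, ((y - x0) ^ 2 * heatK (y - x0) (t - s)) := by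
              rw [intervalIntegral.integral_add, intervalIntegral.integral_const_mul,
                intervalIntegral.integral_const_mul]
              · apply Continuous.intervalIntegrable; fun_prop
              · apply Continuous.intervalIntegrable; fun_prop
          _ ≤ _ := by
              have := heatK_int hab x0 hτ
              have := heatK_sq_int hab x0 hτ
              gcongr
      have hF := h s ⟨m1.le, hst⟩
      unfold dualF at hF
      rw [intervalIntegral.integral_const_mul] at hF
      refine hF.trans ?_
      have : 0 ≤ (v x0 t + ε) * √(4 * π) + M / r ^ 2 * (8 * (t - s) * √(8 * π)) := by positivity
      exact mul_le_mul (Real.exp_le_exp.2 hst.le) hint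
        (by
          apply intervalIntegral.integral_nonneg hab.le
          intro y hy
          exact mul_nonneg (heatK_nonneg _ _) (hsol.v_pos y hy s (hsub hsI)).le)
        (Real.exp_pos t).le
    have hlim : Tendsto (fun s : ℝ => Real.exp t * ((v x0 t + ε) * √(4 * π)
        + M / r ^ 2 * (8 * (t - s) * √(8 * π)))) (𝓝[<] t)
        (𝓝 (Real.exp t * ((v x0 t + ε) * √(4 * π) + M / r ^ 2 * (8 * (t - t) * √(8 * π))))) := by
      apply Tendsto.mono_left _ nhdsWithin_le_nhds
      apply Continuous.tendsto
      fun_prop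
    have hmx : max s1 (max (t / 2) (t - r)) < t :=
      max_lt hs1 (max_lt (by linarith) (by linarith))
    have := ge_of_tendsto hlim (b := A) (by
      filter_upwards [Ioo_mem_nhdsLT hmx] with s hs
      exact hbd s hs.1 hs.2)
    refine this.trans (le_of_eq ?_)
    ring
  have hlim : Tendsto (fun ε : ℝ => Real.exp t * (√(4 * π) * (v x0 t + ε))) (𝓝[>] 0)
      (𝓝 (Real.exp t * (√(4 * π) * (v x0 t + 0)))) := by
    apply Tendsto.mono_left _ nhdsWithin_le_nhds
    apply Continuous.tendsto
    fun_prop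
  have := ge_of_tendsto hlim (b := A) (by
    filter_upwards [self_mem_nhdsWithin] with ε hε
    exact key ε hε)
  simpa using this

lemma heatK_lower {a b x0 y τ τ0 τ1 : ℝ} (hx0 : x0 ∈ Ioo a b) (hy : y ∈ Icc a b)
    (h0 : 0 < τ0) (h1 : τ0 ≤ τ) (h2 : τ ≤ τ1) :
    (√τ1)⁻¹ * Real.exp (-((b - a) ^ 2) / (4 * τ0)) ≤ heatK (y - x0) τ := by
  unfold heatK
  have hτ : 0 < τ := h0.trans_le h1
  have hs := Real.sqrt_pos.2 hτ
  have : (y - x0) ^ 2 ≤ (b - a) ^ 2 := by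
    apply sq_le_sq'
    · linarith [hx0.1, hx0.2, hy.1, hy.2]
    · linarith [hx0.1, hx0.2, hy.1, hy.2]
  rw [neg_div, neg_div]
  gcongr

lemma dualF_mono {a b χ : ℝ} (hab : a < b) {B1 B2 : ℝ → ℝ → ℝ} {u0 v0 : ℝ → ℝ}
    {Tmax : ℝ≥0∞} {u v : ℝ → ℝ → ℝ} (hsol : CrimeSol a b χ B1 B2 u0 v0 u v Tmax)
    (hB0 : ∀ x t : ℝ, 0 ≤ B2 x t)
    {x0 t : ℝ} (hx0 : x0 ∈ Ioo a b) (ht : t ∈ It' Tmax) :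
    MonotoneOn (dualF a b v x0 t) (Ioo 0 t) := by
  have hd := fun s (hs : s ∈ Ioo 0 t) => dualF_deriv hab hsol hB0 hx0 ht hs (κ := 0)
    (fun y _ => heatK_nonneg _ _)
  refine monotoneOn_of_deriv_nonneg (convex_Ioo 0 t)
    (fun s hs => (hd s hs).1.continuousAt.continuousWithinAt) ?_ ?_
  · rw [interior_Ioo]
    exact fun s hs => (hd s hs).1.differentiableWithinAt
  · rw [interior_Ioo]
    intro s hs
    simpa using (hd s hs).2

lemma part_one {a b χ : ℝ} (hab : a < b) {B1 B2 : ℝ → ℝ → ℝ} {u0 v0 : ℝ → ℝ}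
    {Tmax : ℝ≥0∞} (hT : 0 < Tmax) {u v : ℝ → ℝ → ℝ} (hinit : HypInit a b u0 v0)
    (hsol : CrimeSol a b χ B1 B2 u0 v0 u v Tmax)
    (hB0 : ∀ x t : ℝ, 0 ≤ B2 x t) (T : ℝ) (hT0 : 0 < T) :
    ∃ C : ℝ, 0 < C ∧ ∀ x ∈ Ioo a b, ∀ t ∈ It' Tmax, t < T → C ≤ v x t := by
  obtain ⟨t2, ht2⟩ : ∃ t2, t2 ∈ It' Tmax := by
    obtain ⟨q, hq0, hq⟩ := ENNReal.lt_iff_exists_real_btwn.1 hT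
    refine ⟨q, ?_, hq.2⟩
    simpa using hq.1
  have ht20 : 0 < t2 := ht2.1
  have hsub : Icc 0 t2 ⊆ It Tmax :=
    fun r hr => ⟨hr.1, (ENNReal.ofReal_le_ofReal hr.2).trans_lt ht2.2⟩
  obtain ⟨p, hp, hmin⟩ := ((isCompact_Icc (a := a) (b := b)).prod
    (isCompact_Icc (a := 0) (b := t2))).exists_isMinOn
    ⟨(a, 0), ⟨le_rfl, hab.le⟩, ⟨le_rfl, ht20.le⟩⟩
    (hsol.v_cont.mono (prod_mono subset_rfl hsub))
  set m := v p.1 p.2 with hm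
  have hm0 : 0 < m := by
    rcases hp.2.1.eq_or_lt with h | h
    · rw [hm, ← h, hsol.v_init _ hp.1]
      exact hinit.2.2.2 _ hp.1
    · exact hsol.v_pos _ hp.1 _ ⟨h, (hsub hp.2).2⟩
  have hmle : ∀ y ∈ Icc a b, ∀ s ∈ Icc 0 t2, m ≤ v y s := fun y hy s hs =>
    hmin (show (y, s) ∈ _ from ⟨hy, hs⟩)
  set s0 := t2 / 2 with hs0
  have hs00 : 0 < s0 := by positivity
  set κ := (√T)⁻¹ * Real.exp (-((b - a) ^ 2) / (4 * s0)) with hκ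
  have hκ0 : 0 < κ := by positivity
  have hba : 0 < b - a := sub_pos.2 hab
  refine ⟨min m ((Real.exp T)⁻¹ * (√(4 * π))⁻¹ * (κ * m * (b - a))),
    lt_min hm0 (by positivity), ?_⟩
  intro x hx t ht htT
  by_cases htt : t ≤ t2
  · exact (min_le_left _ _).trans (hmle x (Ioo_subset_Icc_self hx) t ⟨ht.1.le, htt⟩)
  · push Not at htt
    refine (min_le_right _ _).trans ?_
    have hs0t : s0 ∈ Ioo 0 t := ⟨hs00, by linarith⟩
    have cv : ContinuousOn (fun y => v y s0) (Icc a b) :=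
      hsol.v_cont.comp (f := fun y => (y, s0)) (by fun_prop)
        (fun y hy => ⟨hy, hsub ⟨hs00.le, by linarith⟩⟩)
    have hF0 : κ * m * (b - a) ≤ dualF a b v x t s0 := by
      unfold dualF
      have : κ * m * (b - a) = ∫ y in a..b, κ * m := by
        rw [intervalIntegral.integral_const, smul_eq_mul, mul_comm]
      rw [this]
      apply intervalIntegral.integral_mono_on hab.le
      · exact intervalIntegrable_const
      · apply ContinuousOn.intervalIntegrable
        rw [uIcc_of_le hab.le]
        exact continuousOn_const.mul
          ((heatK_cont x (sub_pos.2 hs0t.2)).continuousOn.mul cv)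
      · intro y hy
        have k : κ ≤ heatK (y - x) (t - s0) :=
          heatK_lower hx hy hs00 (by linarith) (by linarith)
        have k4 := heatK_nonneg (y - x) (t - s0)
        have k2 := hmle y hy s0 ⟨hs00.le, by linarith⟩
        have k3 : 1 ≤ Real.exp s0 := Real.one_le_exp hs00.le
        calc κ * m = 1 * (κ * m) := by ring
          _ ≤ _ := by gcongr
    have hl := dualF_limit hab hsol hx ht hs0t.2 (A := κ * m * (b - a)) (by positivity)
      (fun s hs => hF0.trans (dualF_mono hab hsol hB0 hx ht hs0t
        ⟨hs00.trans_le hs.1, hs.2⟩ hs.1))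
    have hv0 := hsol.v_pos x (Ioo_subset_Icc_self hx) t ht
    have hpi : 0 < √(4 * π) := by positivity
    have he : Real.exp t ≤ Real.exp T := Real.exp_le_exp.2 htT.le
    calc _ ≤ (Real.exp T)⁻¹ * (√(4 * π))⁻¹ * (Real.exp T * (√(4 * π) * v x t)) := by
          refine mul_le_mul_of_nonneg_left (hl.trans ?_) (by positivity)
          gcongr
      _ = v x t := by field_simp

lemma part_two {a b χ : ℝ} (hab : a < b) {B1 B2 : ℝ → ℝ → ℝ} {u0 v0 : ℝ → ℝ}
    {Tmax : ℝ≥0∞} {u v : ℝ → ℝ → ℝ}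
    (hsol : CrimeSol a b χ B1 B2 u0 v0 u v Tmax)
    (hB0 : ∀ x t : ℝ, 0 ≤ B2 x t) (h2 : HypH2 a b B2) :
    ∃ C : ℝ, 0 < C ∧ ∀ x ∈ Ioo a b, ∀ t ∈ It' Tmax, 3 ≤ t → C ≤ v x t := by
  obtain ⟨c, hc, hcB⟩ := h2
  set κ := (√2)⁻¹ * Real.exp (-((b - a) ^ 2) / (4 * 1)) with hκ
  have hκ0 : 0 < κ := by positivity
  refine ⟨Real.exp (-2) * (√(4 * π))⁻¹ * (κ * c), by positivity, ?_⟩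
  intro x hx t ht ht3
  have hI : ∀ s ∈ Icc (t - 2) (t - 1), s ∈ Ioo 0 t := fun s hs =>
    ⟨by linarith [hs.1], by linarith [hs.2]⟩
  have hd := fun s (hs : s ∈ Icc (t - 2) (t - 1)) =>
    dualF_deriv hab hsol hB0 hx ht (hI s hs) (κ := κ)
    (fun y hy => heatK_lower hx hy one_pos (by linarith [hs.2]) (by linarith [hs.1]))
  have hmv := (convex_Icc (t - 2) (t - 1)).mul_sub_le_image_sub_of_le_deriv
    (f := dualF a b v x t) (C := Real.exp (t - 2) * (κ * c))
    (fun s hs => (hd s hs).1.continuousAt.continuousWithinAt)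
    (fun s hs => (hd s (interior_subset hs)).1.differentiableWithinAt)
    (fun s hs => by
      have hs' := interior_subset hs
      refine le_trans ?_ (hd s hs').2
      have := hcB s (hI s hs').1
      have := hs'.1
      gcongr)
    (t - 2) ⟨le_rfl, by linarith⟩ (t - 1) ⟨by linarith, le_rfl⟩ (by linarith)
  have hF0 : 0 ≤ dualF a b v x t (t - 2) := by
    unfold dualF
    apply intervalIntegral.integral_nonneg hab.le
    intro y hy
    have := hsol.v_pos y hy (t - 2) (It'_down ht (by linarith) (by linarith))
    have := heatK_nonneg (y - x) (t - (t - 2))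
    positivity
  have hF1 : Real.exp (t - 2) * (κ * c) ≤ dualF a b v x t (t - 1) := by
    have e : t - 1 - (t - 2) = 1 := by ring
    rw [e, mul_one] at hmv
    linarith
  have hl := dualF_limit hab hsol hx ht (s1 := t - 1) (by linarith)
    (A := Real.exp (t - 2) * (κ * c)) (by positivity)
    (fun s hs => hF1.trans (dualF_mono hab hsol hB0 hx ht (hI _ ⟨by linarith, le_rfl⟩)
      ⟨by linarith [hs.1], hs.2⟩ hs.1))
  have hpi : 0 < √(4 * π) := by positivity
  have e : Real.exp (t - 2) = Real.exp t * Real.exp (-2) := by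
    rw [← Real.exp_add]; congr 1
  rw [e, mul_assoc] at hl
  have hl2 := le_of_mul_le_mul_left hl (Real.exp_pos t)
  calc _ = (√(4 * π))⁻¹ * (Real.exp (-2) * (κ * c)) := by ring
    _ ≤ (√(4 * π))⁻¹ * (√(4 * π) * v x t) := by gcongr
    _ = v x t := by field_simp

/-- Lemma 2.3 (pointwise lower bound for `v`, uniform in time under (H2)). -/
theorem lower_bound_for_v
    (a b χ : ℝ) (hab : a < b) (hχ : 0 < χ)
    (B1 B2 : ℝ → ℝ → ℝ) (hB1 : HypB a b B1) (hB2 : HypB a b B2)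
    (u0 v0 : ℝ → ℝ) (hinit : HypInit a b u0 v0)
    (Tmax : ℝ≥0∞) (hT : 0 < Tmax)
    (u v : ℝ → ℝ → ℝ) (hsol : CrimeSol a b χ B1 B2 u0 v0 u v Tmax) :
    (∀ T : ℝ, 0 < T → ∃ C : ℝ, 0 < C ∧
      ∀ x ∈ Set.Ioo a b, ∀ t : ℝ, 0 < t →
        ENNReal.ofReal t < min (ENNReal.ofReal T) Tmax → C ≤ v x t) ∧
    (HypH2 a b B2 → ∃ C : ℝ, 0 < C ∧
      ∀ x ∈ Set.Ioo a b, ∀ t ∈ It' Tmax, C ≤ v x t) := by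
  have hB0 := hB2.1
  have h1 := part_one hab hT hinit hsol hB0
  constructor
  · intro T hT0
    obtain ⟨C, hC, h⟩ := h1 T hT0
    refine ⟨C, hC, fun x hx t ht htm => ?_⟩
    rw [lt_min_iff] at htm
    exact h x hx t ⟨ht, htm.2⟩ ((ENNReal.ofReal_lt_ofReal_iff hT0).1 htm.1)
  · intro h2
    obtain ⟨C, hC, h⟩ := h1 3 (by norm_num)
    obtain ⟨C', hC', h'⟩ := part_two hab hsol hB0 h2
    refine ⟨min C C', lt_min hC hC', fun x hx t ht => ?_⟩
    rcases lt_or_ge t 3 with h3 | h3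
    · exact (min_le_left _ _).trans (h x hx t ht h3)
    · exact (min_le_right _ _).trans (h' x hx t ht h3)
end
end
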